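/- Let β ∈ ℝ. Let a : ℝ → ℝ and b₁ : ℝ → ℝ be smooth functions such that for every k ≥ 0 and every N there is a constant C_{Nk} with |a^{(k)}(z)| + |b₁^{(k)}(z)| ≤ C_{Nk}(1+|z|)^{-N} for all z ∈ ℝ, and let b = b₀ + b₁ where b₀ is a constant. Define, for |x| < t, ρ = (t² − x²)^{1/2}, φ(ρ, x/ρ) = ρ + (3/8)β a(x/ρ)² ln ρ + b(x/ρ), and v₀(t,x) = ρ^{-1/2} a(x/ρ) cos φ(ρ, x/ρ), with v₀(t,x) = 0 when |x| ≥ t. Then there exist T < ∞, a constant C, and a smooth function v on [T,∞) × ℝ solving the nonlinear Klein–Gordon equation ∂_t²v − ∂_x²v + v = −β v³, such that for all t ≥ T: ‖(v − v₀)(t,·)‖_{L^∞(ℝ)} + Σ_{|α| ≤ 1} ‖∂_{t,x}^α (v − v₀)(t,·)‖_{L²(ℝ)} ≤ C (1 + ln(1+t))² (1+t)^{-1}. -/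

import Mathlib

open MeasureTheory Real

/-- Partial derivative in the first (time) variable. -/
noncomputable def pt (v : ℝ → ℝ → ℝ) (t x : ℝ) : ℝ := deriv (fun s => v s x) t

/-- Partial derivative in the second (space) variable. -/
noncomputable def px (v : ℝ → ℝ → ℝ) (t x : ℝ) : ℝ := deriv (fun z => v t z) x

/-- The d'Alembertian `□v = ∂_t² v − ∂_x² v`. -/
noncomputable def box (v : ℝ → ℝ → ℝ) (t x : ℝ) : ℝ :=
  pt (fun s z => pt v s z) t x - px (fun s z => px v s z) t x

namespace NLKG

open Set Filter Topology
open scoped ENNReal ContDiff NNReal Nat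

/-- Joint smoothness of a function of two real variables. -/
def Smooth2 (f : ℝ → ℝ → ℝ) : Prop := ContDiff ℝ (⊤ : ℕ∞) (fun p : ℝ × ℝ => f p.1 p.2)

/-- The linear form `(s, y) ↦ a s + b y`. -/
noncomputable def dlin (a b : ℝ) : ℝ × ℝ →L[ℝ] ℝ :=
  a • ContinuousLinearMap.fst ℝ ℝ ℝ + b • ContinuousLinearMap.snd ℝ ℝ ℝ

lemma dlin_apply (a b : ℝ) (u : ℝ × ℝ) : dlin a b u = a * u.1 + b * u.2 := by simp [dlin]

lemma hasDerivAt_fst_of_hasFDerivAt {f : ℝ → ℝ → ℝ} {t x a b : ℝ}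
    (h : HasFDerivAt (fun p : ℝ × ℝ => f p.1 p.2) (dlin a b) (t, x)) :
    HasDerivAt (fun s => f s x) a t := by
  have h2 : HasDerivAt (fun s : ℝ => ((s, x) : ℝ × ℝ)) (1, 0) t :=
    (hasDerivAt_id t).prodMk (hasDerivAt_const t x)
  have := h.comp_hasDerivAt t h2
  rw [dlin_apply] at this
  simp only [mul_one, mul_zero, add_zero] at this
  exact this

lemma hasDerivAt_snd_of_hasFDerivAt {f : ℝ → ℝ → ℝ} {t x a b : ℝ}
    (h : HasFDerivAt (fun p : ℝ × ℝ => f p.1 p.2) (dlin a b) (t, x)) :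
    HasDerivAt (fun z => f t z) b x := by
  have h2 : HasDerivAt (fun z : ℝ => ((t, z) : ℝ × ℝ)) (0, 1) x :=
    (hasDerivAt_const x t).prodMk (hasDerivAt_id x)
  have := h.comp_hasDerivAt x h2
  rw [dlin_apply] at this
  simp only [mul_one, mul_zero, zero_add] at this
  exact this

lemma pt_eq_of_hasFDerivAt {f : ℝ → ℝ → ℝ} {t x a b : ℝ}
    (h : HasFDerivAt (fun p : ℝ × ℝ => f p.1 p.2) (dlin a b) (t, x)) : pt f t x = a :=
  (hasDerivAt_fst_of_hasFDerivAt h).deriv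

lemma px_eq_of_hasFDerivAt {f : ℝ → ℝ → ℝ} {t x a b : ℝ}
    (h : HasFDerivAt (fun p : ℝ × ℝ => f p.1 p.2) (dlin a b) (t, x)) : px f t x = b :=
  (hasDerivAt_snd_of_hasFDerivAt h).deriv

lemma dlin_of_clm (L : ℝ × ℝ →L[ℝ] ℝ) : L = dlin (L (1, 0)) (L (0, 1)) := by
  ext <;> simp [dlin]

lemma hasFDerivAt_dlin {f : ℝ → ℝ → ℝ} {t x : ℝ}
    (h : DifferentiableAt ℝ (fun p : ℝ × ℝ => f p.1 p.2) (t, x)) :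
    HasFDerivAt (fun p : ℝ × ℝ => f p.1 p.2) (dlin (pt f t x) (px f t x)) (t, x) := by
  have h1 := h.hasFDerivAt
  rw [dlin_of_clm (fderiv ℝ (fun p : ℝ × ℝ => f p.1 p.2) (t, x))] at h1
  rwa [← pt_eq_of_hasFDerivAt h1, ← px_eq_of_hasFDerivAt h1] at h1

namespace Smooth2
variable {f g : ℝ → ℝ → ℝ}

lemma hasFDerivAt (h : Smooth2 f) (t x : ℝ) :
    HasFDerivAt (fun p : ℝ × ℝ => f p.1 p.2) (dlin (pt f t x) (px f t x)) (t, x) :=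
  hasFDerivAt_dlin ((ContDiff.differentiable h (by simp)) _)

lemma hasDerivAt_pt (h : Smooth2 f) (t x : ℝ) : HasDerivAt (fun s => f s x) (pt f t x) t :=
  hasDerivAt_fst_of_hasFDerivAt (h.hasFDerivAt t x)

lemma hasDerivAt_px (h : Smooth2 f) (t x : ℝ) : HasDerivAt (fun z => f t z) (px f t x) x :=
  hasDerivAt_snd_of_hasFDerivAt (h.hasFDerivAt t x)

lemma fderiv_eq (h : Smooth2 f) (p : ℝ × ℝ) :
    fderiv ℝ (fun p : ℝ × ℝ => f p.1 p.2) p = dlin (pt f p.1 p.2) (px f p.1 p.2) :=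
  (h.hasFDerivAt p.1 p.2).fderiv

lemma pt (h : Smooth2 f) : Smooth2 (pt f) := by
  have h1 : ContDiff ℝ (⊤ : ℕ∞) (fderiv ℝ (fun p : ℝ × ℝ => f p.1 p.2)) :=
    ContDiff.fderiv_right h (by simp)
  have h2 : ContDiff ℝ (⊤ : ℕ∞) (fun p => fderiv ℝ (fun p : ℝ × ℝ => f p.1 p.2) p (1, 0)) :=
    h1.clm_apply contDiff_const
  have h3 : (fun p : ℝ × ℝ => _root_.pt f p.1 p.2)
      = (fun p => fderiv ℝ (fun p : ℝ × ℝ => f p.1 p.2) p (1, 0)) := by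
    ext p; simp [h.fderiv_eq, dlin_apply]
  unfold Smooth2; rwa [h3]

lemma px (h : Smooth2 f) : Smooth2 (px f) := by
  have h1 : ContDiff ℝ (⊤ : ℕ∞) (fderiv ℝ (fun p : ℝ × ℝ => f p.1 p.2)) :=
    ContDiff.fderiv_right h (by simp)
  have h2 : ContDiff ℝ (⊤ : ℕ∞) (fun p => fderiv ℝ (fun p : ℝ × ℝ => f p.1 p.2) p (0, 1)) :=
    h1.clm_apply contDiff_const
  have h3 : (fun p : ℝ × ℝ => _root_.px f p.1 p.2)
      = (fun p => fderiv ℝ (fun p : ℝ × ℝ => f p.1 p.2) p (0, 1)) := by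
    ext p; simp [h.fderiv_eq, dlin_apply]
  unfold Smooth2; rwa [h3]

lemma add (hf : Smooth2 f) (hg : Smooth2 g) : Smooth2 (f + g) := ContDiff.add hf hg
lemma sub (hf : Smooth2 f) (hg : Smooth2 g) : Smooth2 (f - g) := ContDiff.sub hf hg
lemma mul (hf : Smooth2 f) (hg : Smooth2 g) : Smooth2 (f * g) := ContDiff.mul hf hg
lemma smul (c : ℝ) (hf : Smooth2 f) : Smooth2 (c • f) := ContDiff.const_smul c hf
lemma zero : Smooth2 0 := contDiff_const
lemma of_fst {h : ℝ → ℝ} (hh : ContDiff ℝ (⊤ : ℕ∞) h) : Smooth2 (fun t _ => h t) :=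
  hh.comp contDiff_fst
lemma of_snd {h : ℝ → ℝ} (hh : ContDiff ℝ (⊤ : ℕ∞) h) : Smooth2 (fun _ x => h x) :=
  hh.comp contDiff_snd

lemma slice (hf : Smooth2 f) (t : ℝ) : ContDiff ℝ (⊤ : ℕ∞) (f t) :=
  ContDiff.comp (g := fun p : ℝ × ℝ => f p.1 p.2) hf (contDiff_const.prodMk contDiff_id)

lemma continuous (hf : Smooth2 f) : Continuous (fun p : ℝ × ℝ => f p.1 p.2) := ContDiff.continuous hf
lemma continuous_slice (hf : Smooth2 f) (t : ℝ) : Continuous (f t) := (hf.slice t).continuous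

lemma pt_add (hf : Smooth2 f) (hg : Smooth2 g) :
    _root_.pt (f + g) = _root_.pt f + _root_.pt g := by
  ext t x; exact ((hf.hasDerivAt_pt t x).add (hg.hasDerivAt_pt t x)).deriv
lemma px_add (hf : Smooth2 f) (hg : Smooth2 g) :
    _root_.px (f + g) = _root_.px f + _root_.px g := by
  ext t x; exact ((hf.hasDerivAt_px t x).add (hg.hasDerivAt_px t x)).deriv
lemma pt_sub (hf : Smooth2 f) (hg : Smooth2 g) :
    _root_.pt (f - g) = _root_.pt f - _root_.pt g := by
  ext t x; exact ((hf.hasDerivAt_pt t x).sub (hg.hasDerivAt_pt t x)).deriv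
lemma px_sub (hf : Smooth2 f) (hg : Smooth2 g) :
    _root_.px (f - g) = _root_.px f - _root_.px g := by
  ext t x; exact ((hf.hasDerivAt_px t x).sub (hg.hasDerivAt_px t x)).deriv
lemma pt_mul (hf : Smooth2 f) (hg : Smooth2 g) :
    _root_.pt (f * g) = _root_.pt f * g + f * _root_.pt g := by
  ext t x; exact ((hf.hasDerivAt_pt t x).mul (hg.hasDerivAt_pt t x)).deriv
lemma px_mul (hf : Smooth2 f) (hg : Smooth2 g) :
    _root_.px (f * g) = _root_.px f * g + f * _root_.px g := by
  ext t x; exact ((hf.hasDerivAt_px t x).mul (hg.hasDerivAt_px t x)).deriv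
lemma pt_smul (c : ℝ) (hf : Smooth2 f) : _root_.pt (c • f) = c • _root_.pt f := by
  ext t x; exact ((hf.hasDerivAt_pt t x).const_mul c).deriv
lemma px_smul (c : ℝ) (hf : Smooth2 f) : _root_.px (c • f) = c • _root_.px f := by
  ext t x; exact ((hf.hasDerivAt_px t x).const_mul c).deriv

lemma pt_px_comm (hf : Smooth2 f) : _root_.pt (_root_.px f) = _root_.px (_root_.pt f) := by
  have h1 : ContDiff ℝ (⊤ : ℕ∞) (fderiv ℝ (fun p : ℝ × ℝ => f p.1 p.2)) :=
    ContDiff.fderiv_right hf (by simp)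
  ext t x
  have h2 := (ContDiff.differentiable h1 (by simp) (t, x)).hasFDerivAt
  have hs := second_derivative_symmetric
    (fun p => (ContDiff.differentiable hf (by simp) p).hasFDerivAt) h2 (1, 0) (0, 1)
  have ha : HasFDerivAt (fun p : ℝ × ℝ => _root_.px f p.1 p.2)
      ((ContinuousLinearMap.apply ℝ ℝ ((0 : ℝ), (1 : ℝ))).comp
        (fderiv ℝ (fderiv ℝ (fun p : ℝ × ℝ => f p.1 p.2)) (t, x))) (t, x) := by
    have := (ContinuousLinearMap.apply ℝ ℝ ((0 : ℝ), (1 : ℝ))).hasFDerivAt.comp (t, x) h2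
    refine this.congr_of_eventuallyEq (Eventually.of_forall fun p => ?_)
    simp [hf.fderiv_eq, dlin_apply]
  have hb : HasFDerivAt (fun p : ℝ × ℝ => _root_.pt f p.1 p.2)
      ((ContinuousLinearMap.apply ℝ ℝ ((1 : ℝ), (0 : ℝ))).comp
        (fderiv ℝ (fderiv ℝ (fun p : ℝ × ℝ => f p.1 p.2)) (t, x))) (t, x) := by
    have := (ContinuousLinearMap.apply ℝ ℝ ((1 : ℝ), (0 : ℝ))).hasFDerivAt.comp (t, x) h2
    refine this.congr_of_eventuallyEq (Eventually.of_forall fun p => ?_)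
    simp [hf.fderiv_eq, dlin_apply]
  rw [dlin_of_clm (ContinuousLinearMap.comp _ _)] at ha hb
  rw [pt_eq_of_hasFDerivAt ha, px_eq_of_hasFDerivAt hb]
  simpa using hs

end Smooth2

/-- A family of functions on an open set that is closed under taking both partial derivatives
consists of smooth functions. -/
lemma contDiffOn_of_closed_family {Ω : Set (ℝ × ℝ)} (hΩ : IsOpen Ω) (F : Set (ℝ × ℝ → ℝ))
    (hF : ∀ f ∈ F, ∃ f₁ ∈ F, ∃ f₂ ∈ F, ∀ p ∈ Ω, HasFDerivAt f (dlin (f₁ p) (f₂ p)) p)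
    {f : ℝ × ℝ → ℝ} (hf : f ∈ F) : ContDiffOn ℝ (⊤ : ℕ∞) f Ω := by
  have key : ∀ n : ℕ, ∀ f ∈ F, ContDiffOn ℝ n f Ω := by
    intro n
    induction n with
    | zero =>
      intro f hf
      obtain ⟨f₁, -, f₂, -, h⟩ := hF f hf
      exact contDiffOn_zero.2 fun p hp => (h p hp).continuousAt.continuousWithinAt
    | succ n ih =>
      intro f hf
      obtain ⟨f₁, h₁, f₂, h₂, h⟩ := hF f hf
      push_cast
      rw [contDiffOn_succ_iff_fderiv_of_isOpen hΩ]
      refine ⟨fun p hp => (h p hp).differentiableAt.differentiableWithinAt, by simp, ?_⟩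
      have : ContDiffOn ℝ n (fun p => dlin (f₁ p) (f₂ p)) Ω :=
        ((ih f₁ h₁).smul contDiffOn_const).add ((ih f₂ h₂).smul contDiffOn_const)
      exact this.congr fun p hp => (h p hp).fderiv
  exact contDiffOn_infty.2 fun n => key n f hf

/-- Sum of `N` over all mixed partial derivatives of order `n` (counted as words). -/
noncomputable def cN (N : (ℝ → ℝ → ℝ) → ℝ≥0∞) : ℕ → (ℝ → ℝ → ℝ) → ℝ≥0∞
  | 0, f => N f
  | n + 1, f => cN N n (pt f) + cN N n (px f)

/-- The Taylor weight `ε ^ n / n!`. -/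
noncomputable def wt (ε : ℝ≥0) (n : ℕ) : ℝ≥0∞ := ((ε ^ n / (n ! : ℝ≥0) : ℝ≥0) : ℝ≥0∞)

/-- The weighted jet functional of order `k`. -/
noncomputable def jet (N : (ℝ → ℝ → ℝ) → ℝ≥0∞) (k : ℕ) (ε : ℝ≥0) (f : ℝ → ℝ → ℝ) : ℝ≥0∞ :=
  ∑ n ∈ Finset.range (k + 1), wt ε n * cN N n f

/-- Subadditivity on smooth functions. -/
def SubAdd (N : (ℝ → ℝ → ℝ) → ℝ≥0∞) : Prop :=
  ∀ f g, Smooth2 f → Smooth2 g → N (f + g) ≤ N f + N g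

lemma wt_zero (ε : ℝ≥0) : wt ε 0 = 1 := by simp [wt]

lemma wt_ne_top (ε : ℝ≥0) (n : ℕ) : wt ε n ≠ ⊤ := ENNReal.coe_ne_top

lemma wt_ne_zero {ε : ℝ≥0} (hε : 0 < ε) (n : ℕ) : wt ε n ≠ 0 := by
  rw [wt, Ne, ENNReal.coe_eq_zero]
  positivity

lemma wt_mul_choose (ε : ℝ≥0) (i j : ℕ) :
    wt ε (i + j) * ((i + j).choose i : ℝ≥0∞) = wt ε i * wt ε j := by
  have h : ((i + j).choose i : ℝ≥0∞) = (((i + j).choose i : ℝ≥0) : ℝ≥0∞) := by simp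
  rw [h, wt, wt, wt, ← ENNReal.coe_mul, ← ENNReal.coe_mul, ENNReal.coe_inj]
  have h2 : ((i + j).choose i : ℝ≥0) * (i ! : ℝ≥0) * (j ! : ℝ≥0) = ((i + j)! : ℝ≥0) := by
    have := Nat.add_choose_mul_factorial_mul_factorial i j
    rw [← Nat.choose_symm_add] at this
    exact_mod_cast this
  have h3 : ((i + j)! : ℝ≥0) ≠ 0 := by positivity
  have h4 : (i ! : ℝ≥0) ≠ 0 := by positivity
  have h5 : (j ! : ℝ≥0) ≠ 0 := by positivity
  rw [div_mul_eq_mul_div, div_mul_div_comm, div_eq_div_iff h3 (by positivity), ← h2, pow_add]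
  ring

section
variable {N N₁ N₂ N₃ : (ℝ → ℝ → ℝ) → ℝ≥0∞} {f g : ℝ → ℝ → ℝ}

lemma cN_add_le (hN : SubAdd N) (n : ℕ) : SubAdd (cN N n) := by
  induction n with
  | zero => exact hN
  | succ n ih =>
    intro f g hf hg
    simp only [cN]
    rw [Smooth2.pt_add hf hg, Smooth2.px_add hf hg]
    calc _ ≤ (cN N n (pt f) + cN N n (pt g)) + (cN N n (px f) + cN N n (px g)) :=
          add_le_add (ih _ _ hf.pt hg.pt) (ih _ _ hf.px hg.px)
      _ = _ := by ring

lemma jet_add_le (hN : SubAdd N) (k : ℕ) (ε : ℝ≥0) : SubAdd (jet N k ε) := by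
  intro f g hf hg
  rw [jet, jet, jet, ← Finset.sum_add_distrib]
  refine Finset.sum_le_sum fun n _ => ?_
  rw [← mul_add]
  exact mul_le_mul_right (cN_add_le hN n f g hf hg) _

lemma cN_smul (hN : ∀ (c : ℝ) f, N (c • f) = ‖c‖ₑ * N f) (c : ℝ) (n : ℕ) (hf : Smooth2 f) :
    cN N n (c • f) = ‖c‖ₑ * cN N n f := by
  induction n generalizing f with
  | zero => exact hN c f
  | succ n ih =>
    simp only [cN]
    rw [Smooth2.pt_smul c hf, Smooth2.px_smul c hf, ih hf.pt, ih hf.px, mul_add]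

lemma jet_smul (hN : ∀ (c : ℝ) f, N (c • f) = ‖c‖ₑ * N f) (c : ℝ) (k : ℕ) (ε : ℝ≥0)
    (hf : Smooth2 f) : jet N k ε (c • f) = ‖c‖ₑ * jet N k ε f := by
  rw [jet, jet, Finset.mul_sum]
  refine Finset.sum_congr rfl fun n _ => ?_
  rw [cN_smul hN c n hf, mul_left_comm]

lemma cN_mul_le (hadd : SubAdd N₃)
    (hmul : ∀ f g, Smooth2 f → Smooth2 g → N₃ (f * g) ≤ N₁ f * N₂ g) (n : ℕ)
    (hf : Smooth2 f) (hg : Smooth2 g) :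
    cN N₃ n (f * g) ≤ ∑ ij ∈ Finset.HasAntidiagonal.antidiagonal n,
      (n.choose ij.1 : ℝ≥0∞) * (cN N₁ ij.1 f * cN N₂ ij.2 g) := by
  induction n generalizing f g with
  | zero => simpa [cN] using hmul f g hf hg
  | succ n ih =>
    rw [Finset.sum_antidiagonal_choose_succ_mul (fun i j => cN N₁ i f * cN N₂ j g)]
    simp only [cN]
    rw [Smooth2.pt_mul hf hg, Smooth2.px_mul hf hg]
    have e1 := (cN_add_le hadd n _ _ (hf.pt.mul hg) (hf.mul hg.pt)).trans
      (add_le_add (ih hf.pt hg) (ih hf hg.pt))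
    have e2 := (cN_add_le hadd n _ _ (hf.px.mul hg) (hf.mul hg.px)).trans
      (add_le_add (ih hf.px hg) (ih hf hg.px))
    refine (add_le_add e1 e2).trans (le_of_eq ?_)
    simp only [← Finset.sum_add_distrib]
    refine Finset.sum_congr rfl fun ij hij => ?_
    have : n.choose ij.2 = n.choose ij.1 :=
      Nat.choose_symm_of_eq_add (by rw [← Finset.HasAntidiagonal.mem_antidiagonal.1 hij, add_comm])
    rw [this]
    ring

lemma jet_mul_le (hadd : SubAdd N₃)
    (hmul : ∀ f g, Smooth2 f → Smooth2 g → N₃ (f * g) ≤ N₁ f * N₂ g) (k : ℕ) (ε : ℝ≥0)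
    (hf : Smooth2 f) (hg : Smooth2 g) :
    jet N₃ k ε (f * g) ≤ jet N₁ k ε f * jet N₂ k ε g := by
  rw [jet, jet, jet, Finset.sum_mul_sum, ← Finset.sum_product']
  calc _ ≤ ∑ n ∈ Finset.range (k + 1), ∑ ij ∈ Finset.HasAntidiagonal.antidiagonal n,
        (wt ε ij.1 * cN N₁ ij.1 f) * (wt ε ij.2 * cN N₂ ij.2 g) := by
        refine Finset.sum_le_sum fun n _ => ?_
        refine (mul_le_mul_right (cN_mul_le hadd hmul n hf hg) _).trans (le_of_eq ?_)
        rw [Finset.mul_sum]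
        refine Finset.sum_congr rfl fun ij hij => ?_
        rw [← Finset.HasAntidiagonal.mem_antidiagonal.1 hij, ← mul_assoc, wt_mul_choose]
        ring
    _ ≤ _ := by
        rw [← Finset.sum_biUnion]
        · refine Finset.sum_le_sum_of_subset fun ij hij => ?_
          simp only [Finset.mem_biUnion, Finset.mem_range, Finset.HasAntidiagonal.mem_antidiagonal] at hij
          obtain ⟨n, hn, h⟩ := hij
          simp only [Finset.mem_product, Finset.mem_range]
          omega
        · intro n _ m _ hnm
          refine Finset.disjoint_left.2 fun ij h1 h2 => hnm ?_
          rw [← Finset.HasAntidiagonal.mem_antidiagonal.1 h1, Finset.HasAntidiagonal.mem_antidiagonal.1 h2]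

lemma cN_le_jet {k n : ℕ} (hn : n ≤ k) {ε : ℝ≥0} (hε : 0 < ε) :
    cN N n f ≤ (wt ε n)⁻¹ * jet N k ε f := by
  have h : wt ε n * cN N n f ≤ jet N k ε f :=
    Finset.single_le_sum (f := fun n => wt ε n * cN N n f) (fun _ _ => zero_le)
      (Finset.mem_range.2 (Nat.lt_succ_of_le hn))
  calc cN N n f = (wt ε n)⁻¹ * (wt ε n * cN N n f) := by
        rw [← mul_assoc, ENNReal.inv_mul_cancel (wt_ne_zero hε n) (wt_ne_top ε n), one_mul]
    _ ≤ _ := mul_le_mul_right h _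

lemma le_jet (k : ℕ) (ε : ℝ≥0) : N f ≤ jet N k ε f := by
  have h := Finset.single_le_sum (f := fun n => wt ε n * cN N n f) (fun _ _ => zero_le)
      (Finset.mem_range.2 (Nat.succ_pos k))
  simpa [jet, wt_zero, cN] using h

end

/-- Jets of positive order can be made negligible by choosing the Taylor scale small. -/
lemma exists_small_scale (X : ℕ → ℝ≥0∞) (hX : ∀ n, X n ≠ ⊤) (k : ℕ) {η : ℝ≥0∞} (hη : 0 < η) :
    ∃ ε : ℝ≥0, 0 < ε ∧ ∑ n ∈ Finset.range k, wt ε (n + 1) * X (n + 1) ≤ η := by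
  set S := ∑ n ∈ Finset.range k, X (n + 1) with hS
  have hS' : S ≠ ⊤ := by simp [hS, ENNReal.sum_eq_top, hX]
  obtain ⟨δ, hδ, hδ'⟩ := ENNReal.exists_nnreal_pos_mul_lt hS' hη.ne'
  refine ⟨min δ 1, by positivity, ?_⟩
  calc _ ≤ ∑ n ∈ Finset.range k, (δ : ℝ≥0∞) * X (n + 1) := by
        refine Finset.sum_le_sum fun n _ => mul_le_mul_left ?_ _
        rw [wt, ENNReal.coe_le_coe]
        calc (min δ 1) ^ (n + 1) / ((n + 1)! : ℝ≥0) ≤ (min δ 1) ^ (n + 1) :=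
              div_le_self zero_le (by exact_mod_cast Nat.succ_le_of_lt (Nat.factorial_pos _))
          _ ≤ (min δ 1) ^ 1 := pow_le_pow_of_le_one zero_le (min_le_right _ _) (by omega)
          _ ≤ δ := by rw [pow_one]; exact min_le_left _ _
    _ = δ * S := by rw [hS, Finset.mul_sum]
    _ ≤ η := hδ'.le

lemma jet_le_of_scale {N : (ℝ → ℝ → ℝ) → ℝ≥0∞} {X : ℕ → ℝ≥0∞} {k : ℕ} {ε : ℝ≥0} {η : ℝ≥0∞}
    (h : ∑ n ∈ Finset.range k, wt ε (n + 1) * X (n + 1) ≤ η) {f : ℝ → ℝ → ℝ}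
    (hf : ∀ n, cN N (n + 1) f ≤ X (n + 1)) : jet N k ε f ≤ N f + η := by
  rw [jet, Finset.sum_range_succ', wt_zero, one_mul, add_comm]
  exact add_le_add le_rfl
    ((Finset.sum_le_sum fun n _ => mul_le_mul_right (hf n) _).trans h)

/-- Weighted supremum norm on `t ≥ T`. -/
noncomputable def Nsup (σ T : ℝ) (f : ℝ → ℝ → ℝ) : ℝ≥0∞ :=
  ⨆ (t : ℝ) (_ : T ≤ t) (x : ℝ), ENNReal.ofReal (t ^ σ) * ‖f t x‖ₑ

/-- Weighted norm `sup_{t ≥ T} t^σ ‖f(t,·)‖_{L²}`. -/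
noncomputable def Ntwo (σ T : ℝ) (f : ℝ → ℝ → ℝ) : ℝ≥0∞ :=
  ⨆ (t : ℝ) (_ : T ≤ t), ENNReal.ofReal (t ^ σ) * eLpNorm (f t) 2 volume

section
variable {σ σ₁ σ₂ T : ℝ} {f g : ℝ → ℝ → ℝ}

lemma Nsup_le_iff {a : ℝ≥0∞} :
    Nsup σ T f ≤ a ↔ ∀ t, T ≤ t → ∀ x, ENNReal.ofReal (t ^ σ) * ‖f t x‖ₑ ≤ a := by
  simp [Nsup, iSup_le_iff]

lemma Ntwo_le_iff {a : ℝ≥0∞} :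
    Ntwo σ T f ≤ a ↔ ∀ t, T ≤ t → ENNReal.ofReal (t ^ σ) * eLpNorm (f t) 2 volume ≤ a := by
  simp [Ntwo, iSup_le_iff]

lemma le_Nsup {t : ℝ} (ht : T ≤ t) (x : ℝ) :
    ENNReal.ofReal (t ^ σ) * ‖f t x‖ₑ ≤ Nsup σ T f := Nsup_le_iff.1 le_rfl t ht x

lemma le_Ntwo {t : ℝ} (ht : T ≤ t) :
    ENNReal.ofReal (t ^ σ) * eLpNorm (f t) 2 volume ≤ Ntwo σ T f := Ntwo_le_iff.1 le_rfl t ht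

lemma Nsup_subAdd (σ T : ℝ) : SubAdd (Nsup σ T) := by
  intro f g _ _
  refine Nsup_le_iff.2 fun t ht x => ?_
  calc _ ≤ ENNReal.ofReal (t ^ σ) * (‖f t x‖ₑ + ‖g t x‖ₑ) :=
        mul_le_mul_right (enorm_add_le _ _) _
    _ ≤ _ := by rw [mul_add]; exact add_le_add (le_Nsup ht x) (le_Nsup ht x)

lemma Ntwo_subAdd (σ T : ℝ) : SubAdd (Ntwo σ T) := by
  intro f g hf hg
  refine Ntwo_le_iff.2 fun t ht => ?_
  calc _ ≤ ENNReal.ofReal (t ^ σ) * (eLpNorm (f t) 2 volume + eLpNorm (g t) 2 volume) :=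
        mul_le_mul_right (eLpNorm_add_le (hf.continuous_slice t).aestronglyMeasurable
          (hg.continuous_slice t).aestronglyMeasurable (by norm_num)) _
    _ ≤ _ := by rw [mul_add]; exact add_le_add (le_Ntwo ht) (le_Ntwo ht)

lemma ofReal_rpow_add {t : ℝ} (ht : 0 < t) (σ₁ σ₂ : ℝ) :
    ENNReal.ofReal (t ^ (σ₁ + σ₂)) = ENNReal.ofReal (t ^ σ₁) * ENNReal.ofReal (t ^ σ₂) := by
  rw [Real.rpow_add ht, ENNReal.ofReal_mul (by positivity)]

lemma Nsup_mul (hT : 0 < T) (f g : ℝ → ℝ → ℝ) :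
    Nsup (σ₁ + σ₂) T (f * g) ≤ Nsup σ₁ T f * Nsup σ₂ T g := by
  refine Nsup_le_iff.2 fun t ht x => ?_
  rw [ofReal_rpow_add (hT.trans_le ht), Pi.mul_apply, Pi.mul_apply, enorm_mul]
  calc _ = (ENNReal.ofReal (t ^ σ₁) * ‖f t x‖ₑ) * (ENNReal.ofReal (t ^ σ₂) * ‖g t x‖ₑ) := by ring
    _ ≤ _ := mul_le_mul' (le_Nsup ht x) (le_Nsup ht x)

lemma eLpNorm_mul_le_of_sup {u v : ℝ → ℝ} {a : ℝ≥0∞} (hu : ∀ x, ‖u x‖ₑ ≤ a)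
    (hu' : Continuous u) (hv : Continuous v) :
    eLpNorm (u * v) 2 volume ≤ a * eLpNorm v 2 volume := by
  have := eLpNorm_smul_le_mul_eLpNorm (p := ⊤) (q := 2) (r := 2) (μ := (volume : Measure ℝ))
    hv.aestronglyMeasurable hu'.aestronglyMeasurable
  refine this.trans (mul_le_mul_left ?_ _)
  rw [eLpNorm_exponent_top]
  exact essSup_le_of_ae_le _ (Eventually.of_forall hu)

lemma Ntwo_mul (hT : 0 < T) (hf : Smooth2 f) (hg : Smooth2 g) :
    Ntwo (σ₁ + σ₂) T (f * g) ≤ Nsup σ₁ T f * Ntwo σ₂ T g := by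
  refine Ntwo_le_iff.2 fun t ht => ?_
  have ht0 := hT.trans_le ht
  have h0 : ENNReal.ofReal (t ^ σ₁) ≠ 0 := by
    simpa using Real.rpow_pos_of_pos ht0 σ₁
  have h1 := eLpNorm_mul_le_of_sup (u := f t) (v := g t)
    (a := (ENNReal.ofReal (t ^ σ₁))⁻¹ * Nsup σ₁ T f) (fun x => by
      calc ‖f t x‖ₑ = (ENNReal.ofReal (t ^ σ₁))⁻¹ * (ENNReal.ofReal (t ^ σ₁) * ‖f t x‖ₑ) := by
            rw [← mul_assoc, ENNReal.inv_mul_cancel h0 ENNReal.ofReal_ne_top, one_mul]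
        _ ≤ _ := mul_le_mul_right (le_Nsup ht x) _) (hf.continuous_slice t) (hg.continuous_slice t)
  rw [ofReal_rpow_add ht0]
  calc _ ≤ ENNReal.ofReal (t ^ σ₁) * ENNReal.ofReal (t ^ σ₂) *
        ((ENNReal.ofReal (t ^ σ₁))⁻¹ * Nsup σ₁ T f * eLpNorm (g t) 2 volume) :=
        mul_le_mul_right h1 _
    _ = (ENNReal.ofReal (t ^ σ₁) * (ENNReal.ofReal (t ^ σ₁))⁻¹) * Nsup σ₁ T f *
        (ENNReal.ofReal (t ^ σ₂) * eLpNorm (g t) 2 volume) := by ring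
    _ ≤ _ := by
        rw [ENNReal.mul_inv_cancel h0 ENNReal.ofReal_ne_top, one_mul]
        exact mul_le_mul_right (le_Ntwo ht) _

lemma Nsup_smul (c : ℝ) (f : ℝ → ℝ → ℝ) : Nsup σ T (c • f) = ‖c‖ₑ * Nsup σ T f := by
  simp only [Nsup, ENNReal.mul_iSup, Pi.smul_apply, smul_eq_mul, enorm_mul, mul_left_comm]

lemma Ntwo_smul (c : ℝ) (f : ℝ → ℝ → ℝ) : Ntwo σ T (c • f) = ‖c‖ₑ * Ntwo σ T f := by
  simp only [Ntwo, ENNReal.mul_iSup, Pi.smul_apply, eLpNorm_const_smul, mul_left_comm]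

lemma Nsup_mono_weight (hT : 1 ≤ T) (h : σ₁ ≤ σ₂) (f : ℝ → ℝ → ℝ) :
    Nsup σ₁ T f ≤ Nsup σ₂ T f :=
  Nsup_le_iff.2 fun _ ht x => (mul_le_mul_left (ENNReal.ofReal_le_ofReal
    (Real.rpow_le_rpow_of_exponent_le (hT.trans ht) h)) _).trans (le_Nsup ht x)

lemma Nsup_mono_time {T' : ℝ} (h : T ≤ T') (f : ℝ → ℝ → ℝ) :
    Nsup σ T' f ≤ Nsup σ T f :=
  Nsup_le_iff.2 fun _ ht x => le_Nsup (h.trans ht) x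

lemma Ntwo_mono_time {T' : ℝ} (h : T ≤ T') (f : ℝ → ℝ → ℝ) :
    Ntwo σ T' f ≤ Ntwo σ T f :=
  Ntwo_le_iff.2 fun _ ht => le_Ntwo (h.trans ht)

end

lemma hasFDerivAt_congr {f g : ℝ × ℝ → ℝ} {f' g' : ℝ × ℝ →L[ℝ] ℝ} {p : ℝ × ℝ}
    (h : HasFDerivAt f f' p) (hf : ∀ q, g q = f q) (hf' : ∀ u, g' u = f' u) :
    HasFDerivAt g g' p := by
  obtain rfl : g = f := funext hf
  obtain rfl : g' = f' := ContinuousLinearMap.ext hf'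
  exact h

/-- The entire function with Taylor coefficients `c`. -/
noncomputable def pser (c : ℕ → ℝ) (s : ℝ) : ℝ := ∑' n, c n * s ^ n

lemma summable_pser {c : ℕ → ℝ} (hc : ∀ n, |c n| ≤ 1 / (n ! : ℝ)) (s : ℝ) :
    Summable fun n => c n * s ^ n := by
  refine Summable.of_norm_bounded (Real.summable_pow_div_factorial |s|) fun n => ?_
  rw [Real.norm_eq_abs, abs_mul, abs_pow]
  calc _ ≤ 1 / (n ! : ℝ) * |s| ^ n := by gcongr; exact hc n
    _ = _ := by ring

lemma deriv_coeff_le {c : ℕ → ℝ} (hc : ∀ n, |c n| ≤ 1 / (n ! : ℝ)) (n : ℕ) :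
    |((n : ℝ) + 1) * c (n + 1)| ≤ 1 / (n ! : ℝ) := by
  rw [abs_mul, abs_of_nonneg (by positivity)]
  calc _ ≤ ((n : ℝ) + 1) * (1 / ((n + 1)! : ℝ)) := by gcongr; exact hc _
    _ = _ := by
      rw [Nat.factorial_succ]; push_cast; field_simp

lemma hasDerivAt_pser {c : ℕ → ℝ} (hc : ∀ n, |c n| ≤ 1 / (n ! : ℝ)) (s : ℝ) :
    HasDerivAt (pser c) (pser (fun n => ((n : ℝ) + 1) * c (n + 1)) s) s := by
  have hs : Summable fun n : ℕ => (|s| + 1) ^ (n - 1) / ((n - 1)! : ℝ) := by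
    rw [← summable_nat_add_iff 1]
    simpa using Real.summable_pow_div_factorial (|s| + 1)
  have h := hasDerivAt_tsum_of_isPreconnected (g := fun n z => c n * z ^ n)
    (g' := fun n z => c n * (n * z ^ (n - 1))) (t := Metric.ball (0 : ℝ) (|s| + 1)) (y := s)
    (y₀ := s) hs Metric.isOpen_ball (convex_ball _ _).isPreconnected
    (fun n y _ => (hasDerivAt_pow n y).const_mul (c n)) ?_ (by simp)
    (summable_pser hc s) (by simp)
  · refine HasDerivAt.congr_deriv (f := pser c) h ?_
    rw [pser, tsum_eq_zero_add' (f := fun n => c n * (n * s ^ (n - 1)))]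
    · simp only [Nat.cast_zero, zero_mul, mul_zero, zero_add, Nat.add_sub_cancel]
      refine tsum_congr fun n => ?_
      push_cast; ring
    · refine (summable_pser (deriv_coeff_le hc) s).congr fun n => ?_
      simp only [Nat.add_sub_cancel]; push_cast; ring
  · intro n y hy
    rcases n with _ | n
    · simp
    · simp only [Nat.add_sub_cancel]
      have hy' : |y| ≤ |s| + 1 := by
        simpa using (Metric.mem_ball.1 hy).le
      rw [Real.norm_eq_abs, abs_mul, abs_mul, abs_pow, Nat.abs_cast]
      calc |c (n + 1)| * (((n + 1 : ℕ) : ℝ) * |y| ^ n)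
          ≤ 1 / ((n + 1)! : ℝ) * (((n + 1 : ℕ) : ℝ) * (|s| + 1) ^ n) := by
            gcongr; exact hc _
        _ = _ := by rw [Nat.factorial_succ]; push_cast; field_simp

/-- Taylor coefficients of the Bessel-type function solving `s K'' + K' + K / 4 = 0`. -/
noncomputable def kc (n : ℕ) : ℝ := (-1 / 4) ^ n / (n ! : ℝ) ^ 2

lemma kc_le (n : ℕ) : |kc n| ≤ 1 / (n ! : ℝ) := by
  have h1 : (1 : ℝ) ≤ n ! := by exact_mod_cast Nat.factorial_pos n
  rw [kc, abs_div, abs_pow, abs_of_nonneg (show (0 : ℝ) ≤ (n ! : ℝ) ^ 2 by positivity),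
    div_le_div_iff₀ (by positivity) (by positivity)]
  have h2 : |(-1 / 4 : ℝ)| ^ n ≤ 1 := pow_le_one₀ (abs_nonneg _) (by norm_num [abs_of_neg])
  calc _ ≤ 1 * (n ! : ℝ) := by gcongr
    _ ≤ _ := by nlinarith

/-- The Riemann function of the Klein–Gordon operator in terms of the product of the
null coordinates. -/
noncomputable def K0 : ℝ → ℝ := pser kc
noncomputable def K1 : ℝ → ℝ := pser (fun n => ((n : ℝ) + 1) * kc (n + 1))
noncomputable def K2 : ℝ → ℝ := pser (fun n => ((n : ℝ) + 1) * (((n + 1 : ℕ) : ℝ) + 1) * kc (n + 1 + 1))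

lemma hasDerivAt_K0 (s : ℝ) : HasDerivAt K0 (K1 s) s := hasDerivAt_pser kc_le s

lemma hasDerivAt_K1 (s : ℝ) : HasDerivAt K1 (K2 s) s := by
  refine (hasDerivAt_pser (deriv_coeff_le kc_le) s).congr_deriv ?_
  simp only [K2, mul_assoc]

lemma K0_zero : K0 0 = 1 := by
  rw [K0, pser, tsum_eq_single 0]
  · simp [kc]
  · intro n hn; simp [hn]

lemma K_ode (s : ℝ) : s * K2 s + K1 s = -(1 / 4) * K0 s := by
  have h0 := summable_pser kc_le s
  have h1 := summable_pser (deriv_coeff_le kc_le) s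
  have h2 : Summable fun n : ℕ => ((n : ℝ) + 1) * (((n + 1 : ℕ) : ℝ) + 1) * kc (n + 1 + 1) * s ^ n := by
    refine (summable_pser (deriv_coeff_le (deriv_coeff_le kc_le)) s).congr fun n => ?_
    ring
  have e : s * K2 s = ∑' n : ℕ, (n : ℝ) * ((n : ℝ) + 1) * kc (n + 1) * s ^ n := by
    rw [tsum_eq_zero_add' (f := fun n : ℕ => (n : ℝ) * ((n : ℝ) + 1) * kc (n + 1) * s ^ n)]
    · simp only [Nat.cast_zero, zero_mul, zero_add]
      rw [K2, pser, ← tsum_mul_left]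
      refine tsum_congr fun n => ?_
      push_cast; ring
    · refine (h2.mul_left s).congr fun n => ?_
      push_cast; ring
  have hs : Summable fun n : ℕ => (n : ℝ) * ((n : ℝ) + 1) * kc (n + 1) * s ^ n := by
    rw [← summable_nat_add_iff 1]
    refine (h2.mul_left s).congr fun n => ?_
    push_cast; ring
  rw [e, K1, pser, ← hs.tsum_add h1, K0, pser, ← tsum_mul_left]
  refine tsum_congr fun n => ?_
  have : ((n : ℝ) + 1) ^ 2 * kc (n + 1) = -(1 / 4) * kc n := by
    rw [kc, kc, Nat.factorial_succ]; push_cast; field_simp; ring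
  linear_combination s ^ n * this

lemma continuous_K0 : Continuous K0 :=
  continuous_iff_continuousAt.2 fun s => (hasDerivAt_K0 s).continuousAt
lemma continuous_K1 : Continuous K1 :=
  continuous_iff_continuousAt.2 fun s => (hasDerivAt_K1 s).continuousAt

/-- Smooth functions with support bounded below in time and inside a backward light cone. -/
def CS (g : ℝ → ℝ → ℝ) : Prop :=
  Smooth2 g ∧ ∃ a R : ℝ, ∀ t x, (t < a ∨ R < |x| + t) → g t x = 0

/-- Null coordinates. -/
noncomputable def nul (g : ℝ → ℝ → ℝ) (z : ℝ × ℝ) : ℝ := g ((z.1 + z.2) / 2) ((z.1 - z.2) / 2)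

/-- The fundamental solution in null coordinates. -/
noncomputable def ker : ℝ × ℝ → ℝ :=
  (Iic (0 : ℝ × ℝ)).indicator fun y => (1 / 4) * K0 (y.1 * y.2)

/-- The solution operator of the inhomogeneous linear equation vanishing for large times. -/
noncomputable def Lop (g : ℝ → ℝ → ℝ) (t x : ℝ) : ℝ :=
  convolution ker (nul g) (ContinuousLinearMap.mul ℝ ℝ) volume (t + x, t - x)

lemma continuous_kerfun : Continuous fun y : ℝ × ℝ => (1 / 4) * K0 (y.1 * y.2) :=
  continuous_const.mul (continuous_K0.comp (continuous_fst.mul continuous_snd))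

lemma locallyIntegrable_ker : LocallyIntegrable ker volume :=
  (continuous_kerfun.locallyIntegrable).indicator measurableSet_Iic

lemma CS.zero_of {g : ℝ → ℝ → ℝ} {a R : ℝ} (h : ∀ t x, (t < a ∨ R < |x| + t) → g t x = 0)
    (f : ℝ → ℝ → ℝ) (hf : f = pt g ∨ f = px g) : ∀ t x, (t < a ∨ R < |x| + t) → f t x = 0 := by
  intro t x htx
  have ho : IsOpen {p : ℝ × ℝ | p.1 < a ∨ R < |p.2| + p.1} :=
    (isOpen_lt continuous_fst continuous_const).union
      (isOpen_lt continuous_const ((continuous_abs.comp continuous_snd).add continuous_fst))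
  have h0 : HasFDerivAt (fun p : ℝ × ℝ => g p.1 p.2) (dlin 0 0) (t, x) := by
    have : HasFDerivAt (fun _ : ℝ × ℝ => (0 : ℝ)) (dlin 0 0) (t, x) := by
      simpa [dlin] using hasFDerivAt_const (0 : ℝ) ((t, x) : ℝ × ℝ)
    refine this.congr_of_eventuallyEq ?_
    filter_upwards [ho.mem_nhds htx] with p hp using h p.1 p.2 hp
  rcases hf with rfl | rfl
  · exact pt_eq_of_hasFDerivAt h0
  · exact px_eq_of_hasFDerivAt h0

lemma CS.pt {g : ℝ → ℝ → ℝ} (h : CS g) : CS (pt g) := by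
  obtain ⟨h1, a, R, h2⟩ := h
  exact ⟨h1.pt, a, R, CS.zero_of h2 _ (Or.inl rfl)⟩

lemma CS.px {g : ℝ → ℝ → ℝ} (h : CS g) : CS (px g) := by
  obtain ⟨h1, a, R, h2⟩ := h
  exact ⟨h1.px, a, R, CS.zero_of h2 _ (Or.inr rfl)⟩

lemma contDiff_nul {g : ℝ → ℝ → ℝ} (h : Smooth2 g) : ContDiff ℝ (⊤ : ℕ∞) (nul g) :=
  ContDiff.comp (g := fun p : ℝ × ℝ => g p.1 p.2) h
    (((contDiff_fst.add contDiff_snd).div_const 2).prodMk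
      ((contDiff_fst.sub contDiff_snd).div_const 2))

lemma CS.hasCompactSupport_nul {g : ℝ → ℝ → ℝ} (h : CS g) : HasCompactSupport (nul g) := by
  obtain ⟨-, a, R, h2⟩ := h
  refine HasCompactSupport.intro (K := Icc ((2 * a - R : ℝ), (2 * a - R : ℝ)) (R, R)) isCompact_Icc ?_
  intro z hz
  refine h2 _ _ ?_
  by_contra! hcon
  obtain ⟨h3, h4⟩ := hcon
  have h5 := le_abs_self ((z.1 - z.2) / 2)
  have h6 := neg_abs_le ((z.1 - z.2) / 2)
  exact hz ⟨⟨by dsimp; linarith, by dsimp; linarith⟩, ⟨by dsimp; linarith, by dsimp; linarith⟩⟩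

lemma hasFDerivAt_nul {g : ℝ → ℝ → ℝ} (h : Smooth2 g) (z : ℝ × ℝ) :
    HasFDerivAt (nul g) (dlin ((nul (pt g) z + nul (px g) z) / 2)
      ((nul (pt g) z - nul (px g) z) / 2)) z := by
  have h1 : HasFDerivAt (fun z : ℝ × ℝ => ((z.1 + z.2) / 2, (z.1 - z.2) / 2))
      ((dlin (1 / 2) (1 / 2)).prod (dlin (1 / 2) (-(1 / 2)))) z := by
    refine HasFDerivAt.prodMk ?_ ?_
    · refine ((dlin (1 / 2) (1 / 2)).hasFDerivAt (x := z)).congr_of_eventuallyEq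
        (Eventually.of_forall fun y => ?_)
      simp only [dlin_apply]; ring
    · refine ((dlin (1 / 2) (-(1 / 2))).hasFDerivAt (x := z)).congr_of_eventuallyEq
        (Eventually.of_forall fun y => ?_)
      simp only [dlin_apply]; ring
  have h2 := (h.hasFDerivAt ((z.1 + z.2) / 2) ((z.1 - z.2) / 2)).comp z h1
  refine hasFDerivAt_congr h2 (fun _ => rfl) fun u => ?_
  simp [dlin_apply, nul]; ring

lemma hasFDerivAt_conv {g : ℝ → ℝ → ℝ} (h : CS g) (z : ℝ × ℝ) :
    HasFDerivAt (convolution ker (nul g) (ContinuousLinearMap.mul ℝ ℝ) volume)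
      (dlin (convolution ker (fun z => (nul (pt g) z + nul (px g) z) / 2)
          (ContinuousLinearMap.mul ℝ ℝ) volume z)
        (convolution ker (fun z => (nul (pt g) z - nul (px g) z) / 2)
          (ContinuousLinearMap.mul ℝ ℝ) volume z)) z := by
  have hd := (contDiff_nul h.1).of_le (m := 1) (by simp)
  have h1 := h.hasCompactSupport_nul.hasFDerivAt_convolution_right
    (ContinuousLinearMap.mul ℝ ℝ) locallyIntegrable_ker hd z
  rw [dlin_of_clm (convolution _ _ _ _ _)] at h1
  rw [convolution_precompR_apply _ locallyIntegrable_ker (h.hasCompactSupport_nul.fderiv (𝕜 := ℝ))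
      (hd.continuous_fderiv (by simp)),
    convolution_precompR_apply _ locallyIntegrable_ker (h.hasCompactSupport_nul.fderiv (𝕜 := ℝ))
      (hd.continuous_fderiv (by simp))] at h1
  simpa only [(hasFDerivAt_nul h.1 _).fderiv, dlin_apply, mul_one, mul_zero, add_zero, zero_add]
    using h1

lemma convolutionExistsAt {G : ℝ × ℝ → ℝ} (h : HasCompactSupport G) (hG : Continuous G) (z : ℝ × ℝ) :
    ConvolutionExistsAt ker G z (ContinuousLinearMap.mul ℝ ℝ) volume :=
  h.convolutionExists_right _ locallyIntegrable_ker hG z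

lemma hasFDerivAt_Lop {g : ℝ → ℝ → ℝ} (h : CS g) (t x : ℝ) :
    HasFDerivAt (fun p : ℝ × ℝ => Lop g p.1 p.2) (dlin (Lop (pt g) t x) (Lop (px g) t x)) (t, x) := by
  have h1 : HasFDerivAt (fun z : ℝ × ℝ => (z.1 + z.2, z.1 - z.2))
      ((dlin 1 1).prod (dlin 1 (-1))) (t, x) := by
    refine HasFDerivAt.prodMk ?_ ?_
    · refine ((dlin 1 1).hasFDerivAt (x := (t, x))).congr_of_eventuallyEq
        (Eventually.of_forall fun y => ?_)
      simp only [dlin_apply]; ring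
    · refine ((dlin 1 (-1)).hasFDerivAt (x := (t, x))).congr_of_eventuallyEq
        (Eventually.of_forall fun y => ?_)
      simp only [dlin_apply]; ring
  have h2 := (hasFDerivAt_conv h (t + x, t - x)).comp (t, x) h1
  have ct := h.pt.hasCompactSupport_nul
  have cx := h.px.hasCompactSupport_nul
  have et := convolutionExistsAt ct (contDiff_nul h.pt.1).continuous (t + x, t - x)
  have ex := convolutionExistsAt cx (contDiff_nul h.px.1).continuous (t + x, t - x)
  have e1 : convolution ker (fun z => (nul (pt g) z + nul (px g) z) / 2)
      (ContinuousLinearMap.mul ℝ ℝ) volume (t + x, t - x)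
      = (Lop (pt g) t x + Lop (px g) t x) / 2 := by
    rw [Lop, Lop, ← ConvolutionExistsAt.distrib_add et ex]
    simp only [convolution_def, ContinuousLinearMap.mul_apply', Pi.add_apply]
    rw [← integral_div]
    congr 1; ext; ring
  have e2 : convolution ker (fun z => (nul (pt g) z - nul (px g) z) / 2)
      (ContinuousLinearMap.mul ℝ ℝ) volume (t + x, t - x)
      = (Lop (pt g) t x - Lop (px g) t x) / 2 := by
    rw [Lop, Lop, convolution_def, convolution_def, convolution_def, ← integral_sub et ex,
      ← integral_div]
    congr 1; ext; simp only [ContinuousLinearMap.mul_apply']; ring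
  rw [e1, e2] at h2
  refine hasFDerivAt_congr h2 (fun _ => rfl) fun u => ?_
  simp [dlin_apply]; ring

lemma pt_Lop {g : ℝ → ℝ → ℝ} (h : CS g) : pt (Lop g) = Lop (pt g) := by
  ext t x; exact pt_eq_of_hasFDerivAt (hasFDerivAt_Lop h t x)

lemma px_Lop {g : ℝ → ℝ → ℝ} (h : CS g) : px (Lop g) = Lop (px g) := by
  ext t x; exact px_eq_of_hasFDerivAt (hasFDerivAt_Lop h t x)

lemma smooth2_Lop {g : ℝ → ℝ → ℝ} (h : CS g) : Smooth2 (Lop g) := by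
  have := contDiffOn_of_closed_family isOpen_univ
    {F | ∃ g, CS g ∧ F = fun p : ℝ × ℝ => Lop g p.1 p.2} ?_ ⟨g, h, rfl⟩
  · exact contDiffOn_univ.1 this
  · rintro _ ⟨g, hg, rfl⟩
    exact ⟨_, ⟨_, hg.pt, rfl⟩, _, ⟨_, hg.px, rfl⟩, fun p _ => hasFDerivAt_Lop hg p.1 p.2⟩

lemma CS.add {f g : ℝ → ℝ → ℝ} (hf : CS f) (hg : CS g) : CS (f + g) := by
  obtain ⟨h1, a, R, h2⟩ := hf
  obtain ⟨h3, a', R', h4⟩ := hg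
  refine ⟨h1.add h3, min a a', max R R', fun t x h => ?_⟩
  rw [lt_min_iff, max_lt_iff] at h
  rw [Pi.add_apply, Pi.add_apply, h2 t x (h.imp And.left And.left),
    h4 t x (h.imp And.right And.right), add_zero]

lemma CS.smul (c : ℝ) {f : ℝ → ℝ → ℝ} (hf : CS f) : CS (c • f) := by
  obtain ⟨h1, a, R, h2⟩ := hf
  exact ⟨h1.smul c, a, R, fun t x h => by simp [h2 t x h]⟩

lemma CS.sub {f g : ℝ → ℝ → ℝ} (hf : CS f) (hg : CS g) : CS (f - g) := by
  have := hf.add (hg.smul (-1))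
  simpa [sub_eq_add_neg] using this

lemma Lop_add {f g : ℝ → ℝ → ℝ} (hf : CS f) (hg : CS g) : Lop (f + g) = Lop f + Lop g := by
  ext t x
  have ef := convolutionExistsAt hf.hasCompactSupport_nul (contDiff_nul hf.1).continuous (t + x, t - x)
  have eg := convolutionExistsAt hg.hasCompactSupport_nul (contDiff_nul hg.1).continuous (t + x, t - x)
  simp only [Lop, Pi.add_apply]
  rw [← ConvolutionExistsAt.distrib_add ef eg]
  rfl

lemma Lop_sub {f g : ℝ → ℝ → ℝ} (hf : CS f) (hg : CS g) : Lop (f - g) = Lop f - Lop g := by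
  rw [eq_sub_iff_add_eq, ← Lop_add (hf.sub hg) hg, sub_add_cancel]

lemma Lop_apply (g : ℝ → ℝ → ℝ) (t x : ℝ) :
    Lop g t x = ∫ y in Ici (0 : ℝ × ℝ), (1 / 4) * K0 (y.1 * y.2) *
      g (t + (y.1 + y.2) / 2) (x + (y.1 - y.2) / 2) := by
  rw [Lop, convolution_def, ← integral_neg_eq_self, ← integral_indicator measurableSet_Ici]
  congr 1
  ext y
  have h0 : -y ∈ Iic (0 : ℝ × ℝ) ↔ y ∈ Ici (0 : ℝ × ℝ) := by simp
  by_cases hy : y ∈ Ici (0 : ℝ × ℝ)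
  · rw [indicator_of_mem hy, ContinuousLinearMap.mul_apply', ker, indicator_of_mem (h0.2 hy)]
    simp only [Prod.fst_neg, Prod.snd_neg, neg_mul_neg, nul, Prod.fst_sub, Prod.snd_sub]
    congr 2 <;> ring
  · rw [indicator_of_notMem hy, ContinuousLinearMap.mul_apply', ker,
      indicator_of_notMem (mt h0.1 hy), zero_mul]

lemma Lop_support {g : ℝ → ℝ → ℝ} {R : ℝ} (h : ∀ t x, R < |x| + t → g t x = 0) (t x : ℝ)
    (htx : R < |x| + t) : Lop g t x = 0 := by
  rw [Lop_apply]
  refine setIntegral_eq_zero_of_forall_eq_zero fun y hy => ?_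
  have h1 : 0 ≤ y.1 := hy.1
  have h2 : 0 ≤ y.2 := hy.2
  rw [h _ _ ?_, mul_zero]
  rcases abs_cases x with ⟨e, -⟩ | ⟨e, -⟩
  · have := le_abs_self (x + (y.1 - y.2) / 2); linarith
  · have := neg_abs_le (x + (y.1 - y.2) / 2); linarith

lemma Lop_box_add {g : ℝ → ℝ → ℝ} (h : CS g) : Lop (box g + g) = g := by
  ext t x
  obtain ⟨R, hR0, hR⟩ : ∃ R : ℝ, 0 ≤ R ∧ ∀ p q, 0 ≤ p → 0 ≤ q → (R ≤ p ∨ R ≤ q) →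
      ∀ f, (f = g ∨ f = pt g ∨ f = px g ∨ f = box g) →
        f (t + (p + q) / 2) (x + (p - q) / 2) = 0 := by
    have hbox : CS (box g) := h.pt.pt.sub h.px.px
    have : ∀ f, CS f → ∃ R : ℝ, 0 ≤ R ∧ ∀ p q, 0 ≤ p → 0 ≤ q → (R ≤ p ∨ R ≤ q) →
        f (t + (p + q) / 2) (x + (p - q) / 2) = 0 := by
      rintro f ⟨-, a, R, hf⟩
      refine ⟨max 0 (R - t + |x| + 1), le_max_left _ _, fun p q hp hq hpq => hf _ _ (Or.inr ?_)⟩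
      simp only [max_le_iff] at hpq
      have h1 := le_abs_self (x + (p - q) / 2)
      have h2 := neg_abs_le (x + (p - q) / 2)
      have h3 := le_abs_self x
      have h4 := neg_abs_le x
      rcases hpq with hpq | hpq <;> linarith [hpq.2]
    obtain ⟨R1, a1, b1⟩ := this _ h
    obtain ⟨R2, a2, b2⟩ := this _ h.pt
    obtain ⟨R3, a3, b3⟩ := this _ h.px
    obtain ⟨R4, a4, b4⟩ := this _ hbox
    refine ⟨max (max R1 R2) (max R3 R4), by positivity, fun p q hp hq hpq f hf => ?_⟩
    simp only [max_le_iff] at hpq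
    rcases hf with rfl | rfl | rfl | rfl
    · exact b1 p q hp hq (hpq.imp (fun h => h.1.1) (fun h => h.1.1))
    · exact b2 p q hp hq (hpq.imp (fun h => h.1.2) (fun h => h.1.2))
    · exact b3 p q hp hq (hpq.imp (fun h => h.2.1) (fun h => h.2.1))
    · exact b4 p q hp hq (hpq.imp (fun h => h.2.2) (fun h => h.2.2))
  have hfun : ∀ f : ℝ → ℝ → ℝ, Smooth2 f → ∀ y : ℝ × ℝ, HasFDerivAt
      (fun y : ℝ × ℝ => f (t + (y.1 + y.2) / 2) (x + (y.1 - y.2) / 2))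
      (dlin ((pt f (t + (y.1 + y.2) / 2) (x + (y.1 - y.2) / 2)
        + px f (t + (y.1 + y.2) / 2) (x + (y.1 - y.2) / 2)) / 2)
        ((pt f (t + (y.1 + y.2) / 2) (x + (y.1 - y.2) / 2)
        - px f (t + (y.1 + y.2) / 2) (x + (y.1 - y.2) / 2)) / 2)) y := by
    intro f hf y
    have := (hasFDerivAt_nul hf (y + (t + x, t - x))).comp y ((hasFDerivAt_id y).add_const (t + x, t - x))
    refine hasFDerivAt_congr this (fun y => ?_) fun u => ?_
    · simp only [nul, Function.comp, Prod.fst_add, Prod.snd_add, id]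
      congr 1 <;> ring
    · have e1 : (y.1 + (t + x) + (y.2 + (t - x))) / 2 = t + (y.1 + y.2) / 2 := by ring
      have e2 : (y.1 + (t + x) - (y.2 + (t - x))) / 2 = x + (y.1 - y.2) / 2 := by ring
      simp only [nul, Prod.fst_add, Prod.snd_add, ContinuousLinearMap.comp_id, e1, e2]
  have hmulK : ∀ (k k' : ℝ → ℝ), (∀ s, HasDerivAt k (k' s) s) → ∀ y : ℝ × ℝ,
      HasFDerivAt (fun y : ℝ × ℝ => k (y.1 * y.2))
        (dlin (k' (y.1 * y.2) * y.2) (k' (y.1 * y.2) * y.1)) y := by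
    intro k k' hk y
    have h1 := (hk (y.1 * y.2)).comp_hasFDerivAt y
      ((hasFDerivAt_fst (p := y) (𝕜 := ℝ)).mul (hasFDerivAt_snd (p := y) (𝕜 := ℝ)))
    refine hasFDerivAt_congr h1 (fun _ => rfl) fun u => ?_
    simp [dlin_apply]; ring
  set P : (ℝ → ℝ → ℝ) → ℝ × ℝ → ℝ := fun f y => f (t + (y.1 + y.2) / 2) (x + (y.1 - y.2) / 2) with hP
  have hcP : ∀ f, Smooth2 f → Continuous (P f) := fun f hf =>
    continuous_iff_continuousAt.2 fun y => (hfun f hf y).continuousAt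
  have hcK0 : Continuous fun y : ℝ × ℝ => K0 (y.1 * y.2) :=
    continuous_K0.comp (continuous_fst.mul continuous_snd)
  have hcK1 : Continuous fun y : ℝ × ℝ => K1 (y.1 * y.2) :=
    continuous_K1.comp (continuous_fst.mul continuous_snd)
  have hdiff : Smooth2 (pt g - px g) := h.1.pt.sub h.1.px
  have hf1 := fun y => (hmulK K0 K1 hasDerivAt_K0 y).mul ((hfun _ hdiff y).const_mul (1 / 2))
  have hf2 := fun y : ℝ × ℝ => (((hmulK K1 K2 hasDerivAt_K1 y).mul
    (hasFDerivAt_snd (p := y) (𝕜 := ℝ))).mul (hfun g h.1 y)).neg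
  have key : ∀ y : ℝ × ℝ, (1 / 4) * K0 (y.1 * y.2) * P (box g + g) y = 
      K0 (y.1 * y.2) * ((1 / 2) * ((P (pt (pt g - px g)) y + P (px (pt g - px g)) y) / 2))
      + (1 / 2) * P (pt g - px g) y * (K1 (y.1 * y.2) * y.2)
      + -(K1 (y.1 * y.2) * y.2 * ((P (pt g) y - P (px g) y) / 2) +
        P g y * (K1 (y.1 * y.2) + y.2 * (K2 (y.1 * y.2) * y.1))) := by
    intro y
    have h1 : pt (pt g - px g) = pt (pt g) - px (pt g) := by
      rw [Smooth2.pt_sub h.1.pt h.1.px, h.1.pt_px_comm]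
    have h2 : px (pt g - px g) = px (pt g) - px (px g) := Smooth2.px_sub h.1.pt h.1.px
    have h3 : P (box g + g) y = P (pt (pt g)) y - P (px (px g)) y + P g y := rfl
    rw [h1, h2, h3]
    simp only [hP, Pi.sub_apply]
    linear_combination (g (t + (y.1 + y.2) / 2) (x + (y.1 - y.2) / 2)) * K_ode (y.1 * y.2)
  have hbg : Continuous (P (box g + g)) := hcP _ ((h.1.pt.pt.sub h.1.px.px).add h.1)
  have hdiv := integral_divergence_prod_Icc_of_hasFDerivAt_of_le _ _ _ _ (0, 0) (R, R)
    ⟨hR0, hR0⟩ (hcK0.mul (continuous_const.mul (hcP _ hdiff))).continuousOn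
    ((hcK1.mul continuous_snd).mul (hcP g h.1)).neg.continuousOn
    (fun y _ => hf1 y) (fun y _ => hf2 y)
  simp only [add_apply, smul_apply, dlin_apply, smul_eq_mul,
    mul_one, mul_zero, add_zero, zero_add, neg_apply, ContinuousLinearMap.coe_snd'] at hdiv
  have hI : IntegrableOn (fun y : ℝ × ℝ => (1 / 4) * K0 (y.1 * y.2) * P (box g + g) y)
      (Icc ((0 : ℝ), (0 : ℝ)) (R, R)) volume :=
    (continuous_kerfun.mul hbg).continuousOn.integrableOn_compact isCompact_Icc
  replace hdiv := (setIntegral_congr_fun measurableSet_Icc (fun y _ => key y)).trans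
    (hdiv (hI.congr_fun (fun y _ => key y) measurableSet_Icc))
  have hnn : ∀ y ∈ uIcc 0 R, 0 ≤ y := fun y hy => by
    rw [uIcc_of_le hR0] at hy; exact hy.1
  have b1 : ∫ y in (0 : ℝ)..R, (-((fun y : ℝ × ℝ => K1 (y.1 * y.2)) * Prod.snd * P g) : ℝ × ℝ → ℝ) (y, R) = 0 := by
    refine (intervalIntegral.integral_congr (g := fun _ => (0 : ℝ)) fun y hy => ?_).trans
      intervalIntegral.integral_zero
    have : P g (y, R) = 0 := hR y R (hnn y hy) hR0 (Or.inr le_rfl) _ (Or.inl rfl)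
    simp [this]
  have b2 : ∫ y in (0 : ℝ)..R, (-((fun y : ℝ × ℝ => K1 (y.1 * y.2)) * Prod.snd * P g) : ℝ × ℝ → ℝ) (y, 0) = 0 := by
    simp
  have b3 : ∫ y in (0 : ℝ)..R, ((fun y : ℝ × ℝ => K0 (y.1 * y.2)) *
      ((fun _ => 1 / 2) * P (pt g - px g)) : ℝ × ℝ → ℝ) (R, y) = 0 := by
    refine (intervalIntegral.integral_congr (g := fun _ => (0 : ℝ)) fun y hy => ?_).trans
      intervalIntegral.integral_zero
    have h1 : P (pt g) (R, y) = 0 := hR R y hR0 (hnn y hy) (Or.inl le_rfl) _ (Or.inr (Or.inl rfl))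
    have h2 : P (px g) (R, y) = 0 :=
      hR R y hR0 (hnn y hy) (Or.inl le_rfl) _ (Or.inr (Or.inr (Or.inl rfl)))
    have h3 : P (pt g - px g) (R, y) = P (pt g) (R, y) - P (px g) (R, y) := rfl
    simp [h3, h1, h2]
  have b4 : ∫ y in (0 : ℝ)..R, ((fun y : ℝ × ℝ => K0 (y.1 * y.2)) *
      ((fun _ => 1 / 2) * P (pt g - px g)) : ℝ × ℝ → ℝ) (0, y) = - g t x := by
    have hd : ∀ y ∈ uIcc 0 R, HasDerivAt (fun y => P g (0, y))
        (((fun y : ℝ × ℝ => K0 (y.1 * y.2)) * ((fun _ => 1 / 2) * P (pt g - px g)) : ℝ × ℝ → ℝ) (0, y)) y := by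
      intro y _
      have := hasDerivAt_snd_of_hasFDerivAt (f := fun p q => P g (p, q)) (hfun g h.1 (0, y))
      refine this.congr_deriv ?_
      have h3 : P (pt g - px g) (0, y) = P (pt g) (0, y) - P (px g) (0, y) := rfl
      simp only [Pi.mul_apply, h3, zero_mul, K0_zero]
      simp only [hP]; ring
    rw [intervalIntegral.integral_eq_sub_of_hasDerivAt hd]
    · have h1 : P g (0, R) = 0 := hR 0 R le_rfl hR0 (Or.inr le_rfl) _ (Or.inl rfl)
      rw [h1]; simp [hP]
    · refine Continuous.intervalIntegrable ?_ _ _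
      exact (hcK0.mul (continuous_const.mul (hcP _ hdiff))).comp (continuous_const.prodMk continuous_id)
  rw [b1, b2, b3, b4] at hdiv
  rw [Lop_apply, setIntegral_eq_of_subset_of_forall_sdiff_eq_zero (s := Icc ((0 : ℝ), (0 : ℝ)) (R, R))
    (t := Ici (0 : ℝ × ℝ))
    measurableSet_Ici (fun y hy => hy.1)]
  · refine hdiv.trans ?_; ring
  · intro y hy
    have h1 : 0 ≤ y.1 := hy.1.1
    have h2 : 0 ≤ y.2 := hy.1.2
    have h3 : R ≤ y.1 ∨ R ≤ y.2 := by
      by_contra! hc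
      exact hy.2 ⟨hy.1, ⟨hc.1.le, hc.2.le⟩⟩
    have e1 := hR y.1 y.2 h1 h2 h3 (box g) (by simp)
    have e2 := hR y.1 y.2 h1 h2 h3 g (by simp)
    simp only [Pi.add_apply, e1, e2]; ring

lemma deriv_zero_of_open {g : ℝ → ℝ → ℝ} {U : Set (ℝ × ℝ)} (hU : IsOpen U)
    (h : ∀ p ∈ U, g p.1 p.2 = 0) {t x : ℝ} (htx : (t, x) ∈ U) : pt g t x = 0 ∧ px g t x = 0 := by
  have h0 : HasFDerivAt (fun p : ℝ × ℝ => g p.1 p.2) (dlin 0 0) (t, x) := by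
    have : HasFDerivAt (fun _ : ℝ × ℝ => (0 : ℝ)) (dlin 0 0) (t, x) := by
      simpa [dlin] using hasFDerivAt_const (0 : ℝ) ((t, x) : ℝ × ℝ)
    refine this.congr_of_eventuallyEq ?_
    filter_upwards [hU.mem_nhds htx] with p hp using h p hp
  exact ⟨pt_eq_of_hasFDerivAt h0, px_eq_of_hasFDerivAt h0⟩

lemma hasDerivAt_integral {f : ℝ → ℝ → ℝ} (hf : Smooth2 f) (a b t : ℝ) :
    HasDerivAt (fun s => ∫ x in a..b, f s x) (∫ x in a..b, pt f t x) t := by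
  have hc : Continuous fun p : ℝ × ℝ => pt f p.1 p.2 := hf.pt.continuous
  obtain ⟨C, hC⟩ := ((isCompact_Icc (a := t - 1) (b := t + 1)).prod
    (isCompact_uIcc (a := a) (b := b))).exists_bound_of_continuousOn hc.continuousOn
  refine (intervalIntegral.hasDerivAt_integral_of_dominated_loc_of_deriv_le
    (F := f) (F' := pt f) (s := Icc (t - 1) (t + 1)) (bound := fun _ => C)
    (Icc_mem_nhds (by linarith) (by linarith)) ?_ ?_ ?_ ?_ ?_ ?_).2
  · exact Eventually.of_forall fun s => (hf.continuous_slice s).aestronglyMeasurable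
  · exact (hf.continuous_slice t).intervalIntegrable _ _
  · exact (hf.pt.continuous_slice t).aestronglyMeasurable
  · exact Eventually.of_forall fun x hx s hs => hC (s, x) ⟨hs, uIoc_subset_uIcc hx⟩
  · exact intervalIntegrable_const
  · exact Eventually.of_forall fun x _ s _ => hf.hasDerivAt_pt s x

lemma integral_px {f : ℝ → ℝ → ℝ} (hf : Smooth2 f) (a b t : ℝ) :
    ∫ x in a..b, px f t x = f t b - f t a :=
  intervalIntegral.integral_eq_sub_of_hasDerivAt (fun x _ => hf.hasDerivAt_px t x)
    ((hf.px.continuous_slice t).intervalIntegrable _ _)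

lemma eLpNorm_two_eq {f : ℝ → ℝ} (hf : Continuous f) {B : ℝ}
    (h : ∀ x, B ≤ |x| → f x = 0) :
    eLpNorm f 2 volume = ENNReal.ofReal (Real.sqrt (∫ x in -B..B, f x ^ 2)) := by
  have hcs : HasCompactSupport f := by
    refine HasCompactSupport.intro (K := Icc (-B) B) isCompact_Icc fun x hx => h x ?_
    by_contra! hcon
    exact hx ⟨(abs_lt.1 hcon).1.le, (abs_lt.1 hcon).2.le⟩
  have hm : MemLp f 2 volume := hf.memLp_of_hasCompactSupport hcs
  rw [hm.eLpNorm_eq_integral_rpow_norm (by norm_num) (by norm_num)]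
  congr 1
  rw [intervalIntegral.integral_eq_integral_of_support_subset, Real.sqrt_eq_rpow]
  · simp
  · intro x hx
    have : ¬ B ≤ |x| := fun hc => hx (by simp [h x hc])
    exact ⟨(abs_lt.1 (not_le.1 this)).1, (abs_lt.1 (not_le.1 this)).2.le⟩

section Energy
variable {w : ℝ → ℝ → ℝ} {R M T A : ℝ}

lemma smooth2_box (hw : Smooth2 w) : Smooth2 (box w) := hw.pt.pt.sub hw.px.px

noncomputable def enDens (w : ℝ → ℝ → ℝ) : ℝ → ℝ → ℝ :=
  w * w + pt w * pt w + px w * px w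

lemma smooth2_enDens (hw : Smooth2 w) : Smooth2 (enDens w) :=
  ((hw.mul hw).add (hw.pt.mul hw.pt)).add (hw.px.mul hw.px)

lemma pt_enDens (hw : Smooth2 w) (t x : ℝ) :
    pt (enDens w) t x = 2 * (pt w t x * (box w t x + w t x)) + 2 * px (px w * pt w) t x := by
  have e1 : pt (enDens w) = _ := ((hw.mul hw).add (hw.pt.mul hw.pt)).pt_add (hw.px.mul hw.px)
  rw [e1, (hw.mul hw).pt_add (hw.pt.mul hw.pt), hw.pt_mul hw, hw.pt.pt_mul hw.pt,
    hw.px.pt_mul hw.px, hw.px.px_mul hw.pt, hw.pt_px_comm]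
  have e2 : box w t x = pt (pt w) t x - px (px w) t x := rfl
  simp only [Pi.add_apply, Pi.mul_apply, e2]
  ring

lemma energy_bound (hw : Smooth2 w) (hR : ∀ t x, R < |x| + t → w t x = 0) (hM : 0 < M) (hT : 0 < T)
    (hA : ∀ t, T ≤ t → ∫ x in -(|R| + |T| + 1)..(|R| + |T| + 1), (box w t x + w t x) ^ 2
      ≤ A ^ 2 * t ^ (-2 * M - 2)) {t : ℝ} (ht : T ≤ t) :
    ∫ x in -(|R| + |T| + 1)..(|R| + |T| + 1), enDens w t x ≤ (A / M) ^ 2 * t ^ (-2 * M) := by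
  set B := |R| + |T| + 1 with hB
  have hBpos : 0 < B := by positivity
  have hU : IsOpen {p : ℝ × ℝ | R < |p.2| + p.1} :=
    isOpen_lt continuous_const ((continuous_abs.comp continuous_snd).add continuous_fst)
  have hd : ∀ t x, R < |x| + t → w t x = 0 ∧ pt w t x = 0 ∧ px w t x = 0 := fun t x h =>
    ⟨hR t x h, deriv_zero_of_open hU (fun p hp => hR p.1 p.2 hp) h⟩
  have hbd : ∀ t, T ≤ t → ∀ x, |x| = B → pt w t x = 0 := fun t ht x hx =>
    (hd t x (by rw [hx, hB]; linarith [le_abs_self R, abs_nonneg T])).2.1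
  set E : ℝ → ℝ := fun s => ∫ x in -B..B, enDens w s x with hE
  have hE' : ∀ s, T ≤ s → HasDerivAt E (2 * ∫ x in -B..B, pt w s x * (box w s x + w s x)) s := by
    intro s hs
    refine (hasDerivAt_integral (smooth2_enDens hw) (-B) B s).congr_deriv ?_
    have i1 : IntervalIntegrable (fun x => 2 * (pt w s x * (box w s x + w s x))) volume (-B) B :=
      (((hw.pt.continuous_slice s).mul (((smooth2_box hw).continuous_slice s).add
        (hw.continuous_slice s))).const_mul 2).intervalIntegrable _ _
    have i2 : IntervalIntegrable (fun x => 2 * px (px w * pt w) s x) volume (-B) B :=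
      (((hw.px.mul hw.pt).px.continuous_slice s).const_mul 2).intervalIntegrable _ _
    simp only [pt_enDens hw]
    rw [intervalIntegral.integral_add i1 i2, intervalIntegral.integral_const_mul,
      intervalIntegral.integral_const_mul, integral_px (hw.px.mul hw.pt)]
    simp [hbd s hs B (abs_of_pos hBpos), hbd s hs (-B) (by rw [abs_neg, abs_of_pos hBpos])]
  have hEM : ∀ s, T ≤ s → -(M / s) * E s - s / M * (A ^ 2 * s ^ (-2 * M - 2)) ≤
      2 * ∫ x in -B..B, pt w s x * (box w s x + w s x) := by
    intro s hs
    have hs0 : 0 < s := hT.trans_le hs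
    have c1 := hw.continuous_slice s
    have c2 := hw.pt.continuous_slice s
    have c3 := (smooth2_box hw).continuous_slice s
    have c4 := (smooth2_enDens hw).continuous_slice s
    calc _ ≤ -(M / s) * E s - s / M * ∫ x in -B..B, (box w s x + w s x) ^ 2 := by
          gcongr
          exact hA s hs
      _ = ∫ x in -B..B, (-(M / s) * enDens w s x - s / M * (box w s x + w s x) ^ 2) := by
          have j1 : IntervalIntegrable (fun x => -(M / s) * enDens w s x) volume (-B) B :=
            (c4.const_mul _).intervalIntegrable _ _
          have j2 : IntervalIntegrable (fun x => s / M * (box w s x + w s x) ^ 2) volume (-B) B :=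
            (((c3.add c1).pow 2).const_mul _).intervalIntegrable _ _
          rw [intervalIntegral.integral_sub j1 j2,
            intervalIntegral.integral_const_mul, intervalIntegral.integral_const_mul]
      _ ≤ ∫ x in -B..B, 2 * (pt w s x * (box w s x + w s x)) := by
          refine intervalIntegral.integral_mono_on (by linarith)
            (((c4.const_mul _).sub (((c3.add c1).pow 2).const_mul _)).intervalIntegrable _ _)
            (((c2.mul (c3.add c1)).const_mul 2).intervalIntegrable _ _) fun x _ => ?_
          have h1 : enDens w s x = w s x ^ 2 + pt w s x ^ 2 + px w s x ^ 2 := by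
            simp only [enDens, Pi.add_apply, Pi.mul_apply]; ring
          rw [h1]
          set r := M / s with hr
          have hr0 : 0 < r := by positivity
          have h2 : s / M = r⁻¹ := by rw [hr, inv_div]
          rw [h2]
          set u := pt w s x
          set g := box w s x + w s x
          have h3 : 0 ≤ r⁻¹ * (r * u + g) ^ 2 := by positivity
          have h4 : r⁻¹ * (r * u + g) ^ 2 = r * u ^ 2 + 2 * (u * g) + r⁻¹ * g ^ 2 := by
            field_simp
            ring
          nlinarith [mul_nonneg hr0.le (sq_nonneg (w s x)), mul_nonneg hr0.le (sq_nonneg (px w s x))]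
      _ = _ := intervalIntegral.integral_const_mul _ _
  set h : ℝ → ℝ := fun s => s ^ M * E s - (A / M) ^ 2 * s ^ (-M) with hh
  have hder : ∀ s, T ≤ s → HasDerivAt h
      (M * s ^ (M - 1) * E s + s ^ M * (2 * ∫ x in -B..B, pt w s x * (box w s x + w s x))
        - (A / M) ^ 2 * (-M * s ^ (-M - 1))) s := by
    intro s hs
    have hs0 : 0 < s := hT.trans_le hs
    exact ((Real.hasDerivAt_rpow_const (Or.inl hs0.ne')).mul (hE' s hs)).sub
      ((Real.hasDerivAt_rpow_const (Or.inl hs0.ne')).const_mul _)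
  have hmono : MonotoneOn h (Ici T) := by
    refine monotoneOn_of_deriv_nonneg (convex_Ici T)
      (fun s hs => (hder s hs).continuousAt.continuousWithinAt)
      (fun s hs => (hder s (interior_subset hs)).differentiableAt.differentiableWithinAt) ?_
    intro s hs
    have hs : T ≤ s := interior_subset hs
    have hs0 : 0 < s := hT.trans_le hs
    rw [(hder s hs).deriv]
    have h1 := mul_le_mul_of_nonneg_left (hEM s hs) (Real.rpow_nonneg hs0.le M)
    have e1 : s ^ M * (M / s) = M * s ^ (M - 1) := by
      rw [Real.rpow_sub_one hs0.ne']; ring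
    have e2 : s ^ M * (s / M * (A ^ 2 * s ^ (-2 * M - 2))) = (A / M) ^ 2 * (M * s ^ (-M - 1)) := by
      have : s ^ M * s * s ^ (-2 * M - 2) = s ^ (-M - 1) := by
        rw [← Real.rpow_add_one hs0.ne', ← Real.rpow_add hs0]; congr 1; ring
      rw [← this]; field_simp
    have e3 : s ^ M * (-(M / s) * E s - s / M * (A ^ 2 * s ^ (-2 * M - 2))) =
      -(s ^ M * (M / s)) * E s - s ^ M * (s / M * (A ^ 2 * s ^ (-2 * M - 2))) := by ring
    rw [e3, e1, e2] at h1
    linarith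
  have hlarge : h (max t (R + 1)) ≤ 0 := by
    have h0 : E (max t (R + 1)) = 0 := by
      refine (intervalIntegral.integral_congr (g := fun _ => (0 : ℝ)) fun x _ => ?_).trans
        intervalIntegral.integral_zero
      obtain ⟨h1, h2, h3⟩ := hd (max t (R + 1)) x
        (by linarith [abs_nonneg x, le_max_right t (R + 1)])
      simp [enDens, h1, h2, h3]
    simp only [hh, h0, mul_zero, zero_sub, Left.neg_nonpos_iff]
    have : 0 < max t (R + 1) := lt_max_of_lt_left (hT.trans_le ht)
    positivity
  have ht0 : 0 < t := hT.trans_le ht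
  have hfin := (hmono ht (show T ≤ _ from ht.trans (le_max_left _ _)) (le_max_left t (R + 1))).trans hlarge
  have h5 : t ^ M * E t ≤ (A / M) ^ 2 * t ^ (-M) := by simpa [hh] using hfin
  have e6 : t ^ (-2 * M) = t ^ (-M) * t ^ (-M) := by rw [← Real.rpow_add ht0]; congr 1; ring
  have e7 : t ^ (-M) * t ^ M = 1 := by rw [← Real.rpow_add ht0]; simp
  calc E t = t ^ (-M) * (t ^ M * E t) := by rw [← mul_assoc, e7, one_mul]
    _ ≤ t ^ (-M) * ((A / M) ^ 2 * t ^ (-M)) := by gcongr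
    _ = _ := by rw [e6]; ring

lemma sq_le_energy (hw : Smooth2 w) {B : ℝ} {t : ℝ} (hB : ∀ x, B ≤ |x| → w t x = 0) (hB0 : 0 < B)
    (x : ℝ) : w t x ^ 2 ≤ ∫ x in -B..B, enDens w t x := by
  have c4 := (smooth2_enDens hw).continuous_slice t
  have hpos : ∀ x, 0 ≤ enDens w t x := fun x => by
    simp only [enDens, Pi.add_apply, Pi.mul_apply]
    linarith [mul_self_nonneg (w t x), mul_self_nonneg (pt w t x), mul_self_nonneg (px w t x)]
  rcases le_or_gt B |x| with h | h
  · rw [hB x h]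
    simpa using intervalIntegral.integral_nonneg (by linarith) fun x _ => hpos x
  · have hx := abs_lt.1 h
    have h1 : w t x ^ 2 = ∫ y in -B..x, px (w * w) t y := by
      rw [integral_px (hw.mul hw)]
      simp [hB (-B) (by rw [abs_neg, abs_of_pos hB0])]
      ring
    rw [h1]
    calc _ ≤ ∫ y in -B..x, enDens w t y := by
          refine intervalIntegral.integral_mono_on hx.1.le
            (((hw.mul hw).px.continuous_slice t).intervalIntegrable _ _)
            (c4.intervalIntegrable _ _) fun y _ => ?_
          rw [hw.px_mul hw]
          simp only [enDens, Pi.add_apply, Pi.mul_apply]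
          nlinarith [sq_nonneg (w t y - px w t y), sq_nonneg (pt w t y)]
      _ ≤ _ := by
          rw [← intervalIntegral.integral_add_adjacent_intervals (c4.intervalIntegrable (-B) x)
            (c4.intervalIntegrable x B)]
          have := intervalIntegral.integral_nonneg (μ := volume) hx.2.le fun y _ => hpos y
          linarith

lemma energy_estimate (hw : Smooth2 w) (hR : ∀ t x, R < |x| + t → w t x = 0)
    (hM : 0 < M) (hT : 0 < T) :
    Ntwo M T w ≤ ENNReal.ofReal (1 / M) * Ntwo (M + 1) T (box w + w) ∧
    Nsup M T w ≤ ENNReal.ofReal (1 / M) * Ntwo (M + 1) T (box w + w) := by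
  have hM' : ENNReal.ofReal (1 / M) ≠ 0 := by simpa using hM
  by_cases htop : Ntwo (M + 1) T (box w + w) = ⊤
  · rw [htop, ENNReal.mul_top hM']; simp
  set A := (Ntwo (M + 1) T (box w + w)).toReal with hAdef
  have hA0 : 0 ≤ A := ENNReal.toReal_nonneg
  have hAeq : Ntwo (M + 1) T (box w + w) = ENNReal.ofReal A := (ENNReal.ofReal_toReal htop).symm
  rw [hAeq, ← ENNReal.ofReal_mul (by positivity)]
  set B := |R| + |T| + 1 with hBdef
  have hBpos : 0 < B := by positivity
  have hU : IsOpen {p : ℝ × ℝ | R < |p.2| + p.1} :=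
    isOpen_lt continuous_const ((continuous_abs.comp continuous_snd).add continuous_fst)
  have hRB : ∀ t, T ≤ t → ∀ x, B ≤ |x| → R < |x| + t := fun t ht x hx => by
    rw [hBdef] at hx; linarith [le_abs_self R, abs_nonneg T]
  have hz1 : ∀ p : ℝ × ℝ, R < |p.2| + p.1 → _ := fun p hp =>
    deriv_zero_of_open hU (fun p hp => hR p.1 p.2 hp) (t := p.1) (x := p.2) hp
  have hg0 : ∀ t, T ≤ t → ∀ x, B ≤ |x| → box w t x + w t x = 0 := by
    intro t ht x hx
    have h1 := (deriv_zero_of_open hU (g := pt w) (fun p hp => (hz1 p hp).1) (hRB t ht x hx)).1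
    have h2 := (deriv_zero_of_open hU (g := px w) (fun p hp => (hz1 p hp).2) (hRB t ht x hx)).2
    have e2 : box w t x = pt (pt w) t x - px (px w) t x := rfl
    rw [e2, h1, h2, hR t x (hRB t ht x hx)]; simp
  have hA : ∀ t, T ≤ t → ∫ x in -B..B, (box w t x + w t x) ^ 2 ≤ A ^ 2 * t ^ (-2 * M - 2) := by
    intro t ht
    have ht0 : 0 < t := hT.trans_le ht
    have h1 := le_Ntwo (σ := M + 1) (f := box w + w) ht
    rw [hAeq] at h1
    have hc : Continuous ((box w + w) t) := ((smooth2_box hw).add hw).continuous_slice t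
    rw [eLpNorm_two_eq hc (hg0 t ht), ← ENNReal.ofReal_mul (by positivity),
      ENNReal.ofReal_le_ofReal_iff hA0] at h1
    have hI : 0 ≤ ∫ x in -B..B, (box w + w) t x ^ 2 :=
      intervalIntegral.integral_nonneg (by linarith) fun x _ => sq_nonneg _
    have h2 : Real.sqrt (∫ x in -B..B, (box w + w) t x ^ 2) ≤ A * t ^ (-(M + 1)) := by
      rw [Real.rpow_neg ht0.le, ← div_eq_mul_inv, le_div_iff₀ (by positivity)]
      linarith
    have h3 := pow_le_pow_left₀ (Real.sqrt_nonneg _) h2 2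
    rw [Real.sq_sqrt hI] at h3
    refine h3.trans_eq ?_
    rw [mul_pow, ← Real.rpow_natCast (t ^ _), ← Real.rpow_mul ht0.le]
    congr 2
    push_cast; ring
  have hEn : ∀ t, T ≤ t → Real.sqrt (∫ x in -B..B, enDens w t x) ≤ t ^ (-M) * (1 / M * A) := by
    intro t ht
    have ht0 : 0 < t := hT.trans_le ht
    rw [Real.sqrt_le_iff]
    refine ⟨by positivity, (energy_bound hw hR hM hT hA ht).trans_eq ?_⟩
    rw [mul_pow, ← Real.rpow_natCast (t ^ _), ← Real.rpow_mul ht0.le]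
    push_cast
    rw [show -M * 2 = -2 * M by ring]; ring
  have key : ∀ t, T ≤ t → ∀ r, r ≤ t ^ (-M) * (1 / M * A) → t ^ M * r ≤ 1 / M * A := by
    intro t ht r hr
    have ht0 : 0 < t := hT.trans_le ht
    have e7 : t ^ M * t ^ (-M) = 1 := by rw [← Real.rpow_add ht0]; simp
    calc _ ≤ t ^ M * (t ^ (-M) * (1 / M * A)) := by gcongr
      _ = _ := by rw [← mul_assoc, e7, one_mul]
  constructor
  · rw [Ntwo_le_iff]
    intro t ht
    have ht0 : 0 < t := hT.trans_le ht
    rw [eLpNorm_two_eq (hw.continuous_slice t) (fun x hx => hR t x (hRB t ht x hx)),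
      ← ENNReal.ofReal_mul (by positivity)]
    refine ENNReal.ofReal_le_ofReal (key t ht _ (le_trans ?_ (hEn t ht)))
    refine Real.sqrt_le_sqrt (intervalIntegral.integral_mono_on (by linarith)
      (((hw.continuous_slice t).pow 2).intervalIntegrable _ _)
      (((smooth2_enDens hw).continuous_slice t).intervalIntegrable _ _) fun x _ => ?_)
    simp only [enDens, Pi.add_apply, Pi.mul_apply]
    nlinarith [sq_nonneg (px w t x), sq_nonneg (pt w t x)]
  · rw [Nsup_le_iff]
    intro t ht x
    have ht0 : 0 < t := hT.trans_le ht
    rw [← ofReal_norm, ← ENNReal.ofReal_mul (by positivity), Real.norm_eq_abs]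
    refine ENNReal.ofReal_le_ofReal (key t ht _ (le_trans ?_ (hEn t ht)))
    exact Real.abs_le_sqrt (sq_le_energy hw (fun x hx => hR t x (hRB t ht x hx)) hBpos x)

end Energy

section
variable {g : ℝ → ℝ → ℝ} {M T : ℝ}

lemma box_Lop (h : CS g) : box (Lop g) + Lop g = g := by
  have e : box (Lop g) = pt (pt (Lop g)) - px (px (Lop g)) := rfl
  rw [e, pt_Lop h, px_Lop h, pt_Lop h.pt, px_Lop h.px, ← Lop_sub h.pt.pt h.px.px,
    ← Lop_add (h.pt.pt.sub h.px.px) h]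
  exact Lop_box_add h

lemma Lop_estimate (h : CS g) (hM : 0 < M) (hT : 0 < T) :
    Ntwo M T (Lop g) ≤ ENNReal.ofReal (1 / M) * Ntwo (M + 1) T g ∧
    Nsup M T (Lop g) ≤ ENNReal.ofReal (1 / M) * Ntwo (M + 1) T g := by
  obtain ⟨a, R, hR⟩ := h.2
  have := energy_estimate (R := R) (smooth2_Lop h)
    (fun t x htx => Lop_support (fun t x htx => hR t x (Or.inr htx)) t x htx) hM hT
  rwa [box_Lop h] at this

lemma cN_Lop_le {N₁ N₂ : (ℝ → ℝ → ℝ) → ℝ≥0∞} {a : ℝ≥0∞} (hN : ∀ g, CS g → N₁ (Lop g) ≤ a * N₂ g)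
    (n : ℕ) (h : CS g) : cN N₁ n (Lop g) ≤ a * cN N₂ n g := by
  induction n generalizing g with
  | zero => exact hN g h
  | succ n ih =>
    simp only [cN]
    rw [pt_Lop h, px_Lop h, mul_add]
    exact add_le_add (ih h.pt) (ih h.px)

lemma jet_Lop_le {N₁ N₂ : (ℝ → ℝ → ℝ) → ℝ≥0∞} {a : ℝ≥0∞} (hN : ∀ g, CS g → N₁ (Lop g) ≤ a * N₂ g)
    (k : ℕ) (ε : ℝ≥0) (h : CS g) : jet N₁ k ε (Lop g) ≤ a * jet N₂ k ε g := by
  rw [jet, jet, Finset.mul_sum]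
  refine Finset.sum_le_sum fun n _ => ?_
  rw [mul_left_comm]
  gcongr
  exact cN_Lop_le hN n h

end

/-- Geometric Cauchy condition, uniform for `t ≥ T`, for all derivatives of a sequence. -/
def RC (T : ℝ) (f : ℕ → ℝ → ℝ → ℝ) : Prop :=
  (∀ j, Smooth2 (f j)) ∧ ∀ n, ∃ C : ℝ≥0, ∀ j,
    cN (Nsup 0 T) n (f (j + 1) - f j) ≤ ((C * (1 / 2) ^ j : ℝ≥0) : ℝ≥0∞)

noncomputable def limF (f : ℕ → ℝ → ℝ → ℝ) (t x : ℝ) : ℝ := limUnder atTop fun j => f j t x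

section
variable {T : ℝ} {f : ℕ → ℝ → ℝ → ℝ}

lemma RC.pt (h : RC T f) : RC T fun j => pt (f j) := by
  refine ⟨fun j => (h.1 j).pt, fun n => ?_⟩
  obtain ⟨C, hC⟩ := h.2 (n + 1)
  refine ⟨C, fun j => le_trans ?_ (hC j)⟩
  rw [← (h.1 (j + 1)).pt_sub (h.1 j)]
  exact le_self_add

lemma RC.px (h : RC T f) : RC T fun j => px (f j) := by
  refine ⟨fun j => (h.1 j).px, fun n => ?_⟩
  obtain ⟨C, hC⟩ := h.2 (n + 1)
  refine ⟨C, fun j => le_trans ?_ (hC j)⟩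
  rw [← (h.1 (j + 1)).px_sub (h.1 j)]
  exact le_add_self

lemma RC.exists_dist (h : RC T f) : ∃ C : ℝ, ∀ t, T ≤ t → ∀ x j,
    dist (f j t x) (f (j + 1) t x) ≤ C * (1 / 2) ^ j := by
  obtain ⟨C, hC⟩ := h.2 0
  refine ⟨C, fun t ht x j => ?_⟩
  have h1 := (le_Nsup (σ := 0) ht x).trans (hC j)
  rw [Real.rpow_zero, ENNReal.ofReal_one, one_mul, enorm_eq_nnnorm, ENNReal.coe_le_coe] at h1
  have h2 : ‖(f (j + 1) - f j) t x‖ ≤ C * (1 / 2) ^ j := by exact_mod_cast h1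
  rw [dist_comm, dist_eq_norm]
  exact h2

lemma RC.tendsto (h : RC T f) {t : ℝ} (ht : T ≤ t) (x : ℝ) :
    Tendsto (fun j => f j t x) atTop (𝓝 (limF f t x)) := by
  obtain ⟨C, hC⟩ := h.exists_dist
  exact (cauchySeq_of_le_geometric (1 / 2) C (by norm_num) (hC t ht x)).tendsto_limUnder

lemma RC.tendstoUniformlyOn (h : RC T f) :
    TendstoUniformlyOn (fun j (p : ℝ × ℝ) => f j p.1 p.2) (fun p => limF f p.1 p.2) atTop
      {p | T < p.1} := by
  obtain ⟨C, hC⟩ := h.exists_dist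
  have hC' : ∀ t, T ≤ t → ∀ x j, dist (f j t x) (limF f t x) ≤ C * (1 / 2) ^ j / (1 - 1 / 2) :=
    fun t ht x j => dist_le_of_le_geometric_of_tendsto (1 / 2) C (by norm_num) (hC t ht x)
      (h.tendsto ht x) j
  have h0 : Tendsto (fun j : ℕ => C * (1 / 2 : ℝ) ^ j / (1 - 1 / 2)) atTop (𝓝 0) := by
    have := ((tendsto_pow_atTop_nhds_zero_of_lt_one (r := (1 / 2 : ℝ)) (by norm_num)
      (by norm_num)).const_mul C).div_const (1 - 1 / 2)
    simpa using this
  rw [Metric.tendstoUniformlyOn_iff]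
  intro η hη
  filter_upwards [h0.eventually_lt_const hη] with j hj p hp
  rw [dist_comm]
  exact (hC' p.1 (le_of_lt hp) p.2 j).trans_lt hj

lemma norm_dlin_le (a b : ℝ) : ‖dlin a b‖ ≤ |a| + |b| := by
  refine ContinuousLinearMap.opNorm_le_bound _ (by positivity) fun u => ?_
  rw [dlin_apply, Real.norm_eq_abs]
  calc _ ≤ |a * u.1| + |b * u.2| := abs_add_le _ _
    _ ≤ |a| * ‖u‖ + |b| * ‖u‖ := by
        rw [abs_mul, abs_mul]
        gcongr
        · exact norm_fst_le u
        · exact norm_snd_le u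
    _ = _ := by ring

lemma dlin_sub (a b a' b' : ℝ) : dlin a b - dlin a' b' = dlin (a - a') (b - b') := by
  ext <;> simp [dlin_apply]

lemma RC.hasFDerivAt (h : RC T f) {p : ℝ × ℝ} (hp : T < p.1) :
    HasFDerivAt (fun p : ℝ × ℝ => limF f p.1 p.2)
      (dlin (limF (fun j => _root_.pt (f j)) p.1 p.2) (limF (fun j => _root_.px (f j)) p.1 p.2)) p := by
  refine hasFDerivAt_of_tendstoUniformlyOn (s := {p : ℝ × ℝ | T < p.1}) (l := atTop)
    (f := fun j (p : ℝ × ℝ) => f j p.1 p.2)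
    (f' := fun j (p : ℝ × ℝ) => dlin (_root_.pt (f j) p.1 p.2) (_root_.px (f j) p.1 p.2))
    (g' := fun (p : ℝ × ℝ) => dlin (limF (fun j => _root_.pt (f j)) p.1 p.2)
      (limF (fun j => _root_.px (f j)) p.1 p.2))
    (isOpen_lt continuous_const continuous_fst) ?_ ?_ ?_ hp
  · have h1 := Metric.tendstoUniformlyOn_iff.1 h.pt.tendstoUniformlyOn
    have h2 := Metric.tendstoUniformlyOn_iff.1 h.px.tendstoUniformlyOn
    rw [Metric.tendstoUniformlyOn_iff]
    intro η hη
    filter_upwards [h1 (η / 2) (by positivity), h2 (η / 2) (by positivity)] with j hj1 hj2 p hp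
    rw [dist_eq_norm, dlin_sub]
    have h3 := hj1 p hp
    have h4 := hj2 p hp
    rw [Real.dist_eq] at h3 h4
    linarith [norm_dlin_le (limF (fun j => _root_.pt (f j)) p.1 p.2 - _root_.pt (f j) p.1 p.2)
      (limF (fun j => _root_.px (f j)) p.1 p.2 - _root_.px (f j) p.1 p.2)]
  · exact fun j (p : ℝ × ℝ) _ => (h.1 j).hasFDerivAt p.1 p.2
  · exact fun p hp => h.tendsto (le_of_lt hp) p.2

lemma RC.contDiffOn (h : RC T f) :
    ContDiffOn ℝ (⊤ : ℕ∞) (fun p : ℝ × ℝ => limF f p.1 p.2) {p | T < p.1} := by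
  refine contDiffOn_of_closed_family (isOpen_lt continuous_const continuous_fst)
    {g | ∃ f, RC T f ∧ g = fun p : ℝ × ℝ => limF f p.1 p.2} ?_ ⟨f, h, rfl⟩
  rintro _ ⟨f, hf, rfl⟩
  exact ⟨_, ⟨_, hf.pt, rfl⟩, _, ⟨_, hf.px, rfl⟩, fun p hp => hf.hasFDerivAt hp⟩

lemma RC.pt_limF (h : RC T f) {t : ℝ} (ht : T < t) (x : ℝ) :
    _root_.pt (limF f) t x = limF (fun j => _root_.pt (f j)) t x :=
  pt_eq_of_hasFDerivAt (h.hasFDerivAt (p := (t, x)) ht)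

lemma RC.px_limF (h : RC T f) {t : ℝ} (ht : T < t) (x : ℝ) :
    _root_.px (limF f) t x = limF (fun j => _root_.px (f j)) t x :=
  px_eq_of_hasFDerivAt (h.hasFDerivAt (p := (t, x)) ht)

lemma pt_congr_of_lt {f g : ℝ → ℝ → ℝ} (h : ∀ t, T < t → ∀ x, f t x = g t x) {t : ℝ} (ht : T < t)
    (x : ℝ) : pt f t x = pt g t x :=
  EventuallyEq.deriv_eq ((eventually_gt_nhds ht).mono fun s hs => h s hs x)

lemma px_congr_of_lt {f g : ℝ → ℝ → ℝ} (h : ∀ t, T < t → ∀ x, f t x = g t x) {t : ℝ} (ht : T < t)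
    (x : ℝ) : px f t x = px g t x := by
  have : f t = g t := funext fun x => h t ht x
  simp only [px, this]

lemma RC.tendsto_box (h : RC T f) {t : ℝ} (ht : T < t) (x : ℝ) :
    Tendsto (fun j => box (f j) t x) atTop (𝓝 (box (limF f) t x)) := by
  have e : box (limF f) t x = _root_.pt (_root_.pt (limF f)) t x - _root_.px (_root_.px (limF f)) t x :=
    rfl
  rw [e, pt_congr_of_lt (fun t ht x => h.pt_limF ht x) ht,
    px_congr_of_lt (fun t ht x => h.px_limF ht x) ht, h.pt.pt_limF ht, h.px.px_limF ht]
  exact (h.pt.pt.tendsto ht.le x).sub (h.px.px.tendsto ht.le x)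

lemma eLpNorm_lim_le {u : ℕ → ℝ → ℝ} {v : ℝ → ℝ} {a : ℝ≥0∞} (hc : ∀ j, Continuous (u j))
    (hu : ∀ j, eLpNorm (u j) 2 volume ≤ a) (h : ∀ x, Tendsto (fun j => u j x) atTop (𝓝 (v x))) :
    eLpNorm v 2 volume ≤ a :=
  (Lp.eLpNorm_lim_le_liminf_eLpNorm (fun j => (hc j).aestronglyMeasurable) v
    (Eventually.of_forall h)).trans (liminf_le_of_le (by isBoundedDefault) fun b hb => by
      obtain ⟨j, hj⟩ := hb.exists
      exact hj.trans (hu j))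

end

section
/-- `N f` only depends on the restriction of `f` to `[T, ∞) × ℝ`. -/
def LocalN (T : ℝ) (N : (ℝ → ℝ → ℝ) → ℝ≥0∞) : Prop :=
  ∀ f g, (∀ t, T ≤ t → ∀ x, f t x = g t x) → N f = N g

lemma Nsup_local (σ T : ℝ) : LocalN T (Nsup σ T) := fun f g h => by
  refine le_antisymm (Nsup_le_iff.2 fun t ht x => ?_) (Nsup_le_iff.2 fun t ht x => ?_)
  · rw [h t ht x]; exact le_Nsup ht x
  · rw [← h t ht x]; exact le_Nsup ht x

lemma Ntwo_local (σ T : ℝ) : LocalN T (Ntwo σ T) := fun f g h => by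
  have h' : ∀ t, T ≤ t → f t = g t := fun t ht => funext (h t ht)
  refine le_antisymm (Ntwo_le_iff.2 fun t ht => ?_) (Ntwo_le_iff.2 fun t ht => ?_)
  · rw [h' t ht]; exact le_Ntwo ht
  · rw [← h' t ht]; exact le_Ntwo ht

lemma cN_congr {T T' : ℝ} {N : (ℝ → ℝ → ℝ) → ℝ≥0∞} (hN : LocalN T N) (hT : T' < T)
    {f g : ℝ → ℝ → ℝ} (n : ℕ) (h : ∀ t, T' < t → ∀ x, f t x = g t x) : cN N n f = cN N n g := by
  induction n generalizing f g with
  | zero => exact hN f g fun t ht x => h t (hT.trans_le ht) x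
  | succ n ih =>
    simp only [cN]
    rw [ih fun t ht x => pt_congr_of_lt h ht x, ih fun t ht x => px_congr_of_lt h ht x]

lemma jet_congr {T T' : ℝ} {N : (ℝ → ℝ → ℝ) → ℝ≥0∞} (hN : LocalN T N) (hT : T' < T)
    {f g : ℝ → ℝ → ℝ} (k : ℕ) (ε : ℝ≥0) (h : ∀ t, T' < t → ∀ x, f t x = g t x) :
    jet N k ε f = jet N k ε g := by
  simp only [jet, cN_congr hN hT _ h]

lemma cN_of_fst {N : (ℝ → ℝ → ℝ) → ℝ≥0∞} (hN : N 0 = 0) (n : ℕ) (η : ℝ → ℝ) :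
    cN N n (fun t _ => η t) = N (fun t _ => iteratedDeriv n η t) := by
  induction n generalizing η with
  | zero => simp [cN]
  | succ n ih =>
    have h1 : pt (fun t _ => η t) = fun t _ => deriv η t := rfl
    have h2 : px (fun t _ => η t) = fun _ _ => 0 := by ext t x; simp [px]
    simp only [cN]
    rw [h1, h2, ih, ih fun _ => 0, iteratedDeriv_succ']
    have : (fun (t _ : ℝ) => iteratedDeriv n (fun _ => (0 : ℝ)) t) = 0 := by
      ext t x; simp
    rw [this, hN, add_zero]
end

section
lemma exists_bound_smoothTransition (n : ℕ) :
    ∃ C : ℝ≥0, ∀ s, ‖iteratedDeriv n Real.smoothTransition s‖ₑ ≤ C := by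
  have hc : Continuous (iteratedDeriv n Real.smoothTransition) :=
    ContDiff.continuous_iteratedDeriv n (n := (⊤ : ℕ∞)) Real.smoothTransition.contDiff
      (by exact_mod_cast le_top)
  obtain ⟨C, hC⟩ := (isCompact_Icc (a := (-1 : ℝ)) (b := 2)).exists_bound_of_continuousOn
    hc.continuousOn
  have key : ∀ s, ‖iteratedDeriv n Real.smoothTransition s‖ ≤ max C 1 := by
    intro s
    by_cases hs : s ∈ Icc (-1 : ℝ) 2
    · exact (hC s hs).trans (le_max_left _ _)
    · have h1 : ∃ c : ℝ, |c| ≤ 1 ∧ Real.smoothTransition =ᶠ[𝓝 s] fun _ => c := by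
        rcases lt_or_ge s (-1) with h | h
        · refine ⟨0, by simp, (eventually_lt_nhds h).mono fun y hy => ?_⟩
          exact Real.smoothTransition.zero_of_nonpos (by linarith)
        · have h2 : 2 < s := by by_contra! h3; exact hs ⟨h, h3⟩
          refine ⟨1, by simp, (eventually_gt_nhds h2).mono fun y hy => ?_⟩
          exact Real.smoothTransition.one_of_one_le (by linarith)
      obtain ⟨c, hc1, hc2⟩ := h1
      rw [hc2.iteratedDeriv_eq, iteratedDeriv_const]
      refine le_trans ?_ (le_max_right _ _)
      split <;> simp [hc1]
  refine ⟨(max C 1).toNNReal, fun s => ?_⟩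
  rw [← ofReal_norm]
  exact ENNReal.ofReal_le_ofReal (key s)

/-- Cutoff equal to one for `t ≤ 2 ^ j`, vanishing for `t ≥ 2 ^ j + 1`. -/
noncomputable def chi (j : ℕ) (t _x : ℝ) : ℝ := Real.smoothTransition (2 ^ j + 1 - t)

lemma smooth2_chi (j : ℕ) : Smooth2 (chi j) :=
  Smooth2.of_fst (h := fun t => Real.smoothTransition (2 ^ j + 1 - t))
    (Real.smoothTransition.contDiff.comp (contDiff_const.sub contDiff_id))

lemma iteratedDeriv_chi (n j : ℕ) (t : ℝ) :
    iteratedDeriv n (fun t : ℝ => Real.smoothTransition (2 ^ j + 1 - t)) t =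
      (-1) ^ n * iteratedDeriv n Real.smoothTransition (2 ^ j + 1 - t) := by
  rw [iteratedDeriv_comp_const_sub]
  simp

lemma Nsup_zero (σ T : ℝ) : Nsup σ T 0 = 0 := by
  simp [Nsup]

lemma exists_cN_chi_le : ∃ X : ℕ → ℝ≥0, ∀ n j T, cN (Nsup 0 T) n (chi j) ≤ X n := by
  choose X hX using exists_bound_smoothTransition
  refine ⟨X, fun n j T => ?_⟩
  unfold chi
  rw [cN_of_fst (Nsup_zero 0 T) n (fun t => Real.smoothTransition (2 ^ j + 1 - t)), Nsup_le_iff]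
  intro t _ _
  rw [iteratedDeriv_chi, enorm_mul, Real.rpow_zero, ENNReal.ofReal_one, one_mul, enorm_pow, enorm_neg]
  simpa using hX n _

lemma Nsup_chi_le (j : ℕ) (T : ℝ) : Nsup 0 T (chi j) ≤ 1 := by
  refine Nsup_le_iff.2 fun t _ x => ?_
  rw [Real.rpow_zero, ENNReal.ofReal_one, one_mul, ← ofReal_norm, ← ENNReal.ofReal_one]
  refine ENNReal.ofReal_le_ofReal ?_
  rw [chi, Real.norm_of_nonneg (Real.smoothTransition.nonneg _)]
  exact Real.smoothTransition.le_one _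

lemma cN_chi_sub_le {X : ℕ → ℝ≥0} (hX : ∀ n j T, cN (Nsup 0 T) n (chi j) ≤ X n) (n j : ℕ) {T : ℝ}
    (hT : 0 < T) :
    cN (Nsup (-1) T) n (chi (j + 1) - chi j) ≤ ((2 * X n * (1 / 2) ^ j : ℝ≥0) : ℝ≥0∞) := by
  have hsub : ∀ t : ℝ, t < 2 ^ j → ∀ x, (chi (j + 1) - chi j) t x = 0 := by
    intro t ht x
    have h2 : (2 : ℝ) ^ j ≤ 2 ^ (j + 1) := pow_le_pow_right₀ (by norm_num) (by omega)
    simp only [Pi.sub_apply, chi]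
    rw [Real.smoothTransition.one_of_one_le (by linarith),
      Real.smoothTransition.one_of_one_le (by linarith), sub_self]
  have e : (chi (j + 1) - chi j : ℝ → ℝ → ℝ) = fun t _ => (chi (j + 1) - chi j) t 0 := rfl
  have h3 : cN (Nsup 0 T) n (chi (j + 1) - chi j) ≤ ((2 * X n : ℝ≥0) : ℝ≥0∞) := by
    have e2 : (chi (j + 1) - chi j : ℝ → ℝ → ℝ) = chi (j + 1) + (-1 : ℝ) • chi j := by
      ext t x; simp; ring
    rw [e2]
    refine (cN_add_le (Nsup_subAdd 0 T) n _ _ (smooth2_chi _) ((smooth2_chi j).smul (-1))).trans ?_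
    rw [cN_smul (fun c f => Nsup_smul c f) (-1) n (smooth2_chi j), enorm_neg, two_mul,
      ENNReal.coe_add]
    simpa using add_le_add (hX n (j + 1) T) (hX n j T)
  rw [e, cN_of_fst (Nsup_zero 0 T) n, Nsup_le_iff] at h3
  rw [e, cN_of_fst (Nsup_zero (-1) T) n, Nsup_le_iff]
  intro t ht x
  have ht0 : 0 < t := hT.trans_le ht
  rcases lt_or_ge t (2 ^ j) with h | h
  · have h5 : (fun t => (chi (j + 1) - chi j) t 0) =ᶠ[𝓝 t] fun _ => 0 :=
      (eventually_lt_nhds h).mono fun s hs => hsub s hs 0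
    rw [h5.iteratedDeriv_eq, iteratedDeriv_const]
    simp
  · have h4 := h3 t ht x
    rw [Real.rpow_zero, ENNReal.ofReal_one, one_mul] at h4
    rw [mul_comm, ENNReal.coe_mul]
    refine mul_le_mul' h4 ?_
    rw [ENNReal.ofReal, ENNReal.coe_le_coe, Real.toNNReal_le_iff_le_coe]
    push_cast
    rw [Real.rpow_neg_one, one_div, inv_pow]
    exact inv_anti₀ (by positivity) h
end

lemma Ntwo_mono_weight {σ₁ σ₂ T : ℝ} (hT : 1 ≤ T) (h : σ₁ ≤ σ₂) (f : ℝ → ℝ → ℝ) :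
    Ntwo σ₁ T f ≤ Ntwo σ₂ T f :=
  Ntwo_le_iff.2 fun _ ht => (mul_le_mul_left (ENNReal.ofReal_le_ofReal
    (Real.rpow_le_rpow_of_exponent_le (hT.trans ht) h)) _).trans (le_Ntwo ht)

lemma Ntwo_le_inv_mul {σ T : ℝ} (hT : 0 < T) (f : ℝ → ℝ → ℝ) :
    Ntwo σ T f ≤ ENNReal.ofReal T⁻¹ * Ntwo (σ + 1) T f := by
  refine Ntwo_le_iff.2 fun t ht => ?_
  have ht0 := hT.trans_le ht
  refine le_trans ?_ (mul_le_mul_right (le_Ntwo ht) _)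
  rw [← mul_assoc, ← ENNReal.ofReal_mul (by positivity)]
  refine mul_le_mul_left (ENNReal.ofReal_le_ofReal ?_) _
  rw [Real.rpow_add_one ht0.ne', mul_comm, mul_assoc]
  refine le_mul_of_one_le_right (by positivity) ?_
  rw [← div_eq_mul_inv, one_le_div hT]
  exact ht

lemma cN_mono {N₁ N₂ : (ℝ → ℝ → ℝ) → ℝ≥0∞} (h : ∀ f, N₁ f ≤ N₂ f) (n : ℕ) (f : ℝ → ℝ → ℝ) :
    cN N₁ n f ≤ cN N₂ n f := by
  induction n generalizing f with
  | zero => exact h f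
  | succ n ih => exact add_le_add (ih _) (ih _)

lemma jet_mono {N₁ N₂ : (ℝ → ℝ → ℝ) → ℝ≥0∞} (h : ∀ f, N₁ f ≤ N₂ f) (k : ℕ) (ε : ℝ≥0)
    (f : ℝ → ℝ → ℝ) : jet N₁ k ε f ≤ jet N₂ k ε f :=
  Finset.sum_le_sum fun n _ => mul_le_mul_right (cN_mono h n f) _

section Cubic
variable {q w w' d F : ℝ → ℝ → ℝ} {σ M T β : ℝ} {k : ℕ} {ε A : ℝ≥0}

noncomputable def quad (q w w' : ℝ → ℝ → ℝ) : ℝ → ℝ → ℝ :=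
  (q + w) * (q + w) + (q + w) * (q + w') + (q + w') * (q + w')

noncomputable def Gn (β : ℝ) (q F w : ℝ → ℝ → ℝ) : ℝ → ℝ → ℝ := (-β) • (quad q w 0 * w) - F

lemma smooth2_quad (hq : Smooth2 q) (hw : Smooth2 w) (hw' : Smooth2 w') : Smooth2 (quad q w w') :=
  (((hq.add hw).mul (hq.add hw)).add ((hq.add hw).mul (hq.add hw'))).add
    ((hq.add hw').mul (hq.add hw'))

lemma smooth2_Gn (hq : Smooth2 q) (hF : Smooth2 F) (hw : Smooth2 w) : Smooth2 (Gn β q F w) :=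
  (((smooth2_quad hq hw Smooth2.zero).mul hw).smul _).sub hF

lemma Gn_sub : Gn β q F w - Gn β q F w' = (-β) • (quad q w w' * (w - w')) := by
  ext t x
  simp only [Gn, quad, Pi.sub_apply, Pi.smul_apply, Pi.mul_apply, Pi.add_apply, Pi.zero_apply,
    smul_eq_mul]
  ring

lemma jet_Nsup_mul (hT : 0 < T) {σ₁ σ₂ : ℝ} {f g : ℝ → ℝ → ℝ} (hf : Smooth2 f) (hg : Smooth2 g) :
    jet (Nsup (σ₁ + σ₂) T) k ε (f * g) ≤ jet (Nsup σ₁ T) k ε f * jet (Nsup σ₂ T) k ε g :=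
  jet_mul_le (Nsup_subAdd _ _) (fun f g _ _ => Nsup_mul hT f g) k ε hf hg

lemma jet_Ntwo_mul (hT : 0 < T) {σ₁ σ₂ : ℝ} {f g : ℝ → ℝ → ℝ} (hf : Smooth2 f) (hg : Smooth2 g) :
    jet (Ntwo (σ₁ + σ₂) T) k ε (f * g) ≤ jet (Nsup σ₁ T) k ε f * jet (Ntwo σ₂ T) k ε g :=
  jet_mul_le (Ntwo_subAdd _ _) (fun _ _ => Ntwo_mul hT) k ε hf hg

lemma jet_quad_le (hT : 1 ≤ T) (hM : 1 / 2 ≤ M) (hq : Smooth2 q) (hw : Smooth2 w)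
    (hw' : Smooth2 w') (hqA : jet (Nsup (1 / 2) T) k ε q ≤ A)
    (hw1 : jet (Nsup M T) k ε w ≤ 1) (hw1' : jet (Nsup M T) k ε w' ≤ 1) :
    jet (Nsup 1 T) k ε (quad q w w') ≤ ((3 * (A + 1) ^ 2 : ℝ≥0) : ℝ≥0∞) := by
  have key : ∀ u, Smooth2 u → jet (Nsup M T) k ε u ≤ 1 →
      jet (Nsup (1 / 2) T) k ε (q + u) ≤ ((A + 1 : ℝ≥0) : ℝ≥0∞) := by
    intro u hu h1
    refine (jet_add_le (Nsup_subAdd _ _) k ε _ _ hq hu).trans ?_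
    rw [ENNReal.coe_add]
    exact add_le_add hqA ((jet_mono (Nsup_mono_weight hT hM) k ε u).trans h1)
  have key2 : ∀ u u', Smooth2 u → Smooth2 u' → jet (Nsup (1 / 2) T) k ε u ≤ ((A + 1 : ℝ≥0) : ℝ≥0∞) →
      jet (Nsup (1 / 2) T) k ε u' ≤ ((A + 1 : ℝ≥0) : ℝ≥0∞) →
      jet (Nsup 1 T) k ε (u * u') ≤ (((A + 1) ^ 2 : ℝ≥0) : ℝ≥0∞) := by
    intro u u' hu hu' h1 h2
    have h3 := jet_Nsup_mul (σ₁ := 1 / 2) (σ₂ := 1 / 2) (k := k) (ε := ε)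
      (zero_lt_one.trans_le hT) hu hu'
    rw [add_halves] at h3
    refine h3.trans ((mul_le_mul' h1 h2).trans_eq ?_)
    rw [← ENNReal.coe_mul, sq]
  have s1 := hq.add hw
  have s2 := hq.add hw'
  have j1 := key w hw hw1
  have j2 := key w' hw' hw1'
  refine (jet_add_le (Nsup_subAdd _ _) k ε _ _ ((s1.mul s1).add (s1.mul s2)) (s2.mul s2)).trans ?_
  refine (add_le_add ((jet_add_le (Nsup_subAdd _ _) k ε _ _ (s1.mul s1) (s1.mul s2)).trans
    (add_le_add (key2 _ _ s1 s1 j1 j1) (key2 _ _ s1 s2 j1 j2))) (key2 _ _ s2 s2 j2 j2)).trans_eq ?_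
  rw [← ENNReal.coe_add, ← ENNReal.coe_add]
  congr 1
  ring

lemma jet_cubic_le (hT : 1 ≤ T) (hM : 1 / 2 ≤ M) (hq : Smooth2 q) (hw : Smooth2 w)
    (hw' : Smooth2 w') (hd : Smooth2 d) (hqA : jet (Nsup (1 / 2) T) k ε q ≤ A)
    (hw1 : jet (Nsup M T) k ε w ≤ 1) (hw1' : jet (Nsup M T) k ε w' ≤ 1) :
    jet (Ntwo (σ + 1) T) k ε ((-β) • (quad q w w' * d)) ≤
      ((‖β‖₊ * (3 * (A + 1) ^ 2) : ℝ≥0) : ℝ≥0∞) * jet (Ntwo σ T) k ε d := by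
  have hs := smooth2_quad hq hw hw'
  rw [jet_smul (fun c f => Ntwo_smul c f) _ k ε (hs.mul hd), add_comm σ 1, ENNReal.coe_mul,
    mul_assoc, enorm_neg, enorm_eq_nnnorm]
  exact mul_le_mul_right ((jet_Ntwo_mul (zero_lt_one.trans_le hT) hs hd).trans
    (mul_le_mul_left (jet_quad_le hT hM hq hw hw' hqA hw1 hw1') _)) _

end Cubic

section Iteration
variable {q F w : ℝ → ℝ → ℝ} {M T β : ℝ} {k : ℕ} {ε A K : ℝ≥0}

/-- Time cutoff equal to one for `t ≥ T - 1`, vanishing for `t ≤ T - 2`. -/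
noncomputable def psi (T t _x : ℝ) : ℝ := Real.smoothTransition (t - T + 2)

lemma smooth2_psi (T : ℝ) : Smooth2 (psi T) :=
  Smooth2.of_fst (h := fun t => Real.smoothTransition (t - T + 2))
    (Real.smoothTransition.contDiff.comp ((contDiff_id.sub contDiff_const).add contDiff_const))

noncomputable def src (β : ℝ) (q F : ℝ → ℝ → ℝ) (T : ℝ) (j : ℕ) (w : ℝ → ℝ → ℝ) : ℝ → ℝ → ℝ :=
  psi T * (chi j * Gn β q F w)

noncomputable def iter (β : ℝ) (q F : ℝ → ℝ → ℝ) (T : ℝ) : ℕ → ℝ → ℝ → ℝ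
  | 0 => 0
  | j + 1 => Lop (src β q F T j (iter β q F T j))

lemma src_eq {t : ℝ} (ht : T - 1 < t) (j : ℕ) (x : ℝ) :
    src β q F T j w t x = (chi j * Gn β q F w) t x := by
  simp only [src, Pi.mul_apply, psi]
  rw [Real.smoothTransition.one_of_one_le (by linarith), one_mul]

lemma CS_src (hq : Smooth2 q) (hF : Smooth2 F) (hF0 : ∀ t x, t ≤ |x| → F t x = 0)
    (hw : Smooth2 w) (hR : ∃ R, ∀ t x, R < |x| + t → w t x = 0) (j : ℕ) :
    CS (src β q F T j w) := by
  obtain ⟨R, hR⟩ := hR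
  refine ⟨(smooth2_psi T).mul ((smooth2_chi j).mul (smooth2_Gn hq hF hw)),
    T - 2, max R (2 * (2 ^ j + 1)), fun t x htx => ?_⟩
  simp only [src, Pi.mul_apply]
  rcases htx with h | h
  · rw [psi, Real.smoothTransition.zero_of_nonpos (by linarith), zero_mul]
  · rcases le_or_gt t (2 ^ j + 1) with h1 | h1
    · have h2 : F t x = 0 := hF0 t x (by linarith [le_max_right R (2 * (2 ^ j + 1))])
      have h3 : w t x = 0 := hR t x ((le_max_left _ _).trans_lt h)
      simp [Gn, h2, h3]
    · rw [chi, Real.smoothTransition.zero_of_nonpos (by linarith), zero_mul, mul_zero]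

lemma iter_smooth (hq : Smooth2 q) (hF : Smooth2 F) (hF0 : ∀ t x, t ≤ |x| → F t x = 0) (j : ℕ) :
    Smooth2 (iter β q F T j) ∧ ∃ R, ∀ t x, R < |x| + t → iter β q F T j t x = 0 := by
  induction j with
  | zero => exact ⟨Smooth2.zero, 0, fun _ _ _ => rfl⟩
  | succ j ih =>
    have h := CS_src (β := β) (T := T) hq hF hF0 ih.1 ih.2 j
    obtain ⟨a, R, hR⟩ := h.2
    exact ⟨smooth2_Lop h, R, fun t x htx =>
      Lop_support (fun t x htx => hR t x (Or.inr htx)) t x htx⟩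

lemma jet_Lop_estimate {g : ℝ → ℝ → ℝ} (h : CS g) (hM : 0 < M) (hT : 0 < T) :
    jet (Ntwo M T) k ε (Lop g) ≤ ENNReal.ofReal (1 / M) * jet (Ntwo (M + 1) T) k ε g ∧
    jet (Nsup M T) k ε (Lop g) ≤ ENNReal.ofReal (1 / M) * jet (Ntwo (M + 1) T) k ε g :=
  ⟨jet_Lop_le (fun _ h => (Lop_estimate h hM hT).1) k ε h,
    jet_Lop_le (fun _ h => (Lop_estimate h hM hT).2) k ε h⟩

/-- Jet bounds at scale `ε` on the data of the iteration. -/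
structure JetData (q F : ℝ → ℝ → ℝ) (M T : ℝ) (A : ℝ≥0) (k : ℕ) (ε : ℝ≥0) : Prop where
  hq : jet (Nsup (1 / 2) T) k ε q ≤ A
  hF : jet (Ntwo (M + 1) T) k ε F ≤ 1
  hchi : ∀ j, jet (Nsup 0 T) k ε (chi j) ≤ 2

lemma jet_Gn_le (J : JetData q F M T A k ε) (hT : 1 ≤ T) (hM : 2 ≤ M) (hq : Smooth2 q)
    (hF : Smooth2 F) (hw : Smooth2 w) (hw1 : jet (Nsup M T) k ε w ≤ 1)
    (hw2 : jet (Ntwo M T) k ε w ≤ 1) :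
    jet (Ntwo (M + 1) T) k ε (Gn β q F w) ≤ ((‖β‖₊ * (3 * (A + 1) ^ 2) + 1 : ℝ≥0) : ℝ≥0∞) := by
  have z : jet (Nsup M T) k ε 0 ≤ 1 := by
    have := jet_smul (N := Nsup M T) (fun c f => Nsup_smul c f) 0 k ε Smooth2.zero
    simp at this
    simp [this]
  have hs := ((smooth2_quad hq hw Smooth2.zero).mul hw).smul (-β)
  have e : Gn β q F w = (-β) • (quad q w 0 * w) + (-1 : ℝ) • F := by
    ext t x; simp [Gn]; ring
  rw [e, ENNReal.coe_add]
  refine (jet_add_le (Ntwo_subAdd _ _) k ε _ _ hs (hF.smul _)).trans (add_le_add ?_ ?_)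
  · refine (jet_cubic_le hT (by linarith) hq hw Smooth2.zero hw J.hq hw1 z).trans ?_
    calc _ ≤ ((‖β‖₊ * (3 * (A + 1) ^ 2) : ℝ≥0) : ℝ≥0∞) * 1 := mul_le_mul_right hw2 _
      _ = _ := mul_one _
  · rw [jet_smul (fun c f => Ntwo_smul c f) _ k ε hF, enorm_neg]
    simpa using J.hF

lemma iter_bound (J : JetData q F M T A k ε) (hT : 1 ≤ T) (hq : Smooth2 q)
    (hF : Smooth2 F) (hF0 : ∀ t x, t ≤ |x| → F t x = 0)
    (hM : 8 * (‖β‖ * (3 * (A + 1) ^ 2)) + 2 ≤ M) (j : ℕ) :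
    jet (Ntwo M T) k ε (iter β q F T j) ≤ 1 ∧ jet (Nsup M T) k ε (iter β q F T j) ≤ 1 := by
  have hT0 : 0 < T := zero_lt_one.trans_le hT
  have hK : 0 ≤ ‖β‖ * (3 * ((A : ℝ) + 1) ^ 2) := by positivity
  have hM0 : 0 < M := by linarith
  induction j with
  | zero =>
    have h1 := jet_smul (N := Nsup M T) (fun c f => Nsup_smul c f) 0 k ε Smooth2.zero
    have h2 := jet_smul (N := Ntwo M T) (fun c f => Ntwo_smul c f) 0 k ε Smooth2.zero
    simp at h1 h2
    simp [iter, h1, h2]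
  | succ j ih =>
    obtain ⟨hs, hR⟩ := iter_smooth (β := β) (T := T) hq hF hF0 j
    have hcs := CS_src (β := β) (T := T) hq hF hF0 hs hR j
    have h1 : jet (Ntwo (M + 1) T) k ε (src β q F T j (iter β q F T j)) ≤
        2 * ((‖β‖₊ * (3 * (A + 1) ^ 2) + 1 : ℝ≥0) : ℝ≥0∞) := by
      rw [jet_congr (Ntwo_local (M + 1) T) (sub_one_lt T) k ε fun t ht x => src_eq ht j x]
      have h2 := jet_Ntwo_mul (k := k) (ε := ε) (σ₁ := 0) (σ₂ := M + 1) hT0 (smooth2_chi j)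
        (smooth2_Gn (β := β) hq hF hs)
      rw [zero_add] at h2
      exact h2.trans (mul_le_mul' (J.hchi j) (jet_Gn_le J hT (by linarith) hq hF hs ih.2 ih.1))
    have h2 : ENNReal.ofReal (1 / M) * jet (Ntwo (M + 1) T) k ε (src β q F T j (iter β q F T j)) ≤ 1 := by
      refine (mul_le_mul_right h1 _).trans ?_
      rw [← ENNReal.ofReal_coe_nnreal, ← ENNReal.ofReal_ofNat, ← ENNReal.ofReal_mul (by norm_num),
        ← ENNReal.ofReal_mul (by positivity), ← ENNReal.ofReal_one]
      refine ENNReal.ofReal_le_ofReal ?_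
      push_cast
      rw [one_div, inv_mul_le_iff₀ hM0, mul_one]
      linarith
    have h3 := jet_Lop_estimate (k := k) (ε := ε) hcs hM0 hT0
    exact ⟨h3.1.trans h2, h3.2.trans h2⟩

lemma src_sub {w w' : ℝ → ℝ → ℝ} {t : ℝ} (ht : T - 1 < t) (j : ℕ) (x : ℝ) :
    (src β q F T (j + 1) w - src β q F T j w') t x =
      (chi (j + 1) * ((-β) • (quad q w w' * (w - w'))) +
        (chi (j + 1) - chi j) * Gn β q F w') t x := by
  rw [← Gn_sub (F := F)]
  simp only [Pi.sub_apply, Pi.add_apply, Pi.mul_apply, src_eq ht]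
  ring

lemma iter_diff (J : JetData q F M T A k ε) (hT : 1 ≤ T) (hq : Smooth2 q)
    (hF : Smooth2 F) (hF0 : ∀ t x, t ≤ |x| → F t x = 0)
    (hM : 8 * (‖β‖ * (3 * (A + 1) ^ 2)) + 2 ≤ M) :
    ∃ D : ℝ≥0, ∀ j, jet (Nsup (M - 1) T) k ε (iter β q F T (j + 1) - iter β q F T j) ≤
      ((D * (1 / 2) ^ j : ℝ≥0) : ℝ≥0∞) := by
  have hT0 : 0 < T := zero_lt_one.trans_le hT
  set K : ℝ≥0 := ‖β‖₊ * (3 * (A + 1) ^ 2) with hKdef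
  have hKc : (K : ℝ) = ‖β‖ * (3 * ((A : ℝ) + 1) ^ 2) := by rw [hKdef]; push_cast; rfl
  have hK : (0 : ℝ) ≤ K := K.2
  rw [← hKc] at hM
  have hM0 : 0 < M - 1 := by linarith
  obtain ⟨X, hX⟩ := exists_cN_chi_le
  set Y : ℝ≥0 := ∑ n ∈ Finset.range (k + 1), (ε ^ n / (n ! : ℝ≥0)) * (2 * X n) with hY
  have hYj : ∀ j, jet (Nsup (-1) T) k ε (chi (j + 1) - chi j) ≤ ((Y * (1 / 2) ^ j : ℝ≥0) : ℝ≥0∞) := by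
    intro j
    rw [jet, hY, Finset.sum_mul, ENNReal.ofNNReal_finsetSum]
    refine Finset.sum_le_sum fun n _ => ?_
    rw [mul_assoc, ENNReal.coe_mul]
    exact mul_le_mul_right (cN_chi_sub_le hX n j hT0) _
  set a : ℝ≥0 := (1 / (M - 1)).toNNReal with ha
  have haK : a * (2 * K) ≤ 1 / 4 := by
    rw [← NNReal.coe_le_coe]
    push_cast
    rw [ha, Real.coe_toNNReal _ (by positivity), one_div, inv_mul_le_iff₀ hM0]
    linarith
  have hs := fun j => (iter_smooth (β := β) (T := T) hq hF hF0 j).1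
  have hb := iter_bound (β := β) J hT hq hF hF0 (by rw [← hKc]; exact hM)
  have hcs := fun j => CS_src (β := β) (T := T) hq hF hF0 (hs j)
    (iter_smooth (β := β) (T := T) hq hF hF0 j).2 j
  set d := fun j => iter β q F T (j + 1) - iter β q F T j with hd
  have hds : ∀ j, Smooth2 (d j) := fun j => (hs (j + 1)).sub (hs j)
  have hsrc : ∀ j, jet (Ntwo (M - 1 + 1) T) k ε
      (src β q F T (j + 1) (iter β q F T (j + 1)) - src β q F T j (iter β q F T j)) ≤
      2 * (K * jet (Ntwo (M - 1) T) k ε (d j)) + ((Y * (1 / 2) ^ j * (K + 1) : ℝ≥0) : ℝ≥0∞) := by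
    intro j
    rw [jet_congr (Ntwo_local _ T) (sub_one_lt T) k ε fun t ht x => src_sub ht j x]
    have s1 := ((smooth2_quad hq (hs (j + 1)) (hs j)).mul (hds j)).smul (-β)
    have s2 := smooth2_Gn (β := β) hq hF (hs j)
    have s3 := smooth2_chi (j + 1)
    have s4 := s3.sub (smooth2_chi j)
    refine (jet_add_le (Ntwo_subAdd _ _) k ε _ _ (s3.mul s1) (s4.mul s2)).trans (add_le_add ?_ ?_)
    · have h2 := jet_Ntwo_mul (k := k) (ε := ε) (σ₁ := 0) (σ₂ := M - 1 + 1) hT0 s3 s1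
      rw [zero_add] at h2
      exact h2.trans (mul_le_mul' (J.hchi _)
        (jet_cubic_le hT (M := M) (by linarith) hq (hs _) (hs _) (hds j) J.hq (hb _).2 (hb _).2))
    · have h2 := jet_Ntwo_mul (k := k) (ε := ε) (σ₁ := -1) (σ₂ := M + 1) hT0 s4 s2
      rw [show -1 + (M + 1) = M - 1 + 1 by ring] at h2
      rw [ENNReal.coe_mul]
      exact h2.trans (mul_le_mul' (hYj j)
        (jet_Gn_le J hT (by linarith) hq hF (hs j) (hb j).2 (hb j).1))
  have hLop : ∀ j, jet (Ntwo (M - 1) T) k ε (d (j + 1)) ≤ a * (2 * (K * jet (Ntwo (M - 1) T) k ε (d j))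
        + ((Y * (1 / 2) ^ j * (K + 1) : ℝ≥0) : ℝ≥0∞)) ∧
      jet (Nsup (M - 1) T) k ε (d (j + 1)) ≤ a * (2 * (K * jet (Ntwo (M - 1) T) k ε (d j))
        + ((Y * (1 / 2) ^ j * (K + 1) : ℝ≥0) : ℝ≥0∞)) := by
    intro j
    have e : d (j + 1) = Lop (src β q F T (j + 1) (iter β q F T (j + 1)) -
        src β q F T j (iter β q F T j)) := (Lop_sub (hcs (j + 1)) (hcs j)).symm
    rw [e]
    have h3 := jet_Lop_estimate (k := k) (ε := ε) ((hcs (j + 1)).sub (hcs j)) hM0 hT0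
    exact ⟨h3.1.trans (mul_le_mul_right (hsrc j) _), h3.2.trans (mul_le_mul_right (hsrc j) _)⟩
  set D : ℝ≥0 := 1 + 4 * (a * Y * (K + 1)) with hD
  have hcalc : ∀ j, (a : ℝ≥0∞) * (2 * (K * ((D * (1 / 2) ^ j : ℝ≥0) : ℝ≥0∞))
        + ((Y * (1 / 2) ^ j * (K + 1) : ℝ≥0) : ℝ≥0∞)) ≤ ((D * (1 / 2) ^ (j + 1) : ℝ≥0) : ℝ≥0∞) := by
    intro j
    rw [← ENNReal.coe_ofNat, ← ENNReal.coe_mul, ← ENNReal.coe_mul, ← ENNReal.coe_add,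
      ← ENNReal.coe_mul, ENNReal.coe_le_coe]
    calc a * (2 * (K * (D * (1 / 2) ^ j)) + Y * (1 / 2) ^ j * (K + 1))
        = (a * (2 * K) * D + a * Y * (K + 1)) * (1 / 2) ^ j := by ring
      _ ≤ (1 / 4 * D + 1 / 4 * D) * (1 / 2) ^ j := by
          have h4 : a * Y * (K + 1) ≤ 1 / 4 * D :=
            calc a * Y * (K + 1) = 1 / 4 * (4 * (a * Y * (K + 1))) := by
                  rw [← mul_assoc (1 / 4) 4, show (1 / 4 * 4 : ℝ≥0) = 1 by norm_num, one_mul]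
              _ ≤ 1 / 4 * D := mul_le_mul_right (by rw [hD]; exact le_add_self) _
          exact mul_le_mul_left (add_le_add (mul_le_mul_left haK D) h4) _
      _ = _ := by
          rw [pow_succ, ← add_mul, show (1 / 4 + 1 / 4 : ℝ≥0) = 1 / 2 by norm_num]
          ring
  have hd0 : d 0 = iter β q F T 1 := by simp [hd, iter]
  have hD1 : (1 : ℝ≥0∞) ≤ ((D * (1 / 2) ^ 0 : ℝ≥0) : ℝ≥0∞) := by
    rw [pow_zero, mul_one, ← ENNReal.coe_one, ENNReal.coe_le_coe]
    exact le_self_add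
  have htwo : ∀ j, jet (Ntwo (M - 1) T) k ε (d j) ≤ ((D * (1 / 2) ^ j : ℝ≥0) : ℝ≥0∞) := by
    intro j
    induction j with
    | zero =>
      rw [hd0]
      exact (jet_mono (Ntwo_mono_weight hT (by linarith)) k ε _).trans ((hb 1).1.trans hD1)
    | succ j ih =>
      refine ((hLop j).1.trans ?_).trans (hcalc j)
      gcongr
  refine ⟨D, fun j => ?_⟩
  cases j with
  | zero =>
    change jet _ k ε (d 0) ≤ _
    rw [hd0]
    exact (jet_mono (Nsup_mono_weight hT (by linarith)) k ε _).trans ((hb 1).2.trans hD1)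
  | succ j =>
    refine ((hLop j).2.trans ?_).trans (hcalc j)
    gcongr
    exact htwo j

end Iteration

section
variable {q F : ℝ → ℝ → ℝ} {M T T₀ β : ℝ} {k : ℕ} {ε A C₀ : ℝ≥0}

lemma cN_ne_top_of_le {N₁ N₂ : (ℝ → ℝ → ℝ) → ℝ≥0∞} (h : ∀ f, N₁ f ≤ N₂ f) {n : ℕ} {f : ℝ → ℝ → ℝ}
    (hf : cN N₂ n f ≠ ⊤) : cN N₁ n f ≠ ⊤ := ne_top_of_le_ne_top hf (cN_mono h n f)

lemma exists_jetData (hT : 1 ≤ T₀) (hq : Nsup (1 / 2) T₀ q ≤ C₀)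
    (hqn : ∀ n, cN (Nsup (1 / 2) T₀) n q ≠ ⊤) (hFn : ∀ n, cN (Ntwo (M + 2) T₀) n F ≠ ⊤) :
    ∃ T, T₀ ≤ T ∧ ∀ k, ∃ ε, 0 < ε ∧ JetData q F M T (C₀ + 1) k ε := by
  set B := (Ntwo (M + 2) T₀ F).toReal with hB
  have hB0 : 0 ≤ B := ENNReal.toReal_nonneg
  set T := max T₀ (2 * B + 1) with hTdef
  have hT0 : T₀ ≤ T := le_max_left _ _
  have hTpos : 0 < T := by linarith
  refine ⟨T, hT0, fun k => ?_⟩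
  obtain ⟨X, hX⟩ := exists_cN_chi_le
  have hqT : ∀ n, cN (Nsup (1 / 2) T) n q ≠ ⊤ := fun n =>
    cN_ne_top_of_le (Nsup_mono_time hT0) (hqn n)
  have hFT : ∀ n, cN (Ntwo (M + 1) T) n F ≠ ⊤ := fun n =>
    cN_ne_top_of_le (fun f => (Ntwo_mono_weight (hT.trans hT0) (by linarith) f).trans
      (Ntwo_mono_time hT0 f)) (hFn n)
  set S : ℕ → ℝ≥0∞ := fun n => cN (Nsup (1 / 2) T) n q + cN (Ntwo (M + 1) T) n F + X n
  obtain ⟨ε, hε, hs⟩ := exists_small_scale S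
    (fun n => ENNReal.add_ne_top.2 ⟨ENNReal.add_ne_top.2 ⟨hqT n, hFT n⟩, ENNReal.coe_ne_top⟩) k
    (η := 1 / 2) (by simp)
  have h2 : (1 / 2 : ℝ≥0∞) ≤ 1 := by simp
  refine ⟨ε, hε, ?_, ?_, fun j => ?_⟩
  · refine (jet_le_of_scale (X := S) hs fun n => ?_).trans (?_ : _ ≤ ((C₀ + 1 : ℝ≥0) : ℝ≥0∞))
    · exact le_self_add.trans le_self_add
    · rw [ENNReal.coe_add]
      exact add_le_add ((Nsup_mono_time hT0 q).trans hq) h2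
  · refine (jet_le_of_scale (X := S) hs fun n => ?_).trans
      ((add_le_add_left (?_ : Ntwo (M + 1) T F ≤ 1 / 2) (1 / 2)).trans_eq (ENNReal.add_halves 1))
    · exact le_add_self.trans le_self_add
    · refine (Ntwo_le_inv_mul hTpos F).trans ?_
      have h3 : Ntwo (M + 1 + 1) T F ≤ ENNReal.ofReal B := by
        rw [hB, ENNReal.ofReal_toReal (show Ntwo (M + 2) T₀ F ≠ ⊤ from hFn 0), add_assoc, one_add_one_eq_two]
        exact Ntwo_mono_time hT0 F
      refine (mul_le_mul_right h3 _).trans ?_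
      rw [← ENNReal.ofReal_mul (by positivity), ← ENNReal.ofReal_one, ← ENNReal.ofReal_ofNat,
        ← ENNReal.ofReal_div_of_pos (by norm_num)]
      refine ENNReal.ofReal_le_ofReal ?_
      rw [inv_mul_le_iff₀ hTpos]
      linarith [le_max_right T₀ (2 * B + 1)]
  · refine (jet_le_of_scale (X := S) hs fun n => ?_).trans
      ((add_le_add (Nsup_chi_le j T) h2).trans_eq one_add_one_eq_two)
    exact (hX _ j T).trans le_add_self

lemma RC_iter (hT : 1 ≤ T) (hq : Smooth2 q) (hF : Smooth2 F) (hF0 : ∀ t x, t ≤ |x| → F t x = 0)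
    (hM : 8 * (‖β‖ * (3 * (A + 1) ^ 2)) + 2 ≤ M)
    (J : ∀ k, ∃ ε, 0 < ε ∧ JetData q F M T A k ε) : RC T (iter β q F T) := by
  have hM2 : 2 ≤ M := by
    have : 0 ≤ ‖β‖ * (3 * ((A : ℝ) + 1) ^ 2) := by positivity
    linarith
  refine ⟨fun j => (iter_smooth hq hF hF0 j).1, fun n => ?_⟩
  obtain ⟨ε, hε, J⟩ := J n
  obtain ⟨D, hD⟩ := iter_diff J hT hq hF hF0 hM
  refine ⟨(ε ^ n / (n ! : ℝ≥0))⁻¹ * D, fun j => ?_⟩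
  have hne : ε ^ n / (n ! : ℝ≥0) ≠ 0 := by positivity
  calc _ ≤ cN (Nsup (M - 1) T) n (iter β q F T (j + 1) - iter β q F T j) :=
        cN_mono (Nsup_mono_weight hT (by linarith)) n _
    _ ≤ (wt ε n)⁻¹ * jet (Nsup (M - 1) T) n ε (iter β q F T (j + 1) - iter β q F T j) :=
        cN_le_jet le_rfl hε
    _ ≤ (wt ε n)⁻¹ * ((D * (1 / 2) ^ j : ℝ≥0) : ℝ≥0∞) := mul_le_mul_right (hD j) _
    _ = _ := by
        rw [wt, ← ENNReal.coe_inv hne, ← ENNReal.coe_mul, mul_assoc]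

lemma Ntwo_limF_le {f : ℕ → ℝ → ℝ → ℝ} (h : RC T f) (hT : 0 < T) {σ : ℝ} {C : ℝ≥0∞}
    (hf : ∀ j, Ntwo σ T (f j) ≤ C) : Ntwo σ T (limF f) ≤ C := by
  refine Ntwo_le_iff.2 fun t ht => ?_
  have ht0 : 0 < t ^ σ := Real.rpow_pos_of_pos (hT.trans_le ht) _
  have h0 : ENNReal.ofReal (t ^ σ) ≠ 0 := by simpa using ht0
  rw [mul_comm, ← ENNReal.le_div_iff_mul_le (Or.inl h0) (Or.inl ENNReal.ofReal_ne_top)]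
  refine eLpNorm_lim_le (fun j => (h.1 j).continuous_slice t) (fun j => ?_) (h.tendsto ht)
  rw [ENNReal.le_div_iff_mul_le (Or.inl h0) (Or.inl ENNReal.ofReal_ne_top), mul_comm]
  exact (le_Ntwo ht).trans (hf j)

lemma Nsup_limF_le {f : ℕ → ℝ → ℝ → ℝ} (h : RC T f) {σ : ℝ} {C : ℝ≥0∞}
    (hf : ∀ j, Nsup σ T (f j) ≤ C) : Nsup σ T (limF f) ≤ C := by
  refine Nsup_le_iff.2 fun t ht x => ?_
  refine le_of_tendsto (ENNReal.Tendsto.const_mul (h.tendsto ht x).enorm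
    (Or.inr ENNReal.ofReal_ne_top)) (Eventually.of_forall fun j => (le_Nsup ht x).trans (hf j))

/-- Perturbation theorem: an approximate solution `q` with a sufficiently small error `F` can be
corrected to an exact solution `q + w`. -/
theorem exists_correction (β : ℝ) (C₀ : ℝ≥0) : ∃ M₀ : ℝ, ∀ M, M₀ ≤ M → ∀ (q F : ℝ → ℝ → ℝ) (T₀ : ℝ),
    1 ≤ T₀ → Smooth2 q → Smooth2 F → (∀ t x, t ≤ |x| → F t x = 0) →
    Nsup (1 / 2) T₀ q ≤ C₀ → (∀ n, cN (Nsup (1 / 2) T₀) n q ≠ ⊤) →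
    (∀ n, cN (Ntwo (M + 2) T₀) n F ≠ ⊤) →
    ∃ T, T₀ ≤ T ∧ ∃ w : ℝ → ℝ → ℝ,
      ContDiffOn ℝ (⊤ : ℕ∞) (fun p : ℝ × ℝ => w p.1 p.2) {p | T < p.1} ∧
      (∀ t, T < t → ∀ x, box w t x + w t x = -β * ((q t x + w t x) ^ 3 - q t x ^ 3) - F t x) ∧
      ∃ C : ℝ≥0, Nsup M (T + 1) w ≤ C ∧ Ntwo M (T + 1) w ≤ C ∧ Ntwo M (T + 1) (pt w) ≤ C ∧
        Ntwo M (T + 1) (px w) ≤ C := by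
  refine ⟨8 * (‖β‖ * (3 * (((C₀ + 1 : ℝ≥0) : ℝ) + 1) ^ 2)) + 2, ?_⟩
  intro M hM q F T₀ hT₀ hq hF hF0 hqC hqn hFn
  obtain ⟨T, hT, J⟩ := exists_jetData hT₀ hqC hqn hFn
  have hT1 : 1 ≤ T := hT₀.trans hT
  have hT0 : 0 < T := zero_lt_one.trans_le hT1
  have h := RC_iter (β := β) hT1 hq hF hF0 hM J
  have hlt : T < T + 1 := lt_add_one T
  refine ⟨T, hT, limF (iter β q F T), h.contDiffOn, fun t ht x => ?_, ?_⟩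
  · have h1 : Tendsto (fun j => box (iter β q F T j) t x + iter β q F T j t x) atTop
        (𝓝 (box (limF (iter β q F T)) t x + limF (iter β q F T) t x)) :=
      (h.tendsto_box ht x).add (h.tendsto ht.le x)
    set W := limF (iter β q F T) t x
    have h2 : Tendsto (fun j => -β * ((q t x + iter β q F T j t x) ^ 3 - q t x ^ 3) - F t x) atTop
        (𝓝 (-β * ((q t x + W) ^ 3 - q t x ^ 3) - F t x)) :=
      ((((tendsto_const_nhds.add (h.tendsto ht.le x)).pow 3).sub_const _).const_mul _).sub_const _
    refine tendsto_nhds_unique (h1.comp (tendsto_add_atTop_nat 1)) (h2.congr' ?_)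
    have h3 : ∀ᶠ j : ℕ in atTop, t ≤ 2 ^ j :=
      (tendsto_pow_atTop_atTop_of_one_lt (one_lt_two : (1 : ℝ) < 2)).eventually_ge_atTop t
    filter_upwards [h3] with j hj
    obtain ⟨hs, hR⟩ := iter_smooth (β := β) (T := T) hq hF hF0 j
    have h4 := congrFun (congrFun (box_Lop (CS_src (β := β) (T := T) hq hF hF0 hs hR j)) t) x
    refine Eq.trans ?_ h4.symm
    rw [src_eq (by linarith) j x]
    simp only [Pi.mul_apply, chi, Gn, quad, Pi.sub_apply, Pi.smul_apply, Pi.add_apply,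
      Pi.zero_apply, smul_eq_mul]
    rw [Real.smoothTransition.one_of_one_le (by linarith)]
    ring
  · obtain ⟨ε, hε, J⟩ := J 1
    have hb := iter_bound (β := β) J hT1 hq hF hF0 hM
    have hεne : wt ε 1 ≠ 0 := wt_ne_zero hε 1
    have h1 : ∀ j, cN (Ntwo M T) 1 (iter β q F T j) ≤ (wt ε 1)⁻¹ := fun j =>
      (cN_le_jet le_rfl hε).trans ((mul_le_mul_right (hb j).1 _).trans_eq (mul_one _))
    have hpt : ∀ j, Ntwo M T (pt (iter β q F T j)) ≤ (wt ε 1)⁻¹ := fun j => le_self_add.trans (h1 j)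
    have hpx : ∀ j, Ntwo M T (px (iter β q F T j)) ≤ (wt ε 1)⁻¹ := fun j => le_add_self.trans (h1 j)
    have hC : (((1 + (wt ε 1)⁻¹).toNNReal : ℝ≥0) : ℝ≥0∞) = 1 + (wt ε 1)⁻¹ :=
      ENNReal.coe_toNNReal (by simp [hεne])
    refine ⟨(1 + (wt ε 1)⁻¹).toNNReal, ?_⟩
    rw [hC]
    refine ⟨?_, ?_, ?_, ?_⟩
    · exact (Nsup_mono_time hlt.le _).trans
        ((Nsup_limF_le h fun j => (le_jet _ _).trans (hb j).2).trans le_self_add)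
    · exact (Ntwo_mono_time hlt.le _).trans
        ((Ntwo_limF_le h hT0 fun j => (le_jet _ _).trans (hb j).1).trans le_self_add)
    · rw [Ntwo_local M (T + 1) _ _ fun t ht x => h.pt_limF (hlt.trans_le ht) x]
      exact (Ntwo_mono_time hlt.le _).trans ((Ntwo_limF_le h.pt hT0 hpt).trans le_add_self)
    · rw [Ntwo_local M (T + 1) _ _ fun t ht x => h.px_limF (hlt.trans_le ht) x]
      exact (Ntwo_mono_time hlt.le _).trans ((Ntwo_limF_le h.px hT0 hpx).trans le_add_self)

end

/-- `f` decays faster than every power of `cosh`. -/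
def CoshDecay (f : ℝ → ℝ) : Prop := ∀ N : ℕ, ∃ C : ℝ, ∀ y, |f y| * cosh y ^ N ≤ C

/-- `f` and its first `n` derivatives decay faster than every power of `cosh`. -/
def CoshDecayN : ℕ → (ℝ → ℝ) → Prop
  | 0, f => CoshDecay f
  | n + 1, f => CoshDecay f ∧ CoshDecayN n (deriv f)

/-- Smooth functions all of whose derivatives decay faster than every power of `cosh`. -/
def CoshSchwartz (f : ℝ → ℝ) : Prop := ContDiff ℝ (⊤ : ℕ∞) f ∧ ∀ n, CoshDecayN n f

section
variable {f g : ℝ → ℝ} {n : ℕ}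

lemma CoshDecay.add (hf : CoshDecay f) (hg : CoshDecay g) : CoshDecay (f + g) := fun N => by
  obtain ⟨C, hC⟩ := hf N
  obtain ⟨C', hC'⟩ := hg N
  refine ⟨C + C', fun y => ?_⟩
  have h : 0 ≤ cosh y ^ N := by positivity
  calc |f y + g y| * cosh y ^ N ≤ (|f y| + |g y|) * cosh y ^ N :=
        mul_le_mul_of_nonneg_right (abs_add_le _ _) h
    _ ≤ C + C' := by rw [add_mul]; exact add_le_add (hC y) (hC' y)

lemma CoshDecay.mul_of_le (hf : CoshDecay f) {k : ℕ} {K : ℝ} (hg : ∀ y, |g y| ≤ K * cosh y ^ k) :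
    CoshDecay (g * f) := fun N => by
  obtain ⟨C, hC⟩ := hf (k + N)
  refine ⟨|K| * C, fun y => ?_⟩
  have h : 0 ≤ cosh y ^ N := by positivity
  have h' : 0 ≤ cosh y ^ k := by positivity
  calc |g y * f y| * cosh y ^ N ≤ (|K| * cosh y ^ k * |f y|) * cosh y ^ N := by
        rw [abs_mul]
        refine mul_le_mul_of_nonneg_right (mul_le_mul_of_nonneg_right ((hg y).trans ?_)
          (abs_nonneg _)) h
        exact mul_le_mul_of_nonneg_right (le_abs_self K) h'
    _ = |K| * (|f y| * cosh y ^ (k + N)) := by rw [pow_add]; ring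
    _ ≤ |K| * C := mul_le_mul_of_nonneg_left (hC y) (abs_nonneg _)

lemma CoshDecay.mul (hf : CoshDecay f) (hg : CoshDecay g) : CoshDecay (f * g) := by
  obtain ⟨C, hC⟩ := hf 0
  exact hg.mul_of_le (k := 0) (K := C) fun y => by simpa using hC y

lemma CoshDecayN.decay (hf : CoshDecayN n f) : CoshDecay f := by
  cases n with
  | zero => exact hf
  | succ n => exact hf.1

lemma CoshDecayN.of_succ (hf : CoshDecayN (n + 1) f) : CoshDecayN n f := by
  induction n generalizing f with
  | zero => exact hf.1
  | succ n ih => exact ⟨hf.1, ih hf.2⟩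

lemma contDiff_deriv (hf : ContDiff ℝ (⊤ : ℕ∞) f) : ContDiff ℝ (⊤ : ℕ∞) (deriv f) :=
  (contDiff_infty_iff_deriv.1 hf).2

lemma contDiff_differentiable (hf : ContDiff ℝ (⊤ : ℕ∞) f) : Differentiable ℝ f :=
  (contDiff_infty_iff_deriv.1 hf).1

lemma CoshDecayN.add (hf : ContDiff ℝ (⊤ : ℕ∞) f) (hg : ContDiff ℝ (⊤ : ℕ∞) g)
    (hf' : CoshDecayN n f) (hg' : CoshDecayN n g) : CoshDecayN n (f + g) := by
  induction n generalizing f g with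
  | zero => exact CoshDecay.add hf' hg'
  | succ n ih =>
    refine ⟨hf'.1.add hg'.1, ?_⟩
    rw [show deriv (f + g) = deriv f + deriv g from
      funext fun y => deriv_add (contDiff_differentiable hf y) (contDiff_differentiable hg y)]
    exact ih (contDiff_deriv hf) (contDiff_deriv hg) hf'.2 hg'.2

lemma CoshDecayN.mul (hf : ContDiff ℝ (⊤ : ℕ∞) f) (hg : ContDiff ℝ (⊤ : ℕ∞) g)
    (hf' : CoshDecayN n f) (hg' : CoshDecayN n g) : CoshDecayN n (f * g) := by
  induction n generalizing f g with
  | zero => exact CoshDecay.mul hf' hg'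
  | succ n ih =>
    refine ⟨hf'.1.mul hg'.1, ?_⟩
    rw [show deriv (f * g) = deriv f * g + f * deriv g from
      funext fun y => deriv_mul (contDiff_differentiable hf y) (contDiff_differentiable hg y)]
    exact CoshDecayN.add ((contDiff_deriv hf).mul hg) (hf.mul (contDiff_deriv hg))
      (ih (contDiff_deriv hf) hg hf'.2 hg'.of_succ) (ih hf (contDiff_deriv hg) hf'.of_succ hg'.2)

lemma CoshDecayN.cosh_sinh_mul (hf : ContDiff ℝ (⊤ : ℕ∞) f) (hf' : CoshDecayN n f) :
    CoshDecayN n (cosh * f) ∧ CoshDecayN n (sinh * f) := by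
  have hc : ∀ y : ℝ, |cosh y| ≤ 1 * cosh y ^ 1 := fun y => by
    rw [abs_of_pos (cosh_pos y)]; simp
  have hs : ∀ y : ℝ, |sinh y| ≤ 1 * cosh y ^ 1 := fun y => by
    rw [one_mul, pow_one]; exact abs_le_of_sq_le_sq (by rw [cosh_sq]; linarith) (cosh_pos y).le
  induction n generalizing f with
  | zero => exact ⟨CoshDecay.mul_of_le hf' hc, CoshDecay.mul_of_le hf' hs⟩
  | succ n ih =>
    have h1 := ih hf hf'.of_succ
    have h2 := ih (contDiff_deriv hf) hf'.2
    refine ⟨⟨hf'.1.mul_of_le hc, ?_⟩, ⟨hf'.1.mul_of_le hs, ?_⟩⟩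
    · rw [show deriv (cosh * f) = sinh * f + cosh * deriv f from
        funext fun y => by
          rw [deriv_mul differentiableAt_cosh (contDiff_differentiable hf y), Real.deriv_cosh]; rfl]
      exact CoshDecayN.add (contDiff_sinh.mul hf) (contDiff_cosh.mul (contDiff_deriv hf)) h1.2 h2.1
    · rw [show deriv (sinh * f) = cosh * f + sinh * deriv f from
        funext fun y => by
          rw [deriv_mul differentiableAt_sinh (contDiff_differentiable hf y), Real.deriv_sinh]; rfl]
      exact CoshDecayN.add (contDiff_cosh.mul hf) (contDiff_sinh.mul (contDiff_deriv hf)) h1.1 h2.2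

lemma CoshSchwartz.deriv (hf : CoshSchwartz f) : CoshSchwartz (deriv f) :=
  ⟨contDiff_deriv hf.1, fun n => (hf.2 (n + 1)).2⟩

lemma CoshSchwartz.mul (hf : CoshSchwartz f) (hg : CoshSchwartz g) : CoshSchwartz (f * g) :=
  ⟨hf.1.mul hg.1, fun n => CoshDecayN.mul hf.1 hg.1 (hf.2 n) (hg.2 n)⟩

lemma CoshSchwartz.cosh_mul (hf : CoshSchwartz f) : CoshSchwartz (cosh * f) :=
  ⟨contDiff_cosh.mul hf.1, fun n => (CoshDecayN.cosh_sinh_mul hf.1 (hf.2 n)).1⟩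

lemma CoshSchwartz.sinh_mul (hf : CoshSchwartz f) : CoshSchwartz (sinh * f) :=
  ⟨contDiff_sinh.mul hf.1, fun n => (CoshDecayN.cosh_sinh_mul hf.1 (hf.2 n)).2⟩

lemma CoshDecayN.smul (c : ℝ) (hf : ContDiff ℝ (⊤ : ℕ∞) f) (hf' : CoshDecayN n f) :
    CoshDecayN n (c • f) := by
  have h : ∀ {f : ℝ → ℝ}, CoshDecay f → CoshDecay (c • f) := fun {f} hf => by
    have := hf.mul_of_le (g := fun _ => c) (k := 0) (K := |c|) fun y => by simp
    exact this
  induction n generalizing f with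
  | zero => exact h hf'
  | succ n ih =>
    refine ⟨h hf'.1, ?_⟩
    rw [show _root_.deriv (c • f) = c • _root_.deriv f from
      funext fun y => deriv_const_smul c (contDiff_differentiable hf y)]
    exact ih (contDiff_deriv hf) hf'.2

lemma CoshSchwartz.smul (c : ℝ) (hf : CoshSchwartz f) : CoshSchwartz (c • f) :=
  ⟨hf.1.const_smul c, fun n => CoshDecayN.smul c hf.1 (hf.2 n)⟩

lemma coshSchwartz_comp_sinh (hf : ContDiff ℝ (⊤ : ℕ∞) f)
    (hdec : ∀ k N : ℕ, ∃ C : ℝ, ∀ z : ℝ, |iteratedDeriv k f z| ≤ C * (1 + |z|) ^ (-(N : ℝ))) :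
    CoshSchwartz (f ∘ sinh) := by
  refine ⟨hf.comp contDiff_sinh, fun n => ?_⟩
  have h0 : ∀ {f : ℝ → ℝ}, (∀ k N : ℕ, ∃ C : ℝ, ∀ z : ℝ,
      |iteratedDeriv k f z| ≤ C * (1 + |z|) ^ (-(N : ℝ))) → CoshDecay (f ∘ sinh) := by
    intro f hdec N
    obtain ⟨C, hC⟩ := hdec 0 N
    have hC0 : 0 ≤ C := by
      have := (abs_nonneg _).trans (hC 0)
      simpa using this
    refine ⟨C, fun y => ?_⟩
    have h1 : 0 < 1 + |sinh y| := by positivity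
    have h2 : cosh y ≤ 1 + |sinh y| := by
      refine abs_le_of_sq_le_sq' ?_ h1.le |>.2
      rw [cosh_sq, add_sq, sq_abs]
      nlinarith [abs_nonneg (sinh y)]
    have h3 := hC (sinh y)
    rw [iteratedDeriv_zero, rpow_neg h1.le, rpow_natCast, ← div_eq_mul_inv,
      le_div_iff₀ (by positivity)] at h3
    exact (mul_le_mul_of_nonneg_left (pow_le_pow_left₀ (cosh_pos y).le h2 N) (abs_nonneg _)).trans h3
  induction n generalizing f with
  | zero => exact h0 hdec
  | succ n ih =>
    refine ⟨h0 hdec, ?_⟩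
    have hd : ∀ k N : ℕ, ∃ C : ℝ, ∀ z : ℝ,
        |iteratedDeriv k (deriv f) z| ≤ C * (1 + |z|) ^ (-(N : ℝ)) := fun k N => by
      simpa only [iteratedDeriv_succ'] using hdec (k + 1) N
    rw [show deriv (f ∘ sinh) = cosh * (deriv f ∘ sinh) from funext fun y => by
      rw [deriv_comp y (contDiff_differentiable hf _) differentiableAt_sinh, Real.deriv_sinh,
        mul_comm]; rfl]
    exact (CoshDecayN.cosh_sinh_mul ((contDiff_deriv hf).comp contDiff_sinh)
      (ih (contDiff_deriv hf) hd)).1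

end

/-- The phase data: the phase is `exp L + κ(y) L + B(y)`. -/
structure Profile where
  κ : ℝ → ℝ
  B : ℝ → ℝ
  hκ : CoshSchwartz κ
  hB : ContDiff ℝ (⊤ : ℕ∞) B
  hB' : CoshSchwartz (deriv B)

/-- The phase function in the hyperbolic coordinates `(L, y)`. -/
noncomputable def Profile.phase (P : Profile) (L y : ℝ) : ℝ := exp L + P.κ y * L + P.B y

/-- The elementary oscillating functions. -/
noncomputable def gen (P : Profile) (m : ℕ) (c : ℝ → ℝ) (l : ℕ) (j : ℤ) (α : ℝ) : ℝ → ℝ → ℝ :=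
  fun L y => exp (-(m * L)) * c y * L ^ l * cos (j * P.phase L y + α)

/-- The function `exp (-L)`. -/
noncomputable def em : ℝ → ℝ → ℝ := fun L _ => exp (-L)

/-- The derivative `exp (-L) ∂_L`. -/
noncomputable def DL (f : ℝ → ℝ → ℝ) : ℝ → ℝ → ℝ := em * pt f

/-- The span of the elementary functions of order at least `k`, with logarithmic excess `s`. -/
def osc (P : Profile) (k s : ℕ) : Submodule ℝ (ℝ → ℝ → ℝ) :=
  Submodule.span ℝ {f | ∃ m c l j α, CoshSchwartz c ∧ k ≤ m ∧ l ≤ 2 * m + s ∧ f = gen P m c l j α}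

section
variable {P : Profile} {k s k' s' : ℕ} {f g : ℝ → ℝ → ℝ}

lemma gen_mem {m l : ℕ} {c : ℝ → ℝ} {j : ℤ} {α : ℝ} (hc : CoshSchwartz c) (hm : k ≤ m)
    (hl : l ≤ 2 * m + s) : gen P m c l j α ∈ osc P k s :=
  Submodule.subset_span ⟨m, c, l, j, α, hc, hm, hl, rfl⟩

lemma osc_mono (hk : k' ≤ k) (hs : s ≤ s') : osc P k s ≤ osc P k' s' := by
  refine Submodule.span_le.2 ?_
  rintro _ ⟨m, c, l, j, α, hc, hm, hl, rfl⟩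
  exact gen_mem hc (hk.trans hm) (hl.trans (by omega))

lemma smooth2_gen {m l : ℕ} {c : ℝ → ℝ} {j : ℤ} {α : ℝ} (hc : CoshSchwartz c) :
    Smooth2 (gen P m c l j α) := by
  have h1 := P.hκ.1
  have h2 := P.hB
  have h3 := hc.1
  unfold Smooth2 gen Profile.phase
  fun_prop

lemma osc_smooth (hf : f ∈ osc P k s) : Smooth2 f := by
  induction hf using Submodule.span_induction with
  | mem f hf =>
    obtain ⟨m, c, l, j, α, hc, -, -, rfl⟩ := hf
    exact smooth2_gen hc
  | zero => exact Smooth2.zero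
  | add f g _ _ hf hg => exact hf.add hg
  | smul r f _ hf => exact hf.smul r

lemma smooth2_em : Smooth2 em := by
  unfold Smooth2 em
  fun_prop

lemma pt_em : pt em = -em := by
  ext L y
  have : HasDerivAt (fun L : ℝ => exp (-L)) (exp (-L) * -1) L := (hasDerivAt_neg L).exp
  exact this.deriv.trans (by simp [em])

lemma em_mul_gen (m : ℕ) (c : ℝ → ℝ) (l : ℕ) (j : ℤ) (α : ℝ) :
    em * gen P m c l j α = gen P (m + 1) c l j α := by
  ext L y
  simp only [em, gen, Pi.mul_apply]
  rw [show -(((m + 1 : ℕ) : ℝ) * L) = -L + -(m * L) by push_cast; ring, exp_add]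
  ring

lemma em_mul_mem (hf : f ∈ osc P k (s + 2)) : em * f ∈ osc P (k + 1) s := by
  induction hf using Submodule.span_induction with
  | mem f hf =>
    obtain ⟨m, c, l, j, α, hc, hm, hl, rfl⟩ := hf
    rw [em_mul_gen]
    exact gen_mem hc (by omega) (by omega)
  | zero => rw [mul_zero]; exact zero_mem _
  | add f g _ _ hf hg => rw [mul_add]; exact add_mem hf hg
  | smul r f _ hf => rw [mul_smul_comm]; exact Submodule.smul_mem _ _ hf

lemma em_mul_mem' (hf : f ∈ osc P k s) : em * f ∈ osc P (k + 1) s :=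
  em_mul_mem (osc_mono le_rfl (by omega) hf)

lemma DL_add (hf : Smooth2 f) (hg : Smooth2 g) : DL (f + g) = DL f + DL g := by
  rw [DL, hf.pt_add hg, mul_add]; rfl

lemma DL_sub (hf : Smooth2 f) (hg : Smooth2 g) : DL (f - g) = DL f - DL g := by
  rw [DL, hf.pt_sub hg, mul_sub]; rfl

lemma DL_smul (r : ℝ) (hf : Smooth2 f) : DL (r • f) = r • DL f := by
  rw [DL, hf.pt_smul r, mul_smul_comm]; rfl

lemma DL_em_mul (hf : Smooth2 f) : DL (em * f) = em * (DL f - em * f) := by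
  rw [DL, smooth2_em.pt_mul hf, pt_em, DL]
  ring

lemma Smooth2.DL (hf : Smooth2 f) : Smooth2 (DL f) := smooth2_em.mul hf.pt

lemma cos_add_pi_div_two' (x α : ℝ) : cos (x + (α + π / 2)) = -sin (x + α) := by
  rw [← add_assoc, cos_add_pi_div_two]

lemma DL_gen {m l : ℕ} {c : ℝ → ℝ} {j : ℤ} {α : ℝ} :
    DL (gen P m c l j α) = (j : ℝ) • gen P m c l j (α + π / 2) +
      em * ((j : ℝ) • gen P m (P.κ * c) l j (α + π / 2) + (l : ℝ) • gen P m c (l - 1) j α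
        - (m : ℝ) • gen P m c l j α) := by
  ext L y
  have h1 : HasDerivAt (fun L => exp (-(m * L))) (exp (-(m * L)) * (-(m * 1))) L :=
    (((hasDerivAt_id L).const_mul (m : ℝ)).neg).exp
  have h2 : HasDerivAt (fun L => P.phase L y) (exp L + P.κ y * 1) L :=
    ((Real.hasDerivAt_exp L).add ((hasDerivAt_id L).const_mul (P.κ y))).add_const (P.B y)
  have h3 := ((h2.const_mul (j : ℝ)).add_const α).cos
  have h4 := ((h1.mul_const (c y)).mul (hasDerivAt_pow l L)).mul h3
  have h5 : pt (gen P m c l j α) L y = _ := h4.deriv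
  have h6 : exp (-L) * exp L = 1 := by rw [← exp_add]; simp
  simp only [DL, em, Pi.mul_apply, Pi.add_apply, Pi.sub_apply, Pi.smul_apply, smul_eq_mul, h5, gen,
    cos_add_pi_div_two']
  linear_combination (-(exp (-(m * L)) * c y * L ^ l * sin (j * P.phase L y + α) * j)) * h6

lemma px_gen {m l : ℕ} {c : ℝ → ℝ} {j : ℤ} {α : ℝ} (hc : CoshSchwartz c) :
    px (gen P m c l j α) = gen P m (deriv c) l j α +
      (j : ℝ) • gen P m (deriv P.κ * c) (l + 1) j (α + π / 2) +
      (j : ℝ) • gen P m (deriv P.B * c) l j (α + π / 2) := by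
  ext L y
  have h1 := (contDiff_differentiable hc.1 y).hasDerivAt
  have h2 : HasDerivAt (fun y => P.phase L y) (deriv P.κ y * L + deriv P.B y) y :=
    ((((contDiff_differentiable P.hκ.1 y).hasDerivAt).mul_const L).const_add _).add
      (contDiff_differentiable P.hB y).hasDerivAt
  have h3 := ((h2.const_mul (j : ℝ)).add_const α).cos
  have h4 := (((h1.const_mul (exp (-(m * L)))).mul_const (L ^ l))).mul h3
  have h5 : px (gen P m c l j α) L y = _ := h4.deriv
  simp only [Pi.mul_apply, Pi.add_apply, Pi.smul_apply, smul_eq_mul, h5, gen,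
    cos_add_pi_div_two']
  ring

lemma DL_mem (hf : f ∈ osc P k s) : DL f ∈ osc P k s := by
  induction hf using Submodule.span_induction with
  | mem f hf =>
    obtain ⟨m, c, l, j, α, hc, hm, hl, rfl⟩ := hf
    rw [DL_gen]
    refine add_mem (Submodule.smul_mem _ _ (gen_mem hc hm hl))
      (osc_mono (Nat.le_succ k) le_rfl (em_mul_mem' (sub_mem (add_mem ?_ ?_) ?_))) <;>
      refine Submodule.smul_mem _ _ (gen_mem ?_ hm (by omega))
    exacts [P.hκ.mul hc, hc, hc]
  | zero => rw [show DL 0 = 0 by ext; simp [DL, pt]]; exact zero_mem _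
  | add f g hf' hg' hf hg => rw [DL_add (osc_smooth hf') (osc_smooth hg')]; exact add_mem hf hg
  | smul r f hf' hf => rw [DL_smul r (osc_smooth hf')]; exact Submodule.smul_mem _ _ hf

lemma px_mem (hf : f ∈ osc P k s) : px f ∈ osc P k (s + 1) := by
  induction hf using Submodule.span_induction with
  | mem f hf =>
    obtain ⟨m, c, l, j, α, hc, hm, hl, rfl⟩ := hf
    rw [px_gen hc]
    refine add_mem (add_mem (gen_mem hc.deriv hm (by omega)) ?_) ?_ <;>
      refine Submodule.smul_mem _ _ (gen_mem ?_ hm (by omega))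
    exacts [P.hκ.deriv.mul hc, P.hB'.mul hc]
  | zero => rw [show px 0 = 0 by ext; simp [px]]; exact zero_mem _
  | add f g hf' hg' hf hg =>
    rw [(osc_smooth hf').px_add (osc_smooth hg')]; exact add_mem hf hg
  | smul r f hf' hf => rw [(osc_smooth hf').px_smul r]; exact Submodule.smul_mem _ _ hf

lemma gen_mul_gen {m l m' l' : ℕ} {c c' : ℝ → ℝ} {j j' : ℤ} {α α' : ℝ} :
    gen P m c l j α * gen P m' c' l' j' α' =
      (1 / 2 : ℝ) • gen P (m + m') (c * c') (l + l') (j + j') (α + α') +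
      (1 / 2 : ℝ) • gen P (m + m') (c * c') (l + l') (j - j') (α - α') := by
  ext L y
  simp only [Pi.mul_apply, Pi.add_apply, Pi.smul_apply, smul_eq_mul, gen]
  rw [show -(((m + m' : ℕ) : ℝ) * L) = -(m * L) + -(m' * L) by push_cast; ring, exp_add, pow_add,
    show ((j + j' : ℤ) : ℝ) * P.phase L y + (α + α') =
      (j * P.phase L y + α) + (j' * P.phase L y + α') by push_cast; ring,
    show ((j - j' : ℤ) : ℝ) * P.phase L y + (α - α') =
      (j * P.phase L y + α) - (j' * P.phase L y + α') by push_cast; ring]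
  generalize (j : ℝ) * P.phase L y + α = u
  generalize (j' : ℝ) * P.phase L y + α' = v
  rw [cos_add, cos_sub]
  ring

lemma mul_mem (hf : f ∈ osc P k s) (hg : g ∈ osc P k' s') : f * g ∈ osc P (k + k') (s + s') := by
  induction hf using Submodule.span_induction with
  | mem f hf =>
    obtain ⟨m, c, l, j, α, hc, hm, hl, rfl⟩ := hf
    induction hg using Submodule.span_induction with
    | mem g hg =>
      obtain ⟨m', c', l', j', α', hc', hm', hl', rfl⟩ := hg
      rw [gen_mul_gen]
      refine add_mem ?_ ?_ <;>
        exact Submodule.smul_mem _ _ (gen_mem (hc.mul hc') (by omega) (by omega))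
    | zero => rw [mul_zero]; exact zero_mem _
    | add f g _ _ hf hg => rw [mul_add]; exact add_mem hf hg
    | smul r f _ hf => rw [mul_smul_comm]; exact Submodule.smul_mem _ _ hf
  | zero => rw [zero_mul]; exact zero_mem _
  | add f g _ _ hf hg => rw [add_mul]; exact add_mem hf hg
  | smul r f _ hf => rw [smul_mul_assoc]; exact Submodule.smul_mem _ _ hf

lemma multiplier_mul_mem {h : ℝ → ℝ} (hh : ∀ c, CoshSchwartz c → CoshSchwartz (h * c))
    (hf : f ∈ osc P k s) : (fun _ y => h y : ℝ → ℝ → ℝ) * f ∈ osc P k s := by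
  induction hf using Submodule.span_induction with
  | mem f hf =>
    obtain ⟨m, c, l, j, α, hc, hm, hl, rfl⟩ := hf
    rw [show (fun _ y => h y : ℝ → ℝ → ℝ) * gen P m c l j α = gen P m (h * c) l j α by
      ext L y; simp only [gen, Pi.mul_apply]; ring]
    exact gen_mem (hh c hc) hm hl
  | zero => rw [mul_zero]; exact zero_mem _
  | add f g _ _ hf hg => rw [mul_add]; exact add_mem hf hg
  | smul r f _ hf => rw [mul_smul_comm]; exact Submodule.smul_mem _ _ hf

end

section
variable {P : Profile} {k s : ℕ} {f g : ℝ → ℝ → ℝ} {m l : ℕ} {c A : ℝ → ℝ} {j : ℤ} {α β : ℝ}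

lemma gen_add_pi : gen P m c l j (α + π / 2 + π / 2) = -gen P m c l j α := by
  ext L y
  simp only [gen, Pi.neg_apply]
  rw [show j * P.phase L y + (α + π / 2 + π / 2) = (j * P.phase L y + α) + π by ring, cos_add_pi]
  ring

lemma exists_DL_gen (hc : CoshSchwartz c) (hl : l ≤ 2 * m) :
    ∃ h ∈ osc P m 0, DL (gen P m c l j α) = (j : ℝ) • gen P m c l j (α + π / 2) + em * h := by
  refine ⟨_, ?_, DL_gen⟩
  refine sub_mem (add_mem ?_ ?_) ?_ <;>
    refine Submodule.smul_mem _ _ (gen_mem ?_ le_rfl (by omega))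
  exacts [P.hκ.mul hc, hc, hc]

lemma exists_DL_DL_gen (hc : CoshSchwartz c) (hl : l ≤ 2 * m) :
    ∃ r ∈ osc P (m + 1) 0, DL (DL (gen P m c l j α)) = -((j : ℝ) ^ 2 • gen P m c l j α) +
      em * ((2 * j : ℝ) • (-((j : ℝ) • gen P m (P.κ * c) l j α) +
        (l : ℝ) • gen P m c (l - 1) j (α + π / 2) - (m : ℝ) • gen P m c l j (α + π / 2)) + r) := by
  have hl' : l - 1 ≤ 2 * m := by omega
  have hκc := P.hκ.mul hc
  obtain ⟨h₁, hh₁, e₁⟩ := exists_DL_gen (P := P) (j := j) (α := α + π / 2) hκc hl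
  obtain ⟨h₂, hh₂, e₂⟩ := exists_DL_gen (P := P) (j := j) (α := α) hc hl'
  obtain ⟨h₃, hh₃, e₃⟩ := exists_DL_gen (P := P) (j := j) (α := α) hc hl
  have e₄ := DL_gen (P := P) (m := m) (l := l) (c := c) (j := j) (α := α + π / 2)
  have s₁ := smooth2_gen (P := P) (m := m) (l := l) (j := j) (α := α + π / 2) hκc
  have s₂ := smooth2_gen (P := P) (m := m) (l := l - 1) (j := j) (α := α) hc
  have s₃ := smooth2_gen (P := P) (m := m) (l := l) (j := j) (α := α) hc
  have s₄ := smooth2_gen (P := P) (m := m) (l := l) (j := j) (α := α + π / 2) hc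
  set h := (j : ℝ) • gen P m (P.κ * c) l j (α + π / 2) + (l : ℝ) • gen P m c (l - 1) j α
        - (m : ℝ) • gen P m c l j α with hh
  have hs : Smooth2 h := ((s₁.smul _).add (s₂.smul _)).sub (s₃.smul _)
  have hmem : h ∈ osc P m 0 := by
    refine sub_mem (add_mem ?_ ?_) ?_ <;>
      refine Submodule.smul_mem _ _ (gen_mem ?_ le_rfl (by omega))
    exacts [hκc, hc, hc]
  refine ⟨em * ((j : ℝ) • h₁ + (l : ℝ) • h₂ - (m : ℝ) • h₃ - h), ?_, ?_⟩
  · refine em_mul_mem' (sub_mem (sub_mem (add_mem ?_ ?_) ?_) hmem) <;>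
      refine Submodule.smul_mem _ _ ?_
    exacts [hh₁, hh₂, hh₃]
  · rw [DL_gen, ← hh, DL_add (s₄.smul _) (smooth2_em.mul hs), DL_em_mul hs, DL_smul _ s₄, e₄]
    have e₅ : DL h = (j : ℝ) • DL (gen P m (P.κ * c) l j (α + π / 2)) +
        (l : ℝ) • DL (gen P m c (l - 1) j α) - (m : ℝ) • DL (gen P m c l j α) := by
      rw [hh, DL_sub ((s₁.smul _).add (s₂.smul _)) (s₃.smul _), DL_add (s₁.smul _) (s₂.smul _),
        DL_smul _ s₁, DL_smul _ s₂, DL_smul _ s₃]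
    rw [e₅, e₁, e₂, e₃]
    simp only [gen_add_pi]
    clear_value h
    simp only [mul_add, mul_sub, mul_smul_comm, smul_add, smul_sub, mul_neg, smul_neg]
    module

/-- The leading profile in hyperbolic coordinates. -/
noncomputable def lead (P : Profile) (A : ℝ → ℝ) : ℝ → ℝ → ℝ := gen P 0 A 0 1 0

/-- The equation can be solved at order `k` with right hand side `E`, up to higher order. -/
def Solvable (P : Profile) (A : ℝ → ℝ) (β : ℝ) (k : ℕ) (E : ℝ → ℝ → ℝ) : Prop :=
  ∃ δ ∈ osc P k 0, ∃ E' ∈ osc P (k + 1) 0,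
    DL (DL δ) + δ + (3 * β) • (em * (lead P A ^ 2 * δ)) + em * E = em * E'

lemma lead_mem (hA : CoshSchwartz A) : lead P A ∈ osc P 0 0 := gen_mem hA le_rfl (by simp)

lemma Solvable.add (hf : Solvable P A β k f) (hg : Solvable P A β k g) :
    Solvable P A β k (f + g) := by
  obtain ⟨δ, hδ, E, hE, h⟩ := hf
  obtain ⟨δ', hδ', E', hE', h'⟩ := hg
  refine ⟨δ + δ', add_mem hδ hδ', E + E', add_mem hE hE', ?_⟩
  rw [DL_add (osc_smooth hδ) (osc_smooth hδ'), DL_add (osc_smooth hδ).DL (osc_smooth hδ').DL,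
    mul_add em E E', ← h, ← h']
  simp only [mul_add, smul_add]
  abel

lemma Solvable.smul (r : ℝ) (hf : Solvable P A β k f) : Solvable P A β k (r • f) := by
  obtain ⟨δ, hδ, E, hE, h⟩ := hf
  refine ⟨r • δ, Submodule.smul_mem _ _ hδ, r • E, Submodule.smul_mem _ _ hE, ?_⟩
  rw [DL_smul r (osc_smooth hδ), DL_smul r (osc_smooth hδ).DL, mul_smul_comm r em E, ← h]
  simp only [mul_smul_comm, smul_add]
  module

lemma Solvable.of_smul {r : ℝ} (hr : r ≠ 0) (hf : Solvable P A β k (r • f)) :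
    Solvable P A β k f := by
  simpa [smul_smul, inv_mul_cancel₀ hr] using hf.smul r⁻¹

lemma Solvable.of_add (hfg : Solvable P A β k (f + g)) (hf : Solvable P A β k f) :
    Solvable P A β k g := by
  simpa using hfg.add (hf.smul (-1))

lemma solvable_of_mem (hf : f ∈ osc P (k + 1) 0) : Solvable P A β k f := by
  refine ⟨0, zero_mem _, f, hf, ?_⟩
  have h : DL (0 : ℝ → ℝ → ℝ) = 0 := by ext; simp [DL, pt]
  simp [h]

lemma lead_sq_mul_mem (hA : CoshSchwartz A) (hf : f ∈ osc P k s) :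
    lead P A ^ 2 * f ∈ osc P k s := by
  have := mul_mem (mul_mem (lead_mem hA) (lead_mem hA)) hf
  rw [← sq] at this
  simpa using this

lemma exists_nonresonant (hA : CoshSchwartz A) (hc : CoshSchwartz c) (hl : l ≤ 2 * k)
    (hj : (j : ℝ) ^ 2 ≠ 1) : ∃ δ ∈ osc P (k + 1) 0, ∃ E' ∈ osc P (k + 1) 0,
      DL (DL δ) + δ + (3 * β) • (em * (lead P A ^ 2 * δ)) + em * gen P k c l j α = em * E' := by
  obtain ⟨r, hr, e⟩ := exists_DL_DL_gen (P := P) (m := k + 1) (j := j) (α := α) hc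
    (show l ≤ 2 * (k + 1) by omega)
  set d := gen P (k + 1) c l j α with hd
  have hdm : d ∈ osc P (k + 1) 0 := gen_mem hc le_rfl (by omega)
  set r' := (2 * j : ℝ) • (-((j : ℝ) • gen P (k + 1) (P.κ * c) l j α) +
        (l : ℝ) • gen P (k + 1) c (l - 1) j (α + π / 2) -
        ((k + 1 : ℕ) : ℝ) • gen P (k + 1) c l j (α + π / 2)) + r with hr'
  have hr'm : r' ∈ osc P (k + 1) 0 := by
    refine add_mem (Submodule.smul_mem _ _ (sub_mem (add_mem (neg_mem ?_) ?_) ?_))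
      (osc_mono (by omega) le_rfl hr) <;>
      refine Submodule.smul_mem _ _ (gen_mem ?_ le_rfl (by omega))
    exacts [P.hκ.mul hc, hc, hc]
  have hs : Smooth2 d := osc_smooth hdm
  set z := ((j : ℝ) ^ 2 - 1)⁻¹ with hz
  have hz' : z * ((j : ℝ) ^ 2 - 1) = 1 := inv_mul_cancel₀ (sub_ne_zero.2 hj)
  refine ⟨z • d, Submodule.smul_mem _ _ hdm, z • (r' + (3 * β) • (lead P A ^ 2 * d)),
    Submodule.smul_mem _ _ (add_mem hr'm (Submodule.smul_mem _ _ (lead_sq_mul_mem hA hdm))), ?_⟩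
  rw [DL_smul _ hs, DL_smul _ hs.DL, e]
  simp only [mul_smul_comm, em_mul_gen, mul_add]
  rw [← hd]
  linear_combination (norm := module) (-hz') • d

lemma solvable_nonresonant (hA : CoshSchwartz A) (hc : CoshSchwartz c) (hl : l ≤ 2 * k)
    (hj : (j : ℝ) ^ 2 ≠ 1) : Solvable P A β k (gen P k c l j α) := by
  obtain ⟨δ, hδ, E, hE, h⟩ := exists_nonresonant (P := P) (α := α) (β := β) hA hc hl hj
  exact ⟨δ, osc_mono k.le_succ le_rfl hδ, E, hE, h⟩

lemma three_beta_lead_sq_mul (hκ : P.κ = (3 / 8 * β) • (A * A)) :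
    (3 * β) • (lead P A ^ 2 * gen P m c l 1 α) = (4 : ℝ) • gen P m (P.κ * c) l 1 α +
      (2 : ℝ) • gen P m (P.κ * c) l 3 α + (2 : ℝ) • gen P m (P.κ * c) l 1 (-α) := by
  ext L y
  have hκ' : P.κ y = 3 / 8 * β * (A y * A y) := by rw [hκ]; rfl
  simp only [lead, Pi.mul_apply, Pi.pow_apply, Pi.add_apply, Pi.smul_apply, smul_eq_mul, gen]
  rw [hκ']
  push_cast
  generalize P.phase L y = u
  have h3 : cos (3 * u + α) = cos (u + α) * (2 * cos u ^ 2 - 1) - sin (u + α) * (2 * sin u * cos u) := by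
    rw [show 3 * u + α = (u + α) + 2 * u by ring, cos_add, cos_two_mul, sin_two_mul]
  have h4 : cos (1 * u + -α) = cos (u + α) * (2 * cos u ^ 2 - 1) + sin (u + α) * (2 * sin u * cos u) := by
    rw [show 1 * u + -α = -((u + α) - 2 * u) by ring, cos_neg, cos_sub, cos_two_mul, sin_two_mul]
  rw [h3, h4]
  simp only [one_mul, add_zero, zero_mul, neg_zero, exp_zero, pow_zero, mul_one]
  ring

lemma solvable_resonant_step (hA : CoshSchwartz A) (hκ : P.κ = (3 / 8 * β) • (A * A))
    (hc : CoshSchwartz c) (hl : l ≤ 2 * k) (α : ℝ) :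
    Solvable P A β k ((2 : ℝ) • gen P k (P.κ * c) l 1 α + (2 : ℝ) • gen P k (P.κ * c) l 1 (-α) +
      (2 * l : ℝ) • gen P k c (l - 1) 1 (α + π / 2) -
      (2 * k : ℝ) • gen P k c l 1 (α + π / 2)) := by
  obtain ⟨r, hr, e⟩ := exists_DL_DL_gen (P := P) (j := 1) (α := α) hc hl
  have hκc := P.hκ.mul hc
  have h1 : Solvable P A β k ((2 : ℝ) • gen P k (P.κ * c) l 3 α) :=
    (solvable_nonresonant hA hκc hl (by norm_num)).smul _
  refine Solvable.of_add ?_ h1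
  refine ⟨-gen P k c l 1 α, neg_mem (gen_mem hc le_rfl (by omega)), -r, neg_mem hr, ?_⟩
  have s := smooth2_gen (P := P) (m := k) (l := l) (j := 1) (α := α) hc
  rw [← neg_one_smul ℝ (gen P k c l 1 α), DL_smul _ s, DL_smul _ s.DL, e, mul_smul_comm,
    mul_smul_comm, smul_comm (3 * β), ← mul_smul_comm (3 * β) em, three_beta_lead_sq_mul hκ]
  simp only [mul_smul_comm, mul_add, smul_add, mul_sub, smul_sub, mul_neg, smul_neg]
  push_cast
  module

lemma gen_cos_sin (α : ℝ) : gen P m c l 1 α = cos α • gen P m c l 1 0 +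
    sin α • gen P m c l 1 (π / 2) := by
  ext L y
  simp only [Pi.add_apply, Pi.smul_apply, smul_eq_mul, gen, Int.cast_one, one_mul, add_zero]
  rw [cos_add, cos_add_pi_div_two]
  ring

lemma solvable_resonant_zero (hA : CoshSchwartz A) (hκ : P.κ = (3 / 8 * β) • (A * A)) (hk : k ≠ 0)
    (hc : CoshSchwartz c) (hl : l ≤ 2 * k) : Solvable P A β k (gen P k c l 1 0) := by
  have hk' : (-(2 * k) : ℝ) ≠ 0 := by simpa using hk
  have key : ∀ l ≤ 2 * k, Solvable P A β k ((2 * l : ℝ) • gen P k c (l - 1) 1 0 +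
      (-(2 * k) : ℝ) • gen P k c l 1 0) := fun l hl => by
    have h := solvable_resonant_step hA hκ hc hl (-(π / 2))
    rw [gen_cos_sin (-(π / 2)), gen_cos_sin (-(-(π / 2)))] at h
    convert h using 1
    simp only [neg_neg, cos_neg, cos_pi_div_two, sin_neg, sin_pi_div_two, neg_add_cancel]
    module
  induction l with
  | zero => exact Solvable.of_smul hk' (by simpa using key 0 hl)
  | succ l ih =>
    exact Solvable.of_smul hk' ((key _ hl).of_add (Solvable.smul _ (ih (by omega))))

lemma solvable_resonant_pi_div_two (hA : CoshSchwartz A) (hκ : P.κ = (3 / 8 * β) • (A * A))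
    (hk : k ≠ 0) (hc : CoshSchwartz c) (hl : l ≤ 2 * k) :
    Solvable P A β k (gen P k c l 1 (π / 2)) := by
  have hk' : (-(2 * k) : ℝ) ≠ 0 := by simpa using hk
  have key : ∀ l ≤ 2 * k, Solvable P A β k ((2 * l : ℝ) • gen P k c (l - 1) 1 (π / 2) +
      (-(2 * k) : ℝ) • gen P k c l 1 (π / 2)) := fun l hl => by
    have h := solvable_resonant_step hA hκ hc hl 0
    have h' := (solvable_resonant_zero hA hκ hk (P.hκ.mul hc) hl).smul 4
    refine Solvable.of_add ?_ h'
    convert h using 1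
    rw [neg_zero, zero_add]
    module
  induction l with
  | zero => exact Solvable.of_smul hk' (by simpa using key 0 hl)
  | succ l ih =>
    exact Solvable.of_smul hk' ((key _ hl).of_add (Solvable.smul _ (ih (by omega))))

lemma solvable_gen (hA : CoshSchwartz A) (hκ : P.κ = (3 / 8 * β) • (A * A)) (hk : k ≠ 0)
    (hc : CoshSchwartz c) (hl : l ≤ 2 * k) (j : ℤ) (α : ℝ) :
    Solvable P A β k (gen P k c l j α) := by
  have h : ∀ α, Solvable P A β k (gen P k c l 1 α) := fun α => by
    rw [gen_cos_sin α]
    exact ((solvable_resonant_zero hA hκ hk hc hl).smul _).add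
      ((solvable_resonant_pi_div_two hA hκ hk hc hl).smul _)
  by_cases hj : (j : ℝ) ^ 2 = 1
  · have hj' : j ^ 2 = 1 ^ 2 := by exact_mod_cast hj
    rcases sq_eq_sq_iff_eq_or_eq_neg.1 hj' with rfl | rfl
    · exact h α
    · convert h (-α) using 1
      ext L y
      simp only [gen]
      rw [← cos_neg]
      push_cast
      ring_nf
  · exact solvable_nonresonant hA hc hl hj

lemma solvable_all (hA : CoshSchwartz A) (hκ : P.κ = (3 / 8 * β) • (A * A)) (hk : k ≠ 0)
    (hf : f ∈ osc P k 0) : Solvable P A β k f := by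
  induction hf using Submodule.span_induction with
  | mem f hf =>
    obtain ⟨m, c, l, j, α, hc, hm, hl, rfl⟩ := hf
    rcases hm.eq_or_lt with rfl | hm
    · exact solvable_gen hA hκ hk hc hl j α
    · exact solvable_of_mem (gen_mem hc hm hl)
  | zero => exact solvable_of_mem (zero_mem _)
  | add f g _ _ hf hg => exact hf.add hg
  | smul r f _ hf => exact hf.smul r

end

/-- The residual of the equation in hyperbolic coordinates. -/
noncomputable def resid (β : ℝ) (V : ℝ → ℝ → ℝ) : ℝ → ℝ → ℝ :=
  DL (DL V) + V + β • (em * V ^ 3) - em * (em * (px (px V) - (1 / 4 : ℝ) • V))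

section
variable {P : Profile} {k s : ℕ} {V δ f g : ℝ → ℝ → ℝ} {A : ℝ → ℝ} {β : ℝ}

lemma em_mul_yy_mem (hf : f ∈ osc P k 0) :
    em * (px (px f) - (1 / 4 : ℝ) • f) ∈ osc P (k + 1) 0 :=
  em_mul_mem (sub_mem (px_mem (px_mem hf))
    (Submodule.smul_mem _ _ (osc_mono le_rfl (by omega) hf)))

lemma exists_resid_add (hA : CoshSchwartz A) (hV : V - lead P A ∈ osc P 1 0) (hk : 1 ≤ k)
    (hδ : δ ∈ osc P k 0) : ∃ E ∈ osc P (k + 1) 0, resid β (V + δ) =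
      resid β V + (DL (DL δ) + δ + (3 * β) • (em * (lead P A ^ 2 * δ))) + em * E := by
  have hV0 : V ∈ osc P 0 0 := by
    simpa using add_mem (osc_mono zero_le_one le_rfl hV) (lead_mem (P := P) hA)
  have hs := osc_smooth hV0
  have hd := osc_smooth hδ
  refine ⟨(3 * β) • ((V - lead P A) * ((V + lead P A) * δ)) + (3 * β) • (V * (δ * δ)) +
    β • (δ * (δ * δ)) - em * (px (px δ) - (1 / 4 : ℝ) • δ), ?_, ?_⟩
  · refine sub_mem (add_mem (add_mem ?_ ?_) ?_) (em_mul_yy_mem hδ) <;>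
      refine Submodule.smul_mem _ _ ?_
    · exact osc_mono (by omega) (by omega) (mul_mem hV (mul_mem (add_mem hV0 (lead_mem hA)) hδ))
    · exact osc_mono (by omega) (by omega) (mul_mem hV0 (mul_mem hδ hδ))
    · exact osc_mono (by omega) (by omega) (mul_mem hδ (mul_mem hδ hδ))
  · rw [resid, resid, DL_add hs hd, DL_add hs.DL hd.DL, hs.px_add hd, hs.px.px_add hd.px]
    ext L y
    simp only [Pi.add_apply, Pi.sub_apply, Pi.mul_apply, Pi.smul_apply, Pi.pow_apply, smul_eq_mul]
    ring

lemma beta_lead_cube (hκ : P.κ = (3 / 8 * β) • (A * A)) :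
    β • lead P A ^ 3 = (2 : ℝ) • gen P 0 (P.κ * A) 0 1 0 +
      (β / 4) • gen P 0 (A * (A * A)) 0 3 0 := by
  ext L y
  have hκ' : P.κ y = 3 / 8 * β * (A y * A y) := by rw [hκ]; rfl
  simp only [lead, Pi.mul_apply, Pi.pow_apply, Pi.add_apply, Pi.smul_apply, smul_eq_mul, gen]
  rw [hκ']
  push_cast
  generalize P.phase L y = u
  simp only [one_mul, add_zero, zero_mul, neg_zero, exp_zero, pow_zero, mul_one]
  rw [cos_three_mul]
  ring

lemma exists_resid_lead (hA : CoshSchwartz A) (hκ : P.κ = (3 / 8 * β) • (A * A)) :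
    ∃ r ∈ osc P 1 0, resid β (lead P A) = em * ((β / 4) • gen P 0 (A * (A * A)) 0 3 0 + r) := by
  obtain ⟨r, hr, e⟩ := exists_DL_DL_gen (P := P) (m := 0) (l := 0) (j := 1) (α := 0) hA le_rfl
  refine ⟨r - em * (px (px (lead P A)) - (1 / 4 : ℝ) • lead P A),
    sub_mem hr (em_mul_yy_mem (lead_mem hA)), ?_⟩
  rw [resid, ← mul_smul_comm β em, beta_lead_cube hκ, lead, e]
  simp only [mul_smul_comm, mul_add, smul_add, mul_sub, smul_sub, mul_neg, smul_neg]
  push_cast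
  module

/-- Approximate solutions to arbitrary order. -/
lemma exists_approx (hA : CoshSchwartz A) (hκ : P.κ = (3 / 8 * β) • (A * A)) (K : ℕ) :
    ∃ V, V - lead P A ∈ osc P 1 0 ∧ ∃ E ∈ osc P (K + 1) 0, resid β V = em * E := by
  induction K with
  | zero =>
    obtain ⟨r, hr, e⟩ := exists_resid_lead hA hκ
    obtain ⟨δ, hδ, E, hE, h⟩ := exists_nonresonant (P := P) (k := 0) (l := 0) (j := 3) (α := 0)
      (β := β) hA (hA.mul (hA.mul hA)) le_rfl (by norm_num)
    have hδ' := Submodule.smul_mem _ (β / 4) hδ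
    obtain ⟨E', hE', h'⟩ := exists_resid_add (β := β) (V := lead P A) hA
      (by rw [sub_self]; exact zero_mem _) le_rfl hδ'
    refine ⟨lead P A + (β / 4) • δ, by simpa using hδ', r + (β / 4) • E + E', add_mem
      (add_mem hr (Submodule.smul_mem _ _ hE)) (osc_mono (by omega) le_rfl hE'), ?_⟩
    have hs := osc_smooth hδ
    rw [h', e, DL_smul _ hs, DL_smul _ hs.DL, mul_add em _ E', mul_add em r, mul_smul_comm _ em E,
      ← h]
    simp only [mul_smul_comm, mul_add]
    module
  | succ K ih =>
    obtain ⟨V, hV, E, hE, e⟩ := ih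
    obtain ⟨δ, hδ, E', hE', h⟩ := solvable_all hA hκ K.succ_ne_zero hE
    obtain ⟨E'', hE'', h'⟩ := exists_resid_add (β := β) hA hV (by omega) hδ
    refine ⟨V + δ, ?_, E' + E'', add_mem hE' hE'', ?_⟩
    · rw [add_sub_right_comm]
      exact add_mem hV (osc_mono (by omega) le_rfl hδ)
    · rw [h', e, mul_add, ← h]
      abel

end

/-- The logarithm of the hyperbolic radius. -/
noncomputable def radL (t x : ℝ) : ℝ := (log (t + x) + log (t - x)) / 2

/-- The hyperbolic angle. -/
noncomputable def angY (t x : ℝ) : ℝ := (log (t + x) - log (t - x)) / 2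

/-- The decay factor `(1 + log t)² / t`. -/
noncomputable def decay (t : ℝ) : ℝ := (1 + log t) ^ 2 / t

section
variable {t x : ℝ}

lemma exp_radL_mul (h : |x| < t) :
    exp (radL t x) * cosh (angY t x) = t ∧ exp (radL t x) * sinh (angY t x) = x := by
  obtain ⟨h1, h2⟩ := abs_lt.1 h
  have e1 : exp (radL t x) * exp (angY t x) = t + x := by
    rw [← exp_add, radL, angY, ← add_div,
      show log (t + x) + log (t - x) + (log (t + x) - log (t - x)) = 2 * log (t + x) by ring,
      mul_div_cancel_left₀ _ two_ne_zero, exp_log (by linarith)]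
  have e2 : exp (radL t x) * exp (-angY t x) = t - x := by
    rw [← exp_add, radL, angY, ← sub_eq_add_neg, ← sub_div,
      show log (t + x) + log (t - x) - (log (t + x) - log (t - x)) = 2 * log (t - x) by ring,
      mul_div_cancel_left₀ _ two_ne_zero, exp_log (by linarith)]
  rw [cosh_eq, sinh_eq]
  constructor
  · linear_combination (e1 + e2) / 2
  · linear_combination (e1 - e2) / 2

lemma exp_two_radL (h : |x| < t) : exp (2 * radL t x) = t ^ 2 - x ^ 2 := by
  obtain ⟨h1, h2⟩ := exp_radL_mul h
  rw [two_mul, exp_add]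
  have := cosh_sq (angY t x)
  linear_combination (exp (radL t x) * exp (radL t x)) * (-this) + 
    (exp (radL t x) * cosh (angY t x) + t) * h1 - (exp (radL t x) * sinh (angY t x) + x) * h2

lemma decay_nonneg (ht : 1 ≤ t) : 0 ≤ decay t := by unfold decay; positivity

lemma decay_le (ht : 1 ≤ t) : decay t ≤ 16 * t ^ (-(1 / 2) : ℝ) := by
  have h0 : 0 < t := by linarith
  have h1 := Real.add_one_le_exp (log t / 4)
  have h2 : 0 ≤ log t := log_nonneg ht
  have h3 : (1 + log t) ^ 2 ≤ (4 * exp (log t / 4)) ^ 2 :=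
    pow_le_pow_left₀ (by linarith) (by linarith) 2
  rw [decay, rpow_def_of_pos h0, div_le_iff₀ h0]
  refine h3.trans_eq ?_
  nth_rw 3 [← exp_log h0]
  rw [mul_assoc, ← exp_add, mul_pow, ← exp_nat_mul]
  norm_num
  ring_nf

lemma decay_le_sixteen (ht : 1 ≤ t) : decay t ≤ 16 := by
  refine (decay_le ht).trans ?_
  have := rpow_le_one_of_one_le_of_nonpos ht (show (-(1 / 2) : ℝ) ≤ 0 by norm_num)
  linarith

end

section
variable {P : Profile} {k : ℕ} {V f g : ℝ → ℝ → ℝ} {A : ℝ → ℝ} {β : ℝ}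

lemma log_of_eq {L y t : ℝ} (h : exp L * cosh y = t) : log t = L + log (cosh y) := by
  rw [← h, log_mul (exp_pos L).ne' (cosh_pos y).ne', log_exp]

lemma log_cosh_nonneg (y : ℝ) : 0 ≤ log (cosh y) := log_nonneg (one_le_cosh y)

lemma gen_bound {m l : ℕ} {c : ℝ → ℝ} {j : ℤ} {α : ℝ} (hc : CoshSchwartz c) (hm : k ≤ m)
    (hl : l ≤ 2 * m) (N : ℕ) : ∃ C, 0 ≤ C ∧ ∀ L y t, exp L * cosh y = t → 1 ≤ t →
      |gen P m c l j α L y| * cosh y ^ N ≤ C * decay t ^ k := by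
  obtain ⟨C, hC⟩ := (hc.2 0).decay (m + l + N)
  have hC0 : 0 ≤ C := le_trans (by positivity) (hC 0)
  refine ⟨C * 16 ^ (m - k), by positivity, fun L y t ht ht1 => ?_⟩
  have h0 : 0 < t := by linarith
  have hlog := log_nonneg ht1
  have hch := cosh_pos y
  have hch1 := one_le_cosh y
  have e1 : exp (-(m * L)) = cosh y ^ m / t ^ m := by
    rw [← div_pow, ← ht, div_mul_cancel_right₀ hch.ne', ← exp_neg, ← exp_nat_mul, mul_neg]
  have e2 : |L| ≤ (1 + log t) * cosh y := by
    have h1 := log_of_eq ht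
    have h2 := log_cosh_nonneg y
    have h3 := log_le_sub_one_of_pos hch
    rw [abs_le]
    constructor <;> nlinarith
  have e3 : |L| ^ l ≤ (1 + log t) ^ (2 * m) * cosh y ^ l := by
    refine (pow_le_pow_left₀ (abs_nonneg _) e2 l).trans ?_
    rw [mul_pow]
    exact mul_le_mul_of_nonneg_right (pow_le_pow_right₀ (by linarith) hl) (by positivity)
  have e4 : decay t ^ m ≤ 16 ^ (m - k) * decay t ^ k := by
    rw [← pow_sub_mul_pow _ hm]
    exact mul_le_mul_of_nonneg_right (pow_le_pow_left₀ (decay_nonneg ht1) (decay_le_sixteen ht1) _)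
      (pow_nonneg (decay_nonneg ht1) _)
  calc |gen P m c l j α L y| * cosh y ^ N
      = exp (-(m * L)) * |c y| * |L| ^ l * |cos (j * P.phase L y + α)| * cosh y ^ N := by
        rw [gen, abs_mul, abs_mul, abs_mul, abs_pow, abs_of_pos (exp_pos _)]
    _ ≤ exp (-(m * L)) * |c y| * ((1 + log t) ^ (2 * m) * cosh y ^ l) * 1 * cosh y ^ N := by
        gcongr
        exact abs_cos_le_one _
    _ = (|c y| * cosh y ^ (m + l + N)) * decay t ^ m := by
        rw [e1, decay, div_pow, ← pow_mul]
        ring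
    _ ≤ C * (16 ^ (m - k) * decay t ^ k) :=
        mul_le_mul (hC y) e4 (pow_nonneg (decay_nonneg ht1) _) hC0
    _ = _ := by ring

lemma osc_bound (hV : V ∈ osc P k 0) (N : ℕ) : ∃ C, 0 ≤ C ∧ ∀ L y t, exp L * cosh y = t → 1 ≤ t →
    |V L y| * cosh y ^ N ≤ C * decay t ^ k := by
  induction hV using Submodule.span_induction with
  | mem f hf =>
    obtain ⟨m, c, l, j, α, hc, hm, hl, rfl⟩ := hf
    exact gen_bound hc hm hl N
  | zero => exact ⟨0, le_rfl, fun L y t _ _ => by simp⟩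
  | add f g _ _ hf hg =>
    obtain ⟨C, hC0, hC⟩ := hf
    obtain ⟨C', hC0', hC'⟩ := hg
    refine ⟨C + C', by positivity, fun L y t ht ht1 => ?_⟩
    have h : 0 ≤ cosh y ^ N := by positivity
    calc |f L y + g L y| * cosh y ^ N ≤ (|f L y| + |g L y|) * cosh y ^ N :=
          mul_le_mul_of_nonneg_right (abs_add_le _ _) h
      _ ≤ _ := by
          rw [add_mul, add_mul]
          exact add_le_add (hC L y t ht ht1) (hC' L y t ht ht1)
  | smul r f _ hf =>
    obtain ⟨C, hC0, hC⟩ := hf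
    refine ⟨|r| * C, by positivity, fun L y t ht ht1 => ?_⟩
    rw [Pi.smul_apply, Pi.smul_apply, smul_eq_mul, abs_mul, mul_assoc, mul_assoc]
    exact mul_le_mul_of_nonneg_left (hC L y t ht ht1) (abs_nonneg _)

/-- The function on the light cone given by `V` in hyperbolic coordinates. -/
noncomputable def cone (V : ℝ → ℝ → ℝ) (t x : ℝ) : ℝ :=
  if |x| < t then exp (-(radL t x / 2)) * V (radL t x) (angY t x) else 0

lemma cone_add (f g : ℝ → ℝ → ℝ) : cone (f + g) = cone f + cone g := by
  ext t x
  simp only [cone, Pi.add_apply]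
  split_ifs <;> ring

lemma cone_sub (f g : ℝ → ℝ → ℝ) : cone (f - g) = cone f - cone g := by
  ext t x
  simp only [cone, Pi.sub_apply]
  split_ifs <;> ring

lemma cone_of_le {t x : ℝ} (h : t ≤ |x|) : cone V t x = 0 := if_neg h.not_gt

lemma cone_bound (hV : V ∈ osc P k 0) : ∃ C, 0 ≤ C ∧ ∀ t x, 1 ≤ t →
    |cone V t x| ≤ C * t ^ (-(1 / 2) : ℝ) * decay t ^ k := by
  obtain ⟨C, hC0, hC⟩ := osc_bound hV 1
  refine ⟨C, hC0, fun t x ht => ?_⟩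
  have h0 : 0 < t := by linarith
  rw [cone]
  split_ifs with h
  · have h1 := (exp_radL_mul h).1
    have h2 := hC _ _ t h1 ht
    have h3 : exp (-(radL t x / 2)) ≤ cosh (angY t x) * t ^ (-(1 / 2) : ℝ) := by
      rw [rpow_def_of_pos h0, log_of_eq h1]
      nth_rw 1 [← exp_log (cosh_pos (angY t x))]
      rw [← exp_add, exp_le_exp]
      linarith [log_cosh_nonneg (angY t x)]
    rw [abs_mul, abs_of_pos (exp_pos _)]
    calc _ ≤ cosh (angY t x) * t ^ (-(1 / 2) : ℝ) * |V (radL t x) (angY t x)| :=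
          mul_le_mul_of_nonneg_right h3 (abs_nonneg _)
      _ = t ^ (-(1 / 2) : ℝ) * (|V (radL t x) (angY t x)| * cosh (angY t x) ^ 1) := by ring
      _ ≤ t ^ (-(1 / 2) : ℝ) * (C * decay t ^ k) := mul_le_mul_of_nonneg_left h2 (by positivity)
      _ = _ := by ring
  · have := decay_nonneg ht
    rw [abs_zero]
    positivity

lemma cone_boundary (hV : V ∈ osc P 0 0) : ∃ C, 0 ≤ C ∧ ∀ t x, 1 ≤ t →
    |cone V t x| ≤ C * max (t ^ 2 - x ^ 2) 0 ^ 2 := by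
  obtain ⟨C, hC0, hC⟩ := osc_bound hV 5
  refine ⟨C, hC0, fun t x ht => ?_⟩
  rw [cone]
  split_ifs with h
  · have h1 := (exp_radL_mul h).1
    have h2 := hC _ _ t h1 ht
    have h3 : exp (-(radL t x / 2)) ≤ cosh (angY t x) ^ 5 * exp (2 * radL t x) ^ 2 := by
      nth_rw 1 [← exp_log (cosh_pos (angY t x))]
      rw [← exp_nat_mul, ← exp_nat_mul, ← exp_add, exp_le_exp]
      have := log_nonneg ht
      have h4 := log_of_eq h1
      push_cast
      linarith [log_cosh_nonneg (angY t x)]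
    rw [pow_zero, mul_one] at h2
    have h5 := exp_two_radL h
    rw [max_eq_left (by rw [← h5]; positivity), ← h5, abs_mul, abs_of_pos (exp_pos _)]
    calc _ ≤ cosh (angY t x) ^ 5 * exp (2 * radL t x) ^ 2 * |V (radL t x) (angY t x)| :=
          mul_le_mul_of_nonneg_right h3 (abs_nonneg _)
      _ = (|V (radL t x) (angY t x)| * cosh (angY t x) ^ 5) * exp (2 * radL t x) ^ 2 := by ring
      _ ≤ _ := mul_le_mul_of_nonneg_right h2 (by positivity)
  · rw [abs_zero]
    positivity

end

/-- The function `cosh y`. -/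
noncomputable def chY : ℝ → ℝ → ℝ := fun _ y => cosh y

/-- The function `sinh y`. -/
noncomputable def shY : ℝ → ℝ → ℝ := fun _ y => sinh y

/-- The time derivative in hyperbolic coordinates. -/
noncomputable def coneT (V : ℝ → ℝ → ℝ) : ℝ → ℝ → ℝ :=
  chY * (DL V - (1 / 2 : ℝ) • (em * V)) - em * (shY * px V)

/-- The space derivative in hyperbolic coordinates. -/
noncomputable def coneX (V : ℝ → ℝ → ℝ) : ℝ → ℝ → ℝ :=
  em * (chY * px V) - shY * (DL V - (1 / 2 : ℝ) • (em * V))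

section
variable {P : Profile} {k : ℕ} {V f g : ℝ → ℝ → ℝ} {A : ℝ → ℝ} {β t x : ℝ}

lemma chY_mul_mem (hf : f ∈ osc P k 0) : chY * f ∈ osc P k 0 :=
  multiplier_mul_mem (fun _ hc => hc.cosh_mul) hf

lemma shY_mul_mem {s : ℕ} (hf : f ∈ osc P k s) : shY * f ∈ osc P k s :=
  multiplier_mul_mem (fun _ hc => hc.sinh_mul) hf

lemma radial_mem (hV : V ∈ osc P k 0) : DL V - (1 / 2 : ℝ) • (em * V) ∈ osc P k 0 :=
  sub_mem (DL_mem hV) (Submodule.smul_mem _ _ (osc_mono k.le_succ le_rfl (em_mul_mem' hV)))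

lemma em_multiplier_px_mem {h : ℝ → ℝ} (hh : ∀ c, CoshSchwartz c → CoshSchwartz (h * c))
    (hV : V ∈ osc P k 0) : em * ((fun _ y => h y : ℝ → ℝ → ℝ) * px V) ∈ osc P k 0 :=
  osc_mono k.le_succ le_rfl
    (em_mul_mem (osc_mono le_rfl (by omega) (multiplier_mul_mem hh (px_mem hV))))

lemma coneT_mem (hV : V ∈ osc P k 0) : coneT V ∈ osc P k 0 :=
  sub_mem (chY_mul_mem (radial_mem hV)) (em_multiplier_px_mem (fun _ hc => hc.sinh_mul) hV)

lemma coneX_mem (hV : V ∈ osc P k 0) : coneX V ∈ osc P k 0 :=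
  sub_mem (em_multiplier_px_mem (fun _ hc => hc.cosh_mul) hV) (shY_mul_mem (radial_mem hV))

lemma hasFDerivAt_coords (h : |x| < t) :
    HasFDerivAt (fun p : ℝ × ℝ => radL p.1 p.2)
      (dlin (exp (-radL t x) * cosh (angY t x)) (-(exp (-radL t x) * sinh (angY t x)))) (t, x) ∧
    HasFDerivAt (fun p : ℝ × ℝ => angY p.1 p.2)
      (dlin (-(exp (-radL t x) * sinh (angY t x))) (exp (-radL t x) * cosh (angY t x))) (t, x) := by
  obtain ⟨h1, h2⟩ := abs_lt.1 h
  obtain ⟨e1, e2⟩ := exp_radL_mul h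
  have hp0 : HasFDerivAt (fun p : ℝ × ℝ => p.1 + p.2)
      (ContinuousLinearMap.fst ℝ ℝ ℝ + ContinuousLinearMap.snd ℝ ℝ ℝ) (t, x) :=
    hasFDerivAt_fst.add hasFDerivAt_snd
  have hm0 : HasFDerivAt (fun p : ℝ × ℝ => p.1 - p.2)
      (ContinuousLinearMap.fst ℝ ℝ ℝ - ContinuousLinearMap.snd ℝ ℝ ℝ) (t, x) :=
    hasFDerivAt_fst.sub hasFDerivAt_snd
  have hp := hp0.log (show t + x ≠ 0 by linarith)
  have hm := hm0.log (show t - x ≠ 0 by linarith)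
  have hE : exp (-radL t x) * exp (radL t x) = 1 := by rw [← exp_add]; simp
  have hq := cosh_sq (angY t x)
  have i1 : (t + x)⁻¹ = exp (-radL t x) * (cosh (angY t x) - sinh (angY t x)) := by
    refine inv_eq_of_mul_eq_one_right ?_
    linear_combination exp (-radL t x) * exp (radL t x) * hq + hE
      - exp (-radL t x) * (cosh (angY t x) - sinh (angY t x)) * (e1 + e2)
  have i2 : (t - x)⁻¹ = exp (-radL t x) * (cosh (angY t x) + sinh (angY t x)) := by
    refine inv_eq_of_mul_eq_one_right ?_
    linear_combination exp (-radL t x) * exp (radL t x) * hq + hE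
      - exp (-radL t x) * (cosh (angY t x) + sinh (angY t x)) * (e1 - e2)
  constructor
  · refine hasFDerivAt_congr ((hp.add hm).const_mul (1 / 2)) (fun q => ?_) fun u => ?_
    · rw [radL, Pi.add_apply]; ring
    · simp [dlin_apply, i1, i2, -cosh_add_sinh, -cosh_sub_sinh]; ring
  · refine hasFDerivAt_congr ((hp.sub hm).const_mul (1 / 2)) (fun q => ?_) fun u => ?_
    · rw [angY, Pi.sub_apply]; ring
    · simp [dlin_apply, i1, i2, -cosh_add_sinh, -cosh_sub_sinh]; ring

lemma hasFDerivAt_cone_interior (hV : Smooth2 V) (h : |x| < t) :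
    HasFDerivAt (fun p : ℝ × ℝ => cone V p.1 p.2)
      (dlin (cone (coneT V) t x) (cone (coneX V) t x)) (t, x) := by
  obtain ⟨hL, hY⟩ := hasFDerivAt_coords h
  have h1 := HasFDerivAt.comp (t, x) (f := fun p : ℝ × ℝ => (radL p.1 p.2, angY p.1 p.2))
    (hV.hasFDerivAt (radL t x) (angY t x)) (hL.prodMk hY)
  have h2 := ((hL.const_mul (-(1 / 2))).exp).mul h1
  have hU : IsOpen {p : ℝ × ℝ | |p.2| < p.1} := isOpen_lt (by fun_prop) (by fun_prop)
  have h3 : (fun p : ℝ × ℝ => cone V p.1 p.2) =ᶠ[𝓝 (t, x)] fun p : ℝ × ℝ =>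
      exp (-(1 / 2) * radL p.1 p.2) * V (radL p.1 p.2) (angY p.1 p.2) := by
    filter_upwards [hU.mem_nhds h] with p hp
    rw [cone, if_pos hp]
    ring_nf
  refine hasFDerivAt_congr (h2.congr_of_eventuallyEq h3) (fun _ => rfl) fun u => ?_
  simp only [cone, if_pos h, coneT, coneX, chY, shY, em, DL, dlin_apply, Pi.mul_apply, Pi.sub_apply,
    Pi.smul_apply, smul_eq_mul, add_apply, smul_apply,
    ContinuousLinearMap.comp_apply, ContinuousLinearMap.prod_apply, Function.comp_apply]
  rw [show -(radL t x / 2) = -(1 / 2) * radL t x by ring]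
  ring

lemma hasFDerivAt_cone (hV : V ∈ osc P 0 0) (ht : 1 < t) :
    HasFDerivAt (fun p : ℝ × ℝ => cone V p.1 p.2)
      (dlin (cone (coneT V) t x) (cone (coneX V) t x)) (t, x) := by
  by_cases h : |x| < t
  · exact hasFDerivAt_cone_interior (osc_smooth hV) h
  · have h' : t ≤ |x| := not_lt.1 h
    rw [cone_of_le h', cone_of_le h', show dlin 0 0 = 0 by simp [dlin]]
    obtain ⟨C, hC0, hC⟩ := cone_boundary hV
    have h0 : t ^ 2 - x ^ 2 ≤ 0 := by
      rw [sub_nonpos, ← sq_abs x]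
      exact pow_le_pow_left₀ (by linarith) h' 2
    have hd : DifferentiableAt ℝ (fun p : ℝ × ℝ => p.1 ^ 2 - p.2 ^ 2) (t, x) := by fun_prop
    have hO := hd.isBigO_sub
    refine .of_isLittleO ?_
    have h1 : (fun p : ℝ × ℝ => cone V p.1 p.2) =O[𝓝 (t, x)]
        fun p => (p.1 ^ 2 - p.2 ^ 2 - (t ^ 2 - x ^ 2)) ^ 2 := by
      refine Asymptotics.IsBigO.of_bound C ?_
      have hU : IsOpen {p : ℝ × ℝ | 1 < p.1} := isOpen_lt (by fun_prop) (by fun_prop)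
      filter_upwards [hU.mem_nhds ht] with p hp
      refine (hC p.1 p.2 (le_of_lt hp)).trans (mul_le_mul_of_nonneg_left ?_ hC0)
      rw [norm_pow, Real.norm_eq_abs]
      refine pow_le_pow_left₀ (le_max_right _ _) (max_le ?_ (abs_nonneg _)) 2
      exact le_trans (by linarith) (le_abs_self _)
    have h2 : (fun p : ℝ × ℝ => (p.1 ^ 2 - p.2 ^ 2 - (t ^ 2 - x ^ 2)) ^ 2) =O[𝓝 (t, x)]
        fun p => ‖p - (t, x)‖ ^ 2 := (hO.norm_right).pow 2
    have h3 : (fun p : ℝ × ℝ => ‖p - (t, x)‖ ^ 2) =o[𝓝 (t, x)] fun p => p - (t, x) := by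
      simpa using Asymptotics.isLittleO_pow_sub_sub (t, x) (show 1 < 2 by norm_num)
    simpa [cone_of_le h'] using (h1.trans h2).trans_isLittleO h3

end

section
variable {P : Profile} {k : ℕ} {V f g : ℝ → ℝ → ℝ} {A : ℝ → ℝ} {β t x : ℝ}

lemma smooth2_chY : Smooth2 chY := Smooth2.of_snd Real.contDiff_cosh

lemma smooth2_shY : Smooth2 shY := Smooth2.of_snd Real.contDiff_sinh

lemma DL_chY_mul (hf : Smooth2 f) : DL (chY * f) = chY * DL f := by
  rw [DL, smooth2_chY.pt_mul hf, show pt chY = 0 by ext t x; simp [pt, chY], DL]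
  ring

lemma DL_shY_mul (hf : Smooth2 f) : DL (shY * f) = shY * DL f := by
  rw [DL, smooth2_shY.pt_mul hf, show pt shY = 0 by ext t x; simp [pt, shY], DL]
  ring

lemma px_chY_mul (hf : Smooth2 f) : px (chY * f) = shY * f + chY * px f := by
  rw [smooth2_chY.px_mul hf, show px chY = shY by ext t x; simp [px, chY, shY]]

lemma px_shY_mul (hf : Smooth2 f) : px (shY * f) = chY * f + shY * px f := by
  rw [smooth2_shY.px_mul hf, show px shY = chY by ext t x; simp [px, chY, shY]]

lemma px_em_mul (hf : Smooth2 f) : px (em * f) = em * px f := by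
  rw [smooth2_em.px_mul hf, show px em = 0 by ext t x; simp [px, em]]
  ring

lemma coneT_coneT_sub_coneX_coneX (hV : Smooth2 V) : coneT (coneT V) - coneX (coneX V) =
    DL (DL V) - em * (em * (px (px V) - (1 / 4 : ℝ) • V)) := by
  have hW := hV.px
  have hD := hV.DL
  have hE := smooth2_em.mul hV
  have hR := hD.sub (hE.smul (1 / 2))
  have eW : px (DL V) = DL (px V) := by rw [DL, px_em_mul hV.pt, ← hV.pt_px_comm, DL]
  have eR : DL (DL V - (1 / 2 : ℝ) • (em * V)) =
      DL (DL V) - (1 / 2 : ℝ) • (em * (DL V - em * V)) := by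
    rw [DL_sub hD (hE.smul _), DL_smul _ hE, DL_em_mul hV]
  have eR' : px (DL V - (1 / 2 : ℝ) • (em * V)) = DL (px V) - (1 / 2 : ℝ) • (em * px V) := by
    rw [hD.px_sub (hE.smul _), hE.px_smul, px_em_mul hV, eW]
  have hsW := smooth2_shY.mul hW
  have hcW := smooth2_chY.mul hW
  have hsR := smooth2_shY.mul hR
  have hcR := smooth2_chY.mul hR
  have e1 : DL (coneT V) = chY * (DL (DL V) - (1 / 2 : ℝ) • (em * (DL V - em * V))) -
      em * (shY * DL (px V) - em * (shY * px V)) := by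
    rw [coneT, DL_sub hcR (smooth2_em.mul hsW), DL_chY_mul hR, DL_em_mul hsW, DL_shY_mul hW, eR]
  have e2 : px (coneT V) = shY * (DL V - (1 / 2 : ℝ) • (em * V)) + chY * (DL (px V) - (1 / 2 : ℝ) • (em * px V)) -
      em * (chY * px V + shY * px (px V)) := by
    rw [coneT, hcR.px_sub (smooth2_em.mul hsW), px_chY_mul hR, px_em_mul hsW, px_shY_mul hW, eR']
  have e3 : DL (coneX V) = em * (chY * DL (px V) - em * (chY * px V)) -
      shY * (DL (DL V) - (1 / 2 : ℝ) • (em * (DL V - em * V))) := by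
    rw [coneX, DL_sub (smooth2_em.mul hcW) hsR, DL_shY_mul hR, DL_em_mul hcW, DL_chY_mul hW, eR]
  have e4 : px (coneX V) = em * (shY * px V + chY * px (px V)) -
      (chY * (DL V - (1 / 2 : ℝ) • (em * V)) + shY * (DL (px V) - (1 / 2 : ℝ) • (em * px V))) := by
    rw [coneX, (smooth2_em.mul hcW).px_sub hsR, px_shY_mul hR, px_em_mul hcW, px_chY_mul hW, eR']
  rw [coneT.eq_1 (coneT V), coneX.eq_1 (coneX V), e1, e2, e3, e4]
  ext L y
  have hq := cosh_sq y
  simp only [coneT, coneX, Pi.sub_apply, Pi.mul_apply, Pi.add_apply, Pi.smul_apply, smul_eq_mul,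
    chY, shY]
  linear_combination (DL (DL V) L y + em L y * em L y * (V L y / 4 - px (px V) L y)) * hq

lemma pt_cone (hV : V ∈ osc P 0 0) (ht : 1 < t) : pt (cone V) t x = cone (coneT V) t x :=
  pt_eq_of_hasFDerivAt (hasFDerivAt_cone hV ht)

lemma px_cone (hV : V ∈ osc P 0 0) (ht : 1 < t) : px (cone V) t x = cone (coneX V) t x :=
  px_eq_of_hasFDerivAt (hasFDerivAt_cone hV ht)

lemma cone_cube : cone V t x ^ 3 = cone (em * V ^ 3) t x := by
  unfold cone
  split_ifs
  · rw [mul_pow, ← exp_nat_mul, Pi.mul_apply, Pi.mul_apply, em, ← mul_assoc, ← exp_add]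
    rw [Pi.pow_apply, Pi.pow_apply, show ((3 : ℕ) : ℝ) * -(radL t x / 2) =
      -(radL t x / 2) + -radL t x by push_cast; ring]
  · simp

lemma box_cone (hV : V ∈ osc P 0 0) (ht : 1 < t) :
    box (cone V) t x + cone V t x + β * cone V t x ^ 3 = cone (resid β V) t x := by
  have e1 : box (cone V) t x = cone (coneT (coneT V)) t x - cone (coneX (coneX V)) t x := by
    rw [← pt_cone (coneT_mem hV) ht, ← px_cone (coneX_mem hV) ht, box]
    congr 1
    · exact pt_congr_of_lt (fun s hs z => pt_cone hV hs) ht x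
    · exact px_congr_of_lt (fun s hs z => px_cone hV hs) ht x
  rw [e1, cone_cube, ← Pi.sub_apply, ← Pi.sub_apply, ← cone_sub,
    coneT_coneT_sub_coneX_coneX (osc_smooth hV), resid]
  simp only [cone]
  split_ifs
  · simp only [Pi.add_apply, Pi.sub_apply, Pi.smul_apply, smul_eq_mul]
    ring
  · simp

lemma contDiffOn_cone (hV : V ∈ osc P 0 0) :
    ContDiffOn ℝ (⊤ : ℕ∞) (fun p : ℝ × ℝ => cone V p.1 p.2) {p | 1 < p.1} := by
  refine contDiffOn_of_closed_family (isOpen_lt (by fun_prop) (by fun_prop))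
    {f | ∃ V ∈ osc P 0 0, f = fun p : ℝ × ℝ => cone V p.1 p.2} ?_ ⟨V, hV, rfl⟩
  rintro _ ⟨W, hW, rfl⟩
  exact ⟨_, ⟨_, coneT_mem hW, rfl⟩, _, ⟨_, coneX_mem hW, rfl⟩,
    fun p hp => hasFDerivAt_cone hW hp⟩

/-- The function `cone V` cut off near the origin. -/
noncomputable def cutCone (V : ℝ → ℝ → ℝ) (t x : ℝ) : ℝ :=
  Real.smoothTransition (t - 2) * cone V t x

lemma cutCone_eq (ht : 3 ≤ t) : cutCone V t x = cone V t x := by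
  rw [cutCone, Real.smoothTransition.one_of_one_le (by linarith), one_mul]

lemma cutCone_of_le (h : t ≤ |x|) : cutCone V t x = 0 := by rw [cutCone, cone_of_le h, mul_zero]

lemma smooth2_cutCone (hV : V ∈ osc P 0 0) : Smooth2 (cutCone V) := by
  rw [Smooth2, contDiff_iff_contDiffAt]
  intro p
  rcases lt_or_ge 1 p.1 with h | h
  · have hU : IsOpen {p : ℝ × ℝ | 1 < p.1} := isOpen_lt (by fun_prop) (by fun_prop)
    refine ContDiffAt.mul ?_ ((contDiffOn_cone hV).contDiffAt (hU.mem_nhds h))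
    exact (Real.smoothTransition.contDiff.comp (contDiff_fst.sub contDiff_const)).contDiffAt
  · have hU : IsOpen {p : ℝ × ℝ | p.1 < 2} := isOpen_lt (by fun_prop) (by fun_prop)
    refine (contDiffAt_const (c := (0 : ℝ))).congr_of_eventuallyEq ?_
    filter_upwards [hU.mem_nhds (show p.1 < 2 by linarith)] with q hq
    rw [cutCone, Real.smoothTransition.zero_of_nonpos (sub_nonpos.2 (le_of_lt hq)), zero_mul]

lemma pt_cutCone (hV : V ∈ osc P 0 0) (ht : 3 < t) : pt (cutCone V) t x = cutCone (coneT V) t x := by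
  rw [cutCone_eq ht.le, ← pt_cone hV (by linarith)]
  exact pt_congr_of_lt (fun s hs z => cutCone_eq (le_of_lt hs)) ht x

lemma px_cutCone (hV : V ∈ osc P 0 0) (ht : 3 < t) : px (cutCone V) t x = cutCone (coneX V) t x := by
  rw [cutCone_eq ht.le, ← px_cone hV (by linarith)]
  exact px_congr_of_lt (fun s hs z => cutCone_eq (le_of_lt hs)) ht x

lemma cutCone_bound (hV : V ∈ osc P k 0) : ∃ C, 0 ≤ C ∧ ∀ t x, 3 ≤ t →
    |cutCone V t x| ≤ C * t ^ (-(1 / 2) : ℝ) * decay t ^ k := by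
  obtain ⟨C, hC0, hC⟩ := cone_bound hV
  refine ⟨C, hC0, fun t x ht => ?_⟩
  rw [cutCone_eq ht]
  exact hC t x (by linarith)

lemma cN_cutCone_ne_top {N : (ℝ → ℝ → ℝ) → ℝ≥0∞} (hN : LocalN 4 N)
    (h : ∀ W ∈ osc P k 0, N (cutCone W) ≠ ⊤) (n : ℕ) : ∀ W ∈ osc P k 0, cN N n (cutCone W) ≠ ⊤ := by
  induction n with
  | zero => exact h
  | succ n ih =>
    intro W hW
    have hW0 : W ∈ osc P 0 0 := osc_mono (Nat.zero_le k) le_rfl hW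
    rw [cN, cN_congr hN (by norm_num : (3 : ℝ) < 4) n (fun t ht x => pt_cutCone hW0 ht),
      cN_congr hN (by norm_num : (3 : ℝ) < 4) n (fun t ht x => px_cutCone hW0 ht)]
    exact ENNReal.add_ne_top.2 ⟨ih _ (coneT_mem hW), ih _ (coneX_mem hW)⟩

end

section
variable {P : Profile} {k : ℕ} {V f g : ℝ → ℝ → ℝ} {A : ℝ → ℝ} {β t x : ℝ}

lemma eLpNorm_two_le_of_support {f : ℝ → ℝ} {c : ℝ} (ht : 1 ≤ t) (h0 : ∀ x, t ≤ |x| → f x = 0)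
    (hc : ∀ x, |f x| ≤ c * t ^ (-(1 / 2) : ℝ)) : eLpNorm f 2 volume ≤ ENNReal.ofReal (2 * c) := by
  have ht0 : 0 < t := by linarith
  have hs : (Icc (-t) t).indicator f = f := by
    rw [indicator_eq_self]
    intro x hx
    by_contra h
    exact hx (h0 x (not_lt.1 fun h' => h (abs_le.1 h'.le)))
  rw [← hs, eLpNorm_indicator_eq_eLpNorm_restrict measurableSet_Icc]
  refine (eLpNorm_le_of_ae_bound (C := c * t ^ (-(1 / 2) : ℝ)) (ae_of_all _ fun x => hc x)).trans ?_
  rw [Measure.restrict_apply_univ, Real.volume_Icc, ENNReal.ofReal_rpow_of_nonneg (by linarith)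
    (by positivity), ← ENNReal.ofReal_mul (rpow_nonneg (by linarith) _)]
  refine ENNReal.ofReal_le_ofReal ?_
  have hc0 : 0 ≤ c := by
    have := (abs_nonneg _).trans (hc 0)
    exact nonneg_of_mul_nonneg_left this (by positivity)
  have h2 : t ^ (1 / 2 : ℝ) * t ^ (-(1 / 2) : ℝ) = 1 := by rw [← rpow_add ht0]; norm_num
  have h3 : (2 : ℝ) ^ (1 / 2 : ℝ) ≤ 2 := by
    calc (2 : ℝ) ^ (1 / 2 : ℝ) ≤ 2 ^ (1 : ℝ) := rpow_le_rpow_of_exponent_le (by norm_num) (by norm_num)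
      _ = 2 := rpow_one 2
  have h4 : (t - -t) ^ (2 : ℝ≥0∞).toReal⁻¹ = 2 ^ (1 / 2 : ℝ) * t ^ (1 / 2 : ℝ) := by
    rw [← mul_rpow (by norm_num) ht0.le]
    norm_num
    ring_nf
  rw [h4]
  calc 2 ^ (1 / 2 : ℝ) * t ^ (1 / 2 : ℝ) * (c * t ^ (-(1 / 2) : ℝ))
      = 2 ^ (1 / 2 : ℝ) * c * (t ^ (1 / 2 : ℝ) * t ^ (-(1 / 2) : ℝ)) := by ring
    _ ≤ 2 * c := by rw [h2, mul_one]; exact mul_le_mul_of_nonneg_right h3 hc0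

lemma cone_eLpNorm_le (hV : V ∈ osc P k 0) : ∃ C, 0 ≤ C ∧ ∀ t, 1 ≤ t →
    eLpNorm (cone V t) ⊤ volume ≤ ENNReal.ofReal (C * decay t ^ k) ∧
    eLpNorm (cone V t) 2 volume ≤ ENNReal.ofReal (C * decay t ^ k) := by
  obtain ⟨C, hC0, hC⟩ := cone_bound hV
  refine ⟨2 * C, by positivity, fun t ht => ?_⟩
  have hd := pow_nonneg (decay_nonneg ht) k
  constructor
  · rw [eLpNorm_exponent_top]
    refine eLpNormEssSup_le_of_ae_bound (ae_of_all _ fun x => (hC t x ht).trans ?_)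
    have := rpow_le_one_of_one_le_of_nonpos ht (show (-(1 / 2) : ℝ) ≤ 0 by norm_num)
    have h0 := mul_nonneg hC0 hd
    nlinarith
  · rw [mul_assoc]
    exact eLpNorm_two_le_of_support ht (fun x hx => cone_of_le hx)
      fun x => (hC t x ht).trans_eq (by ring)

lemma cutCone_Nsup_ne_top (hV : V ∈ osc P 0 0) : Nsup (1 / 2) 4 (cutCone V) ≠ ⊤ := by
  obtain ⟨C, hC0, hC⟩ := cutCone_bound hV
  refine ne_top_of_le_ne_top (ENNReal.ofReal_ne_top (r := C)) (Nsup_le_iff.2 fun t ht x => ?_)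
  have ht0 : 0 < t := by linarith
  rw [← ofReal_norm, ← ENNReal.ofReal_mul (by positivity)]
  refine ENNReal.ofReal_le_ofReal ?_
  have h2 : t ^ (1 / 2 : ℝ) * t ^ (-(1 / 2) : ℝ) = 1 := by rw [← rpow_add ht0]; norm_num
  calc t ^ (1 / 2 : ℝ) * |cutCone V t x|
      ≤ t ^ (1 / 2 : ℝ) * (C * t ^ (-(1 / 2) : ℝ) * decay t ^ 0) := by
        gcongr
        exact hC t x (by linarith)
    _ = C * (t ^ (1 / 2 : ℝ) * t ^ (-(1 / 2) : ℝ)) := by ring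
    _ = C := by rw [h2, mul_one]

lemma decay_pow_le {M : ℝ} (ht : 1 ≤ t) (hk : 2 * M ≤ k) : t ^ M * decay t ^ k ≤ 16 ^ k := by
  have ht0 : 0 < t := by linarith
  calc t ^ M * decay t ^ k ≤ t ^ M * (16 * t ^ (-(1 / 2) : ℝ)) ^ k := by
        gcongr
        · exact decay_nonneg ht
        · exact decay_le ht
    _ = 16 ^ k * t ^ (M - k / 2) := by
        rw [mul_pow, ← rpow_natCast (t ^ _), ← rpow_mul ht0.le, mul_left_comm, ← rpow_add ht0]
        ring_nf
    _ ≤ 16 ^ k * 1 := by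
        gcongr
        exact rpow_le_one_of_one_le_of_nonpos ht (by linarith)
    _ = _ := mul_one _

lemma cutCone_Ntwo_ne_top {M : ℝ} (hk : 2 * M ≤ k) (hV : V ∈ osc P k 0) :
    Ntwo M 4 (cutCone V) ≠ ⊤ := by
  obtain ⟨C, hC0, hC⟩ := cone_eLpNorm_le hV
  refine ne_top_of_le_ne_top (ENNReal.ofReal_ne_top (r := C * 16 ^ k)) (Ntwo_le_iff.2 fun t ht => ?_)
  have ht1 : 1 ≤ t := by linarith
  rw [show cutCone V t = cone V t from funext fun x => cutCone_eq (by linarith)]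
  calc ENNReal.ofReal (t ^ M) * eLpNorm (cone V t) 2 volume
      ≤ ENNReal.ofReal (t ^ M) * ENNReal.ofReal (C * decay t ^ k) := by
        gcongr
        exact (hC t ht1).2
    _ = ENNReal.ofReal (C * (t ^ M * decay t ^ k)) := by
        rw [← ENNReal.ofReal_mul (by positivity), mul_left_comm]
    _ ≤ _ := ENNReal.ofReal_le_ofReal (mul_le_mul_of_nonneg_left (decay_pow_le ht1 hk) hC0)

/-- Leading order uniform bound: the corrections of order one are absorbed at late times. -/
lemma exists_Nsup_cutCone_le (hA : CoshSchwartz A) : ∃ C₀ : ℝ≥0, ∀ V, V - lead P A ∈ osc P 1 0 →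
    ∃ T₀, 4 ≤ T₀ ∧ Nsup (1 / 2) T₀ (cutCone V) ≤ C₀ := by
  obtain ⟨C, hC0, hC⟩ := cone_bound (lead_mem (P := P) hA)
  refine ⟨(C + 1).toNNReal, fun V hV => ?_⟩
  obtain ⟨C', hC0', hC'⟩ := cone_bound hV
  refine ⟨max 4 ((16 * C') ^ 2), le_max_left _ _, Nsup_le_iff.2 fun t ht x => ?_⟩
  have ht4 : 4 ≤ t := (le_max_left _ _).trans ht
  have ht1 : 1 ≤ t := by linarith
  have ht0 : 0 < t := by linarith
  have h2 : t ^ (1 / 2 : ℝ) * t ^ (-(1 / 2) : ℝ) = 1 := by rw [← rpow_add ht0]; norm_num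
  have h3 : 16 * C' ≤ t ^ (1 / 2 : ℝ) := by
    rw [← sqrt_eq_rpow]
    exact le_sqrt_of_sq_le ((le_max_right _ _).trans ht)
  have h4 : C' * decay t ≤ 1 := by
    calc C' * decay t ≤ C' * (16 * t ^ (-(1 / 2) : ℝ)) := by gcongr; exact decay_le ht1
      _ = 16 * C' * t ^ (-(1 / 2) : ℝ) := by ring
      _ ≤ t ^ (1 / 2 : ℝ) * t ^ (-(1 / 2) : ℝ) := by gcongr
      _ = 1 := h2
  have h5 : cone V t x = cone (V - lead P A) t x + cone (lead P A) t x := by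
    rw [cone_sub]; simp
  rw [cutCone_eq (by linarith), ← ofReal_norm, ← ENNReal.ofReal_mul (by positivity)]
  change _ ≤ ENNReal.ofReal (C + 1)
  refine ENNReal.ofReal_le_ofReal ?_
  calc t ^ (1 / 2 : ℝ) * |cone V t x|
      ≤ t ^ (1 / 2 : ℝ) * (C' * t ^ (-(1 / 2) : ℝ) * decay t ^ 1 +
          C * t ^ (-(1 / 2) : ℝ) * decay t ^ 0) := by
        gcongr
        rw [h5]
        exact (abs_add_le _ _).trans (add_le_add (hC' t x ht1) (hC t x ht1))
    _ = (t ^ (1 / 2 : ℝ) * t ^ (-(1 / 2) : ℝ)) * (C' * decay t + C) := by ring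
    _ = C' * decay t + C := by rw [h2, one_mul]
    _ ≤ C + 1 := by linarith

end

/-- Smoothness on the half plane of times later than `T`. -/
def SmoothAfter (T : ℝ) (f : ℝ → ℝ → ℝ) : Prop :=
  ContDiffOn ℝ (⊤ : ℕ∞) (fun p : ℝ × ℝ => f p.1 p.2) {p | T < p.1}

namespace SmoothAfter
variable {T T' t x : ℝ} {f g : ℝ → ℝ → ℝ}

lemma mono (hf : SmoothAfter T f) (hT : T ≤ T') : SmoothAfter T' f :=
  ContDiffOn.mono hf fun _ hp => hT.trans_lt hp

lemma add (hf : SmoothAfter T f) (hg : SmoothAfter T g) : SmoothAfter T (f + g) :=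
  ContDiffOn.add hf hg

lemma isOpen_after (T : ℝ) : IsOpen {p : ℝ × ℝ | T < p.1} := isOpen_lt (by fun_prop) (by fun_prop)

lemma hasFDerivAt (hf : SmoothAfter T f) (ht : T < t) :
    HasFDerivAt (fun p : ℝ × ℝ => f p.1 p.2) (dlin (pt f t x) (px f t x)) (t, x) :=
  hasFDerivAt_dlin (((ContDiffOn.contDiffAt hf ((isOpen_after T).mem_nhds ht))).differentiableAt
    (by simp))

lemma pt_add (hf : SmoothAfter T f) (hg : SmoothAfter T g) (ht : T < t) :
    _root_.pt (f + g) t x = _root_.pt f t x + _root_.pt g t x :=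
  ((hasDerivAt_fst_of_hasFDerivAt (hf.hasFDerivAt ht)).add
    (hasDerivAt_fst_of_hasFDerivAt (hg.hasFDerivAt ht))).deriv

lemma px_add (hf : SmoothAfter T f) (hg : SmoothAfter T g) (ht : T < t) :
    _root_.px (f + g) t x = _root_.px f t x + _root_.px g t x :=
  ((hasDerivAt_snd_of_hasFDerivAt (hf.hasFDerivAt ht)).add
    (hasDerivAt_snd_of_hasFDerivAt (hg.hasFDerivAt ht))).deriv

lemma apply_fderiv (hf : SmoothAfter T f) (u : ℝ × ℝ) : ContDiffOn ℝ (⊤ : ℕ∞)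
    (fun p : ℝ × ℝ => fderiv ℝ (fun p : ℝ × ℝ => f p.1 p.2) p u) {p | T < p.1} :=
  (ContDiffOn.fderiv_of_isOpen hf (isOpen_after T) (by simp)).clm_apply contDiffOn_const

lemma pt (hf : SmoothAfter T f) : SmoothAfter T (pt f) :=
  (hf.apply_fderiv (1, 0)).congr fun p hp => by
    rw [(hf.hasFDerivAt (x := p.2) hp).fderiv, dlin_apply]; simp

lemma px (hf : SmoothAfter T f) : SmoothAfter T (px f) :=
  (hf.apply_fderiv (0, 1)).congr fun p hp => by
    rw [(hf.hasFDerivAt (x := p.2) hp).fderiv, dlin_apply]; simp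

lemma continuous_slice (hf : SmoothAfter T f) (ht : T < t) : Continuous (f t) :=
  (ContDiffOn.continuousOn hf).comp_continuous (by fun_prop : Continuous fun x : ℝ => (t, x))
    fun _ => ht

lemma box_add (hf : SmoothAfter T f) (hg : SmoothAfter T g) (ht : T < t) :
    box (f + g) t x = box f t x + box g t x := by
  have e1 := pt_congr_of_lt (fun s hs z => hf.pt_add hg (x := z) hs) ht x
  have e2 := px_congr_of_lt (fun s hs z => hf.px_add hg (x := z) hs) ht x
  have e3 := hf.pt.pt_add hg.pt (x := x) ht
  have e4 := hf.px.px_add hg.px (x := x) ht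
  exact (congr_arg₂ (· - ·) (e1.trans e3) (e2.trans e4)).trans (add_sub_add_comm _ _ _ _)

end SmoothAfter

section
variable {P : Profile} {k : ℕ} {V f g : ℝ → ℝ → ℝ} {A : ℝ → ℝ} {β t x T M : ℝ}

lemma smoothAfter_cone (hV : V ∈ osc P 0 0) : SmoothAfter 1 (cone V) := contDiffOn_cone hV

lemma le_decay_of_weight {C : ℝ≥0} {a : ℝ≥0∞} (ht : 1 ≤ t) (hM : 1 ≤ M)
    (h : ENNReal.ofReal (t ^ M) * a ≤ C) : a ≤ ENNReal.ofReal (C * decay t) := by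
  have ht0 : 0 < t := by linarith
  have h1 : ENNReal.ofReal t ≤ ENNReal.ofReal (t ^ M) := ENNReal.ofReal_le_ofReal (by
    simpa using rpow_le_rpow_of_exponent_le ht hM)
  have h2 : ENNReal.ofReal t * a ≤ C := (mul_le_mul_left h1 _).trans h
  have h3 : a ≤ C / ENNReal.ofReal t := by
    rw [ENNReal.le_div_iff_mul_le (by simp [ht0]) (by simp), mul_comm]
    exact h2
  refine h3.trans ?_
  rw [← ENNReal.ofReal_coe_nnreal, ← ENNReal.ofReal_div_of_pos ht0]
  refine ENNReal.ofReal_le_ofReal ?_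
  rw [decay, ← mul_div_assoc]
  refine div_le_div_of_nonneg_right ?_ ht0.le
  exact le_mul_of_one_le_right C.2 (one_le_pow₀ (by linarith [log_nonneg ht]))

/-- Solutions of the nonlinear Klein–Gordon equation with prescribed leading profile. -/
theorem exists_solution_lead (hA : CoshSchwartz A) (hκ : P.κ = (3 / 8 * β) • (A * A)) :
    ∃ T, 1 ≤ T ∧ ∃ v, SmoothAfter T v ∧
      (∀ t, T < t → ∀ x, box v t x + v t x = -β * v t x ^ 3) ∧
      ∃ C, 0 ≤ C ∧ ∀ t, T + 1 ≤ t →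
        eLpNorm (v t - cone (lead P A) t) ⊤ volume ≤ ENNReal.ofReal (C * decay t) ∧
        eLpNorm (v t - cone (lead P A) t) 2 volume ≤ ENNReal.ofReal (C * decay t) ∧
        eLpNorm (pt v t - pt (cone (lead P A)) t) 2 volume ≤ ENNReal.ofReal (C * decay t) ∧
        eLpNorm (px v t - px (cone (lead P A)) t) 2 volume ≤ ENNReal.ofReal (C * decay t) := by
  obtain ⟨C₀, hC₀⟩ := exists_Nsup_cutCone_le (P := P) hA
  obtain ⟨M₀, hM₀⟩ := exists_correction β C₀
  set M := max M₀ 1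
  have hM1 : 1 ≤ M := le_max_right _ _
  obtain ⟨V, hV, E, hE, hres⟩ := exists_approx (P := P) hA hκ ⌈2 * (M + 2)⌉₊
  obtain ⟨T₀, hT₀, hq⟩ := hC₀ V hV
  have hl : lead P A ∈ osc P 0 0 := lead_mem hA
  have hδ : V - lead P A ∈ osc P 0 0 := osc_mono zero_le_one le_rfl hV
  have hV0 : V ∈ osc P 0 0 := by simpa using add_mem hδ hl
  have hF : em * E ∈ osc P (⌈2 * (M + 2)⌉₊ + 1) 0 :=
    osc_mono (Nat.le_succ _) le_rfl (em_mul_mem' hE)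
  have hF0 : em * E ∈ osc P 0 0 := osc_mono (Nat.zero_le _) le_rfl hF
  have hk : 2 * (M + 2) ≤ ((⌈2 * (M + 2)⌉₊ + 1 : ℕ) : ℝ) := by
    push_cast
    linarith [Nat.le_ceil (2 * (M + 2))]
  obtain ⟨T, hT, w, hw, hweq, C, hw1, hw2, hw3, hw4⟩ := hM₀ M (le_max_left _ _) (cutCone V)
    (cutCone (em * E)) T₀ (by linarith) (smooth2_cutCone hV0) (smooth2_cutCone hF0)
    (fun t x h => cutCone_of_le h) hq
    (fun n => cN_ne_top_of_le (Nsup_mono_time hT₀)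
      (cN_cutCone_ne_top (Nsup_local _ 4) (fun W hW => cutCone_Nsup_ne_top hW) n V hV0))
    (fun n => cN_ne_top_of_le (Ntwo_mono_time hT₀)
      (cN_cutCone_ne_top (Ntwo_local _ 4) (fun W hW => cutCone_Ntwo_ne_top hk hW) n _ hF))
  replace hw : SmoothAfter T w := hw
  have hT1 : 1 ≤ T := by linarith
  have sδ := (smoothAfter_cone hδ).mono hT1
  have sl := (smoothAfter_cone hl).mono hT1
  have sV := (smoothAfter_cone hV0).mono hT1
  have hsplit : cone V = cone (V - lead P A) + cone (lead P A) := by rw [← cone_add]; simp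
  obtain ⟨C₁, hC₁, b₁⟩ := cone_eLpNorm_le hV
  obtain ⟨C₂, hC₂, b₂⟩ := cone_eLpNorm_le (coneT_mem hV)
  obtain ⟨C₃, hC₃, b₃⟩ := cone_eLpNorm_le (coneX_mem hV)
  refine ⟨T, hT1, cone V + w, sV.add hw, fun t ht x => ?_, C₁ + C₂ + C₃ + C, by positivity,
    fun t ht => ?_⟩
  · have e1 := hweq t ht x
    have e2 := box_cone (β := β) (x := x) hV0 (hT1.trans_lt ht)
    rw [cutCone_eq (by linarith), cutCone_eq (by linarith), ← hres] at e1
    rw [sV.box_add hw ht, Pi.add_apply, Pi.add_apply]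
    linear_combination e1 + e2
  · have ht' : T < t := by linarith
    have ht1 : 1 < t := hT1.trans_lt ht'
    have hd := decay_nonneg ht1.le
    have key : ∀ (f g h : ℝ → ℝ) (p : ℝ≥0∞) (c : ℝ), 1 ≤ p → 0 ≤ c → c ≤ C₁ + C₂ + C₃ →
        Continuous g → Continuous h → f = g + h →
        eLpNorm g p volume ≤ ENNReal.ofReal (c * decay t ^ 1) →
        eLpNorm h p volume ≤ ENNReal.ofReal (C * decay t) →
        eLpNorm f p volume ≤ ENNReal.ofReal ((C₁ + C₂ + C₃ + C) * decay t) := by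
      intro f g h p c hp hc0 hc hg hh hfgh h1 h2
      rw [hfgh]
      refine (eLpNorm_add_le hg.aestronglyMeasurable hh.aestronglyMeasurable hp).trans ?_
      refine (add_le_add h1 h2).trans ?_
      rw [← ENNReal.ofReal_add (by positivity) (by positivity), pow_one, ← add_mul]
      exact ENNReal.ofReal_le_ofReal (mul_le_mul_of_nonneg_right (by linarith) hd)
    have two : ∀ g, Ntwo M (T + 1) g ≤ C →
        eLpNorm (g t) 2 volume ≤ ENNReal.ofReal (C * decay t) := fun g hg =>
      le_decay_of_weight ht1.le hM1 ((le_Ntwo ht).trans hg)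
    have cδ := sδ.continuous_slice ht'
    have cw := hw.continuous_slice ht'
    have e0 : (cone V + w) t - cone (lead P A) t = cone (V - lead P A) t + w t := by
      rw [hsplit]; ext x; simp only [Pi.add_apply, Pi.sub_apply]; ring
    refine ⟨key _ _ _ _ C₁ le_top hC₁ (by linarith) cδ cw e0 (b₁ t ht1.le).1 ?_,
      key _ _ _ _ C₁ one_le_two hC₁ (by linarith) cδ cw e0 (b₁ t ht1.le).2 (two w hw2),
      key _ _ _ _ C₂ one_le_two hC₂ (by linarith) (sδ.pt.continuous_slice ht')
        (hw.pt.continuous_slice ht') ?_ ?_ (two _ hw3),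
      key _ _ _ _ C₃ one_le_two hC₃ (by linarith) (sδ.px.continuous_slice ht')
        (hw.px.continuous_slice ht') ?_ ?_ (two _ hw4)⟩
    · rw [eLpNorm_exponent_top]
      exact eLpNormEssSup_le_of_ae_enorm_bound (ae_of_all _ fun x =>
        le_decay_of_weight ht1.le hM1 ((le_Nsup ht x).trans hw1))
    · ext x
      rw [hsplit, Pi.sub_apply, (sδ.add sl).pt_add hw ht', sδ.pt_add sl ht', Pi.add_apply]
      ring
    · rw [show pt (cone (V - lead P A)) t = cone (coneT (V - lead P A)) t from
        funext fun x => pt_cone hδ ht1]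
      exact (b₂ t ht1.le).2
    · ext x
      rw [hsplit, Pi.sub_apply, (sδ.add sl).px_add hw ht', sδ.px_add sl ht', Pi.add_apply]
      ring
    · rw [show px (cone (V - lead P A)) t = cone (coneX (V - lead P A)) t from
        funext fun x => px_cone hδ ht1]
      exact (b₃ t ht1.le).2

end

section
variable {t x : ℝ}

lemma decay_le_shift (ht : 1 ≤ t) : decay t ≤ 2 * ((1 + log (1 + t)) ^ 2 * (1 + t)⁻¹) := by
  have h1 : (1 + log t) ^ 2 ≤ (1 + log (1 + t)) ^ 2 :=
    pow_le_pow_left₀ (by linarith [log_nonneg ht])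
      (by linarith [log_le_log (by linarith : 0 < t) (by linarith : t ≤ 1 + t)]) 2
  have h2 : t⁻¹ ≤ 2 * (1 + t)⁻¹ := by
    rw [← div_eq_mul_inv, le_div_iff₀ (by linarith), inv_mul_le_iff₀ (by linarith)]
    linarith
  calc decay t = (1 + log t) ^ 2 * t⁻¹ := div_eq_mul_inv _ _
    _ ≤ (1 + log (1 + t)) ^ 2 * (2 * (1 + t)⁻¹) := by gcongr
    _ = _ := by ring

lemma sqrt_eq_exp_radL (h : |x| < t) : √(t ^ 2 - x ^ 2) = exp (radL t x) := by
  rw [← exp_two_radL h, two_mul, exp_add, sqrt_mul_self (exp_pos _).le]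

lemma div_sqrt_eq_sinh (h : |x| < t) : x / √(t ^ 2 - x ^ 2) = sinh (angY t x) := by
  rw [sqrt_eq_exp_radL h, div_eq_iff (exp_pos _).ne', mul_comm]
  exact (exp_radL_mul h).2.symm

/-- The asymptotic profile determined by the scattering data `a` and `b`. -/
noncomputable def dataProfile (β : ℝ) {a b : ℝ → ℝ} (ha : CoshSchwartz (a ∘ sinh))
    (hb : ContDiff ℝ (⊤ : ℕ∞) b) (hb' : CoshSchwartz (deriv (b ∘ sinh))) : Profile where
  κ := (3 / 8 * β) • ((a ∘ sinh) * (a ∘ sinh))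
  B := b ∘ sinh
  hκ := (ha.mul ha).smul _
  hB := hb.comp contDiff_sinh
  hB' := hb'

lemma coshSchwartz_deriv_comp_sinh {b b₁ : ℝ → ℝ} {b₀ : ℝ} (hb : ∀ z, b z = b₀ + b₁ z)
    (hb₁ : ContDiff ℝ (⊤ : ℕ∞) b₁)
    (hdec : ∀ k N : ℕ, ∃ C : ℝ, ∀ z, |iteratedDeriv k b₁ z| ≤ C * (1 + |z|) ^ (-(N : ℝ))) :
    CoshSchwartz (deriv (b ∘ sinh)) := by
  have h := (coshSchwartz_comp_sinh hb₁ hdec).deriv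
  rwa [show b ∘ sinh = fun y => b₀ + (b₁ ∘ sinh) y from funext fun y => hb _, deriv_const_add']

end

end NLKG

open NLKG
/-- Long range scattering for the 1d cubic nonlinear Klein–Gordon equation:
given the modified asymptotic profile `v₀` built from rapidly decaying data `a, b₁`
(and constant `b₀`), there is a solution `v` of `□v + v = −βv³` for `t ≥ T`
agreeing with `v₀` at infinity. -/
theorem nlkg_long_range_scattering (β : ℝ) (a b₁ : ℝ → ℝ) (b₀ : ℝ)
    (ha : ContDiff ℝ (⊤ : ℕ∞) a) (hb₁ : ContDiff ℝ (⊤ : ℕ∞) b₁)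
    (hdecay : ∀ k N : ℕ, ∃ C : ℝ, ∀ z : ℝ,
      |iteratedDeriv k a z| + |iteratedDeriv k b₁ z| ≤ C * (1 + |z|) ^ (-(N : ℝ)))
    (b : ℝ → ℝ) (hb : ∀ z, b z = b₀ + b₁ z)
    (v₀ : ℝ → ℝ → ℝ)
    (hv₀ : ∀ t x : ℝ, v₀ t x =
      if |x| < t then
        (Real.sqrt (t ^ 2 - x ^ 2)) ^ (-(1 : ℝ) / 2) * a (x / Real.sqrt (t ^ 2 - x ^ 2)) *
          Real.cos (Real.sqrt (t ^ 2 - x ^ 2)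
            + (3 / 8) * β * (a (x / Real.sqrt (t ^ 2 - x ^ 2))) ^ 2
                * Real.log (Real.sqrt (t ^ 2 - x ^ 2))
            + b (x / Real.sqrt (t ^ 2 - x ^ 2)))
      else 0) :
    ∃ (T C : ℝ) (v : ℝ → ℝ → ℝ),
      ContDiffOn ℝ (⊤ : ℕ∞) (fun p : ℝ × ℝ => v p.1 p.2) (Set.Ici T ×ˢ Set.univ) ∧
      (∀ t ≥ T, ∀ x : ℝ, box v t x + v t x = -β * (v t x) ^ 3) ∧
      ∀ t ≥ T,
        eLpNorm (fun x => v t x - v₀ t x) ⊤ volume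
          + eLpNorm (fun x => v t x - v₀ t x) 2 volume
          + eLpNorm (fun x => pt v t x - pt v₀ t x) 2 volume
          + eLpNorm (fun x => px v t x - px v₀ t x) 2 volume
          ≤ ENNReal.ofReal (C * (1 + Real.log (1 + t)) ^ 2 * (1 + t)⁻¹) := by
  have da : ∀ k N : ℕ, ∃ C : ℝ, ∀ z, |iteratedDeriv k a z| ≤ C * (1 + |z|) ^ (-(N : ℝ)) :=
    fun k N => (hdecay k N).imp fun C hC z => (le_add_of_nonneg_right (abs_nonneg _)).trans (hC z)
  have db : ∀ k N : ℕ, ∃ C : ℝ, ∀ z, |iteratedDeriv k b₁ z| ≤ C * (1 + |z|) ^ (-(N : ℝ)) :=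
    fun k N => (hdecay k N).imp fun C hC z => (le_add_of_nonneg_left (abs_nonneg _)).trans (hC z)
  have hA := coshSchwartz_comp_sinh ha da
  have hbs : ContDiff ℝ (⊤ : ℕ∞) b := by
    rw [show b = fun z => b₀ + b₁ z from funext hb]
    exact contDiff_const.add hb₁
  set P := dataProfile β hA hbs (coshSchwartz_deriv_comp_sinh hb hb₁ db)
  have hv : v₀ = cone (lead P (a ∘ sinh)) := by
    ext t x
    rw [hv₀, cone]
    split_ifs with h
    · rw [div_sqrt_eq_sinh h, sqrt_eq_exp_radL h, log_exp, ← exp_mul, lead, gen, Profile.phase]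
      simp only [P, dataProfile, Pi.smul_apply, Pi.mul_apply, Function.comp_apply, smul_eq_mul]
      norm_num
      ring_nf
    · rfl
  obtain ⟨T, hT, v, hv1, hv2, C, hC, hv3⟩ := exists_solution_lead (P := P) (β := β) hA rfl
  refine ⟨T + 1, 8 * C, v, ContDiffOn.mono hv1 fun p hp => ?_, fun t ht x => hv2 t (by linarith) x,
    fun t ht => ?_⟩
  · exact lt_of_lt_of_le (by linarith) (Set.mem_Ici.1 hp.1)
  · obtain ⟨h1, h2, h3, h4⟩ := hv3 t ht
    rw [hv]
    refine (add_le_add (add_le_add (add_le_add h1 h2) h3) h4).trans ?_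
    have ht1 : 1 ≤ t := by linarith
    have hd : 0 ≤ C * decay t := mul_nonneg hC (decay_nonneg ht1)
    rw [← ENNReal.ofReal_add hd hd, ← ENNReal.ofReal_add (by positivity) hd,
      ← ENNReal.ofReal_add (by positivity) hd]
    refine ENNReal.ofReal_le_ofReal ?_
    linarith [mul_le_mul_of_nonneg_left (decay_le_shift ht1) hC]
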